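/- Let f : ℕ → ℂ be a non-identically-zero function that is periodic with period q ≥ 1, and let 0 < α < 1 be an algebraic irrational real number. Then the function F(s, f, α) = ∑_{n=0}^∞ f(n)/(n+α)^s has infinitely many zeros s with Re(s) > 1. -/

import Mathlib

section
open Complex Filter Topology Set MeasureTheory

/-- A nonvanishing holomorphic function on a convex open set has a holomorphic logarithm, which may
be chosen to extend a given logarithm on a convex open subset. -/
lemma exists_log_extending {Q P : Set ℂ} (hQ : Convex ℝ Q) (hQo : IsOpen Q) (hP : Convex ℝ P)
    (hPo : IsOpen P) (hPne : P.Nonempty) (hPQ : P ⊆ Q) {G l : ℂ → ℂ}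
    (hG : DifferentiableOn ℂ G Q) (hG0 : ∀ z ∈ Q, G z ≠ 0)
    (hl : DifferentiableOn ℂ l P) (hlG : ∀ z ∈ P, exp (l z) = G z) :
    ∃ g : ℂ → ℂ, DifferentiableOn ℂ g Q ∧ (∀ z ∈ Q, exp (g z) = G z) ∧ ∀ z ∈ P, g z = l z := by
  have hd : DifferentiableOn ℂ (fun z => deriv G z / G z) Q :=
    (hG.deriv hQo).div hG hG0
  obtain ⟨g, hg⟩ := hQ.exists_forall_hasDerivWithinAt hd
  replace hg : ∀ a ∈ Q, HasDerivAt g (deriv G a / G a) a := fun a ha =>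
    (hg a ha).hasDerivAt (hQo.mem_nhds ha)
  have hGd : ∀ a ∈ Q, HasDerivAt G (deriv G a) a := fun a ha =>
    (hG.differentiableAt (hQo.mem_nhds ha)).hasDerivAt
  have hld : ∀ a ∈ P, HasDerivAt l (deriv G a / G a) a := by
    intro a ha
    have h1 := (hl.differentiableAt (hPo.mem_nhds ha)).hasDerivAt
    have h2 : HasDerivAt G (exp (l a) * deriv l a) a := by
      refine h1.cexp.congr_of_eventuallyEq ?_
      filter_upwards [hPo.mem_nhds ha] with z hz using (hlG z hz).symm
    rw [h2.deriv, hlG a ha, mul_div_cancel_left₀ _ (hG0 a (hPQ ha))]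
    exact h1
  obtain ⟨p, hp⟩ := hPne
  have hconst : ∀ z ∈ P, g z - l z = g p - l p := by
    intro z hz
    refine hPo.is_const_of_deriv_eq_zero (f := fun z => g z - l z) hP.isPreconnected
      (fun a ha => ((hg a (hPQ ha)).sub (hld a ha)).differentiableAt.differentiableWithinAt)
      (fun a ha => ?_) hz hp
    exact (((hg a (hPQ ha)).sub (hld a ha)).deriv).trans (sub_self _)
  refine ⟨fun z => g z - (g p - l p), fun a ha =>
    ((hg a ha).sub_const _).differentiableAt.differentiableWithinAt, ?_, ?_⟩
  · have hc : ∀ z ∈ Q, G z * exp (-(g z - (g p - l p))) = 1 := by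
      intro z hz
      have hd : ∀ a ∈ Q, HasDerivAt (fun z => G z * exp (-(g z - (g p - l p)))) 0 a := by
        intro a ha
        refine ((hGd a ha).mul (((hg a ha).sub_const _).neg.cexp)).congr_deriv ?_
        field_simp [hG0 a ha]
        ring
      have := hQo.is_const_of_deriv_eq_zero (f := fun z => G z * exp (-(g z - (g p - l p))))
        hQ.isPreconnected (fun a ha => (hd a ha).differentiableAt.differentiableWithinAt)
        (fun a ha => (hd a ha).deriv) hz (hPQ hp)
      refine this.trans ?_
      simp only [sub_sub_cancel]
      rw [← hlG p hp, ← exp_add]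
      simp
    intro z hz
    have := hc z hz
    rw [exp_neg] at this
    field_simp at this
    exact this.symm
  · intro z hz
    have := hconst z hz
    simp only
    rw [← this]; ring

/-- `φ` has asymptotic mean value `L` along `[b, ∞)`. -/
def HasMean (b : ℝ) (φ : ℝ → ℂ) (L : ℂ) : Prop :=
  Tendsto (fun T : ℝ => (T : ℂ)⁻¹ * ∫ t in b..T, φ t) atTop (𝓝 L)

/-- The oscillation `y ^ (i t)` for positive `y`. -/
noncomputable def osc (y t : ℝ) : ℂ := cexp ((t * Real.log y : ℝ) * I)

lemma continuous_osc (y : ℝ) : Continuous (osc y) := by unfold osc; fun_prop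

lemma norm_osc (y t : ℝ) : ‖osc y t‖ = 1 := norm_exp_ofReal_mul_I _

lemma osc_mul {y z : ℝ} (hy : 0 < y) (hz : 0 < z) (t : ℝ) :
    osc (y * z) t = osc y t * osc z t := by
  unfold osc
  rw [Real.log_mul hy.ne' hz.ne', ← exp_add]
  push_cast; ring_nf

lemma osc_inv (y t : ℝ) : osc y⁻¹ t = (starRingEnd ℂ) (osc y t) := by
  unfold osc
  rw [Real.log_inv, ← exp_conj]
  simp

lemma osc_one (t : ℝ) : osc 1 t = 1 := by simp [osc]

namespace HasMean
variable {b : ℝ}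

lemma congr {φ ψ : ℝ → ℂ} {L : ℂ} (h : HasMean b φ L) (hφ : ∀ t, b ≤ t → φ t = ψ t) :
    HasMean b ψ L := by
  refine Tendsto.congr' ?_ h
  filter_upwards [eventually_ge_atTop b] with T hT
  congr 1
  refine intervalIntegral.integral_congr fun t ht => hφ t ?_
  rw [uIcc_of_le hT] at ht
  exact ht.1

lemma const (c : ℂ) : HasMean b (fun _ => c) c := by
  have h1 : Tendsto (fun T : ℝ => (1 - T⁻¹ * b : ℝ)) atTop (𝓝 (1 - 0 * b)) :=
    (tendsto_inv_atTop_zero.mul_const b).const_sub 1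
  have h2 : Tendsto (fun T : ℝ => ((1 - T⁻¹ * b : ℝ) : ℂ) * c) atTop
      (𝓝 (((1 - 0 * b : ℝ) : ℂ) * c)) :=
    ((continuous_ofReal.tendsto _).comp h1).mul_const c
  simp only [zero_mul, sub_zero, ofReal_one, one_mul] at h2
  refine Tendsto.congr' ?_ h2
  filter_upwards [eventually_gt_atTop 0] with T hT
  have : (T : ℂ) ≠ 0 := by exact_mod_cast hT.ne'
  rw [intervalIntegral.integral_const]
  simp only [real_smul]
  push_cast
  field_simp

lemma const_mul {φ : ℝ → ℂ} {L : ℂ} (h : HasMean b φ L) (c : ℂ) :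
    HasMean b (fun t => c * φ t) (c * L) := by
  refine (Tendsto.const_mul c h).congr fun T => ?_
  rw [intervalIntegral.integral_const_mul]; ring

lemma of_antideriv {φ Φ : ℝ → ℂ} (hφ : Continuous φ) (hd : ∀ t, HasDerivAt Φ (φ t) t) {C : ℝ}
    (hC : ∀ t, ‖Φ t‖ ≤ C) : HasMean b φ 0 := by
  have h0 : Tendsto (fun T : ℝ => T⁻¹ * (C + C)) atTop (𝓝 0) := by
    simpa using tendsto_inv_atTop_zero.mul_const (C + C)
  refine squeeze_zero_norm' ?_ h0
  filter_upwards [eventually_gt_atTop 0] with T hT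
  rw [intervalIntegral.integral_eq_sub_of_hasDerivAt (fun t _ => hd t)
    (hφ.intervalIntegrable _ _), norm_mul, norm_inv, norm_real, Real.norm_of_nonneg hT.le]
  gcongr
  exact (norm_sub_le _ _).trans (add_le_add (hC _) (hC _))

lemma osc_of_ne_one {y : ℝ} (hy : 0 < y) (hy1 : y ≠ 1) : HasMean b (osc y) 0 := by
  have hl : Real.log y ≠ 0 := Real.log_ne_zero_of_pos_of_ne_one hy hy1
  have hlc : (Real.log y : ℂ) ≠ 0 := by exact_mod_cast hl
  refine of_antideriv (continuous_osc y) (Φ := fun t => osc y t / (Real.log y * I))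
    (C := 1 / |Real.log y|) (fun t => ?_) (fun t => ?_)
  · unfold osc
    have h1 : HasDerivAt (fun t : ℝ => ((t * Real.log y : ℝ) : ℂ) * I) (Real.log y * I) t := by
      have := (((hasDerivAt_id t).mul_const (Real.log y)).ofReal_comp).mul_const I
      simpa using this
    refine (h1.cexp.div_const _).congr_deriv ?_
    field_simp [I_ne_zero]
  · simp [norm_osc]

lemma sum {ι : Type*} {s : Finset ι} {φ : ι → ℝ → ℂ} {L : ι → ℂ}
    (hφ : ∀ i ∈ s, ContinuousOn (φ i) (Ici b))
    (h : ∀ i ∈ s, HasMean b (φ i) (L i)) :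
    HasMean b (fun t => ∑ i ∈ s, φ i t) (∑ i ∈ s, L i) := by
  refine Tendsto.congr' ?_ (tendsto_finsetSum s h)
  filter_upwards [eventually_ge_atTop b] with T hT
  rw [intervalIntegral.integral_finsetSum, Finset.mul_sum]
  intro i hi
  refine ((hφ i hi).mono ?_).intervalIntegrable
  rw [uIcc_of_le hT]
  exact Icc_subset_Ici_self

lemma tsum {φ : ℕ → ℝ → ℂ} {L : ℕ → ℂ} {c : ℕ → ℝ}
    (hφ : ∀ k, Continuous (φ k)) (hc : Summable c) (hb : ∀ k t, ‖φ k t‖ ≤ c k)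
    (h : ∀ k, HasMean b (φ k) (L k)) :
    HasMean b (fun t => ∑' k, φ k t) (∑' k, L k) := by
  have hc0 : ∀ k, 0 ≤ c k := fun k => (norm_nonneg _).trans (hb k 0)
  have key := tendsto_tsum_of_dominated_convergence (𝓕 := atTop)
    (f := fun (T : ℝ) k => (T : ℂ)⁻¹ * ∫ t in b..T, φ k t) (g := L)
    (bound := fun k => c k * (1 + |b|)) (hc.mul_right _) (fun k => h k) ?_
  · refine Tendsto.congr' ?_ key
    filter_upwards [eventually_ge_atTop b] with T hT
    rw [tsum_mul_left]
    congr 1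
    refine (intervalIntegral.hasSum_integral_of_dominated_convergence (fun k _ => c k)
      (fun k => (hφ k).aestronglyMeasurable) (fun k => ?_) ?_ ?_ ?_).tsum_eq
    · exact Eventually.of_forall fun t _ => hb k t
    · exact Eventually.of_forall fun t _ => hc
    · exact intervalIntegrable_const
    · exact Eventually.of_forall fun t _ =>
        (Summable.of_norm_bounded hc fun k => hb k t).hasSum
  · filter_upwards [eventually_ge_atTop (max 1 b)] with T hT k
    have h1 : 1 ≤ T := (le_max_left _ _).trans hT
    have h2 : b ≤ T := (le_max_right _ _).trans hT
    have h3 := intervalIntegral.norm_integral_le_of_norm_le_const (a := b) (b := T) (f := φ k)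
      (C := c k) (fun t _ => hb k t)
    have h4 : |T - b| ≤ T * (1 + |b|) := by
      rw [abs_of_nonneg (by linarith)]
      nlinarith [neg_abs_le b, abs_nonneg b]
    rw [norm_mul, norm_inv, norm_real, Real.norm_of_nonneg (by linarith)]
    calc T⁻¹ * ‖∫ t in b..T, φ k t‖ ≤ T⁻¹ * (c k * (T * (1 + |b|))) := by
          gcongr
          exact h3.trans (mul_le_mul_of_nonneg_left h4 (hc0 k))
      _ = c k * (1 + |b|) := by
          field_simp

end HasMean

section LogSeries
variable {b : ℝ} {c : ℕ → ℂ} {x : ℕ → ℝ}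

/-- The almost periodic function with coefficients `c` and frequencies `-log x`. -/
noncomputable def apSum (c : ℕ → ℂ) (x : ℕ → ℝ) (t : ℝ) : ℂ := ∑' k, c k * osc (x k)⁻¹ t

lemma summable_norm_apSum (hc : Summable fun k => ‖c k‖) (t : ℝ) :
    Summable fun k => ‖c k * osc (x k)⁻¹ t‖ := by
  simpa [norm_osc] using hc

lemma norm_apSum_le (hc : Summable fun k => ‖c k‖) (hh : ∑' k, ‖c k‖ ≤ 1 / 2) (t : ℝ) :
    ‖apSum c x t‖ ≤ 1 / 2 := by
  refine (norm_tsum_le_tsum_norm (summable_norm_apSum hc t)).trans ?_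
  simpa [norm_osc] using hh

lemma continuous_apSum (hc : Summable fun k => ‖c k‖) : Continuous (apSum c x) := by
  refine continuous_tsum (u := fun k => ‖c k‖) (fun k => ?_) hc (fun k t => ?_)
  · exact continuous_const.mul (continuous_osc _)
  · simp [norm_osc]

lemma hasMean_apSum_pow (hc : Summable fun k => ‖c k‖) (hh : ∑' k, ‖c k‖ ≤ 1 / 2)
    (hx : ∀ k, 0 < x k) (m : ℕ) : ∀ y : ℝ, 0 < y →
    (∀ l : List ℕ, l.length = m → y ≠ (l.map x).prod) →
    HasMean b (fun t => apSum c x t ^ m * osc y t) 0 := by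
  induction m with
  | zero =>
    intro y hy h
    simpa using HasMean.osc_of_ne_one (b := b) hy (by simpa using h [] rfl)
  | succ m ih =>
    intro y hy h
    have key := HasMean.tsum (b := b) (L := fun _ => 0)
      (φ := fun k t => c k * (apSum c x t ^ m * osc (y * (x k)⁻¹) t))
      (c := fun k => ‖c k‖ * (1 / 2) ^ m)
      (fun k => continuous_const.mul (((continuous_apSum hc).pow m).mul (continuous_osc _)))
      (hc.mul_right _) (fun k t => ?_) (fun k => ?_)
    · refine (tsum_zero (α := ℂ) (β := ℕ) ▸ key).congr fun t _ => ?_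
      have e : ∀ k, c k * (apSum c x t ^ m * osc (y * (x k)⁻¹) t)
          = apSum c x t ^ m * osc y t * (c k * osc (x k)⁻¹ t) := fun k => by
        rw [osc_mul hy (inv_pos.mpr (hx k))]; ring
      simp_rw [e]
      rw [tsum_mul_left]
      change _ * apSum c x t = _
      ring
    · rw [norm_mul, norm_mul, norm_pow, norm_osc, mul_one]
      gcongr
      exact norm_apSum_le hc hh t
    · have := ih (y * (x k)⁻¹) (mul_pos hy (inv_pos.mpr (hx k))) ?_
      · simpa using this.const_mul (c k)
      · intro l hl he
        refine h (k :: l) (by simp [hl]) ?_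
        rw [List.map_cons, List.prod_cons, ← he]
        field_simp [(hx k).ne']

lemma hasMean_apSum_single (hc : Summable fun k => ‖c k‖) (hx : ∀ k, 0 < x k) {i : ℕ}
    (hi : ∀ k, x k = x i → k = i) :
    HasMean b (fun t => apSum c x t * osc (x i) t) (c i) := by
  have key := HasMean.tsum (b := b) (L := fun k => if k = i then c i else 0)
      (φ := fun k t => c k * osc (x i * (x k)⁻¹) t)
      (c := fun k => ‖c k‖)
      (fun k => continuous_const.mul (continuous_osc _))
      hc (fun k t => by simp [norm_osc]) (fun k => ?_)
  · rw [tsum_ite_eq] at key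
    refine key.congr fun t _ => ?_
    have e : ∀ k, c k * osc (x i * (x k)⁻¹) t = osc (x i) t * (c k * osc (x k)⁻¹ t) := fun k => by
        rw [osc_mul (hx i) (inv_pos.mpr (hx k))]; ring
    simp_rw [e]
    rw [tsum_mul_left, mul_comm]
    rfl
  · split_ifs with h
    · subst h
      rw [mul_inv_cancel₀ (hx k).ne']
      simpa [osc_one] using HasMean.const (b := b) (c k)
    · have := (HasMean.osc_of_ne_one (b := b) (y := x i * (x k)⁻¹)
        (mul_pos (hx i) (inv_pos.mpr (hx k))) ?_).const_mul (c k)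
      · simpa using this
      · intro h1
        apply h
        apply hi
        field_simp [(hx k).ne'] at h1
        exact h1.symm

/-- Mean values of `log (1 + u)` against oscillations, from the Taylor series of the logarithm. -/
lemma hasMean_log {y : ℝ} (hc : Summable fun k => ‖c k‖) (hh : ∑' k, ‖c k‖ ≤ 1 / 2)
    {M : ℕ → ℂ}
    (h : ∀ m, HasMean b (fun t => apSum c x t ^ (m + 1) * osc y t) (M m)) :
    HasMean b (fun t => log (1 + apSum c x t) * osc y t)
      (∑' m : ℕ, (-1) ^ m / (m + 1 : ℂ) * M m) := by
  have key := HasMean.tsum (b := b) (L := fun m => (-1) ^ m / (m + 1 : ℂ) * M m)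
      (φ := fun m t => (-1) ^ m / (m + 1 : ℂ) * (apSum c x t ^ (m + 1) * osc y t))
      (c := fun m => (1 / 2) ^ m)
      (fun k => continuous_const.mul (((continuous_apSum hc).pow _).mul (continuous_osc _)))
      (summable_geometric_of_lt_one (by norm_num) (by norm_num)) (fun k t => ?_)
      (fun m => (h m).const_mul _)
  · refine key.congr fun t _ => ?_
    have hu := norm_apSum_le (x := x) hc hh t
    have := (hasSum_taylorSeries_log (z := apSum c x t) (by linarith))
    rw [← hasSum_nat_add_iff' 1] at this
    simp only [Finset.range_one, Finset.sum_singleton, CharP.cast_eq_zero, div_zero,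
      sub_zero] at this
    rw [← this.tsum_eq, ← tsum_mul_right]
    refine tsum_congr fun m => ?_
    push_cast
    ring
  · have hu := norm_apSum_le (x := x) hc hh t
    have h1 : ‖(k + 1 : ℂ)‖ = k + 1 := by exact_mod_cast norm_natCast (k + 1)
    rw [norm_mul, norm_mul, norm_pow, norm_osc, mul_one, norm_div, h1, norm_pow, norm_neg,
      norm_one, one_pow]
    calc 1 / ((k : ℝ) + 1) * ‖apSum c x t‖ ^ (k + 1) ≤ 1 * (1 / 2) ^ (k + 1) := by
          gcongr
          rw [div_le_one (by positivity)]
          linarith [(Nat.cast_nonneg k : (0 : ℝ) ≤ k)]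
      _ ≤ (1 / 2) ^ k := by
          rw [pow_succ, one_mul]
          nlinarith [pow_pos (show (0 : ℝ) < 1 / 2 by norm_num) k]

end LogSeries

section DirichletSeries
variable {a : ℕ → ℂ} {x : ℕ → ℝ}

/-- A generalized Dirichlet series with coefficients `a` and frequencies `log x`. -/
noncomputable def genDirichlet (a : ℕ → ℂ) (x : ℕ → ℝ) (s : ℂ) : ℂ := ∑' k, a k * (x k : ℂ) ^ (-s)

lemma norm_genDirichlet_term (hx : ∀ k, 1 < x k) (k : ℕ) (s : ℂ) :
    ‖a k * (x k : ℂ) ^ (-s)‖ = ‖a k‖ * x k ^ (-s.re) := by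
  rw [norm_mul, norm_cpow_eq_rpow_re_of_pos (by linarith [hx k]), neg_re]

lemma summable_genDirichlet (hx : ∀ k, 1 < x k)
    (hs : ∀ σ : ℝ, 1 < σ → Summable fun k => ‖a k‖ * x k ^ (-σ)) {s : ℂ} (h1 : 1 < s.re) :
    Summable fun k => ‖a k * (x k : ℂ) ^ (-s)‖ := by
  simp_rw [norm_genDirichlet_term hx]
  exact hs _ h1

lemma norm_genDirichlet_le (hx : ∀ k, 1 < x k)
    (hs : ∀ σ : ℝ, 1 < σ → Summable fun k => ‖a k‖ * x k ^ (-σ)) {s : ℂ} {σ : ℝ} (h1 : 1 < σ)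
    (h2 : σ ≤ s.re) : ‖genDirichlet a x s‖ ≤ ∑' k, ‖a k‖ * x k ^ (-σ) := by
  have h3 := summable_genDirichlet hx hs (h1.trans_le h2)
  refine (norm_tsum_le_tsum_norm h3).trans (h3.tsum_le_tsum (fun k => ?_) (hs _ h1))
  rw [norm_genDirichlet_term hx]
  gcongr
  exact (hx k).le

lemma differentiableOn_genDirichlet (hx : ∀ k, 1 < x k)
    (hs : ∀ σ : ℝ, 1 < σ → Summable fun k => ‖a k‖ * x k ^ (-σ)) :
    DifferentiableOn ℂ (genDirichlet a x) {s | 1 < s.re} := by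
  intro s hsr
  have hsr' : 1 < s.re := hsr
  obtain ⟨σ, h1, h2⟩ := exists_between hsr'
  have hopen : IsOpen {s : ℂ | σ < s.re} := isOpen_lt continuous_const continuous_re
  refine DifferentiableAt.differentiableWithinAt ?_
  refine DifferentiableOn.differentiableAt (s := {s : ℂ | σ < s.re}) ?_ (hopen.mem_nhds h2)
  refine differentiableOn_tsum_of_summable_norm (hs σ h1) (fun k => ?_) hopen (fun k w hw => ?_)
  · have : (x k : ℂ) ≠ 0 := by exact_mod_cast (by linarith [hx k] : x k ≠ 0)
    exact ((differentiable_id.neg.const_cpow (Or.inl this)).const_mul _).differentiableOn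
  · rw [norm_genDirichlet_term hx]
    have hw' : σ < w.re := hw
    gcongr
    exact (hx k).le

lemma genDirichlet_eq_apSum (hx : ∀ k, 1 < x k) (σ t : ℝ) :
    genDirichlet a x (σ + t * I) = apSum (fun k => a k * (x k ^ (-σ) : ℝ)) x t := by
  refine tsum_congr fun k => ?_
  have h0 : 0 < x k := by linarith [hx k]
  have hne : (x k : ℂ) ≠ 0 := by exact_mod_cast h0.ne'
  rw [mul_assoc, neg_add, cpow_add _ _ hne, ofReal_cpow h0.le]
  congr 2
  · simp
  · rw [cpow_def_of_ne_zero hne, osc, ← ofReal_log h0.le, Real.log_inv]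
    congr 1
    push_cast; ring

lemma exists_tsum_le_half (hx : ∀ k, 1 < x k) {c : ℝ} (hc : 1 < c) (hcx : ∀ k, c ≤ x k)
    (hs : ∀ σ : ℝ, 1 < σ → Summable fun k => ‖a k‖ * x k ^ (-σ)) :
    ∃ σ₁ : ℝ, 2 < σ₁ ∧ ∑' k, ‖a k‖ * x k ^ (-σ₁) ≤ 1 / 2 := by
  set S := ∑' k, ‖a k‖ * x k ^ (-2 : ℝ) with hS
  obtain ⟨n, hn⟩ := ((tendsto_pow_atTop_atTop_of_one_lt hc).eventually_ge_atTop (2 * S)).exists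
  have hn' : 2 * S ≤ c ^ (n + 1) := hn.trans (pow_le_pow_right₀ hc.le (by omega))
  have hcp : 0 < c ^ (n + 1) := by positivity
  refine ⟨2 + (n + 1 : ℕ), by push_cast; linarith [(Nat.cast_nonneg n : (0 : ℝ) ≤ n)], ?_⟩
  have key : ∀ k, ‖a k‖ * x k ^ (-(2 + (n + 1 : ℕ)) : ℝ) ≤
      ‖a k‖ * x k ^ (-2 : ℝ) * (c ^ (n + 1))⁻¹ := by
    intro k
    have h0 : 0 < x k := by linarith [hx k]
    rw [neg_add, Real.rpow_add h0, Real.rpow_neg h0.le (((n + 1 : ℕ) : ℝ)), Real.rpow_natCast,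
      ← mul_assoc]
    gcongr
    exact hcx k
  calc ∑' k, ‖a k‖ * x k ^ (-(2 + (n + 1 : ℕ)) : ℝ)
      ≤ ∑' k, ‖a k‖ * x k ^ (-2 : ℝ) * (c ^ (n + 1))⁻¹ :=
        (hs _ (by push_cast; linarith [(Nat.cast_nonneg n : (0 : ℝ) ≤ n)])).tsum_le_tsum key
          ((hs 2 (by norm_num)).mul_right _)
    _ = S * (c ^ (n + 1))⁻¹ := by rw [tsum_mul_right]
    _ ≤ 1 / 2 := by
      rw [mul_inv_le_iff₀ hcp]; linarith

/-- Shifting the line of integration of an almost periodic mean value. -/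
lemma HasMean.shift {g : ℂ → ℂ} {b σ σ₁ C : ℝ} (hσ : σ ≤ σ₁)
    (hg : DifferentiableOn ℂ g {s | σ ≤ s.re ∧ b ≤ s.im})
    (hb : ∀ s : ℂ, σ ≤ s.re → s.re ≤ σ₁ → b ≤ s.im → ‖g s‖ ≤ C) {y : ℝ} (hy : 0 < y) {L : ℂ}
    (h : HasMean b (fun t => g (σ₁ + t * I) * osc y t) L) :
    HasMean b (fun t => g (σ + t * I) * osc y t) ((y ^ (σ₁ - σ) : ℝ) * L) := by
  set f : ℂ → ℂ := fun s => g s * cexp ((s - σ) * Real.log y) with hf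
  have hfd : DifferentiableOn ℂ f {s | σ ≤ s.re ∧ b ≤ s.im} :=
    hg.mul (by fun_prop)
  have hf1 : ∀ t : ℝ, f (σ₁ + t * I) = (y ^ (σ₁ - σ) : ℝ) * (g (σ₁ + t * I) * osc y t) := by
    intro t
    simp only [hf, osc]
    rw [Real.rpow_def_of_pos hy, ofReal_exp, mul_left_comm, ← exp_add]
    congr 2
    push_cast; ring
  have hf0 : ∀ t : ℝ, f (σ + t * I) = g (σ + t * I) * osc y t := by
    intro t
    simp only [hf, osc]
    congr 2
    push_cast; ring
  have hC : 0 ≤ C := (norm_nonneg _).trans (hb ((σ : ℂ) + b * I) (by simp) (by simpa) (by simp))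
  set D := C * Real.exp ((σ₁ - σ) * |Real.log y|) with hD
  have hfb : ∀ s : ℂ, σ ≤ s.re → s.re ≤ σ₁ → b ≤ s.im → ‖f s‖ ≤ D := by
    intro s h1 h2 h3
    rw [hf, hD, norm_mul, norm_exp]
    gcongr
    · exact hb s h1 h2 h3
    · have h4 : 0 ≤ s.re - σ := by linarith
      simp only [mul_re, sub_re, ofReal_re, ofReal_im, mul_zero, sub_zero]
      calc (s.re - σ) * Real.log y ≤ (s.re - σ) * |Real.log y| := by
            gcongr
            exact le_abs_self _
        _ ≤ _ := by gcongr
  have hrect : ∀ T, b ≤ T → ‖(∫ t in b..T, f (σ₁ + t * I)) - ∫ t in b..T, f (σ + t * I)‖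
      ≤ 2 * (D * (σ₁ - σ)) := by
    intro T hT
    have h1 := integral_boundary_rect_eq_zero_of_differentiableOn f (⟨σ, b⟩ : ℂ) (⟨σ₁, T⟩ : ℂ)
      (hfd.mono ?_)
    · simp only at h1
      have hn : ∀ v, b ≤ v → ‖∫ r in σ..σ₁, f (r + v * I)‖ ≤ D * (σ₁ - σ) := by
        intro v hv
        have := intervalIntegral.norm_integral_le_of_norm_le_const (a := σ) (b := σ₁)
          (f := fun r : ℝ => f (r + v * I)) (C := D) (fun r hr => ?_)
        · rwa [abs_of_nonneg (sub_nonneg.mpr hσ)] at this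
        · rw [uIoc_of_le hσ] at hr
          refine hfb _ ?_ ?_ ?_
          · simpa using hr.1.le
          · simpa using hr.2
          · simpa using hv
      have h2 : I • ((∫ t in b..T, f (σ₁ + t * I)) - ∫ t in b..T, f (σ + t * I)) =
          (∫ r in σ..σ₁, f (r + T * I)) - ∫ r in σ..σ₁, f (r + b * I) := by
        rw [smul_sub]
        linear_combination h1
      have h3 := congrArg norm h2
      rw [norm_smul, norm_I, one_mul] at h3
      rw [h3]
      refine (norm_sub_le _ _).trans ?_
      linarith [hn T hT, hn b le_rfl]
    · rintro s ⟨h1, h2⟩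
      simp only [mem_preimage, uIcc_of_le hσ, uIcc_of_le hT] at h1 h2
      exact ⟨h1.1, h2.1⟩
  have hm : HasMean b (fun t => f (σ₁ + t * I)) ((y ^ (σ₁ - σ) : ℝ) * L) :=
    (h.const_mul _).congr fun t _ => (hf1 t).symm
  have hdiff : Tendsto (fun T : ℝ => (T : ℂ)⁻¹ *
      ((∫ t in b..T, f (σ₁ + t * I)) - ∫ t in b..T, f (σ + t * I))) atTop (𝓝 0) := by
    have h0 : Tendsto (fun T : ℝ => T⁻¹ * (2 * (D * (σ₁ - σ)))) atTop (𝓝 0) := by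
      simpa using tendsto_inv_atTop_zero.mul_const (2 * (D * (σ₁ - σ)))
    refine squeeze_zero_norm' ?_ h0
    filter_upwards [eventually_gt_atTop 0, eventually_ge_atTop b] with T hT hTb
    rw [norm_mul, norm_inv, norm_real, Real.norm_of_nonneg hT.le]
    gcongr
    exact hrect T hTb
  have hfin := Tendsto.sub hm hdiff
  rw [sub_zero] at hfin
  refine HasMean.congr (φ := fun t => f (σ + t * I)) ?_ (fun t _ => hf0 t)
  refine hfin.congr fun T => ?_
  ring

end DirichletSeries

section
variable {a : ℕ → ℂ} {x : ℕ → ℝ}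

lemma re_le_of_exp_eq {z w : ℂ} {B : ℝ} (h : exp z = 1 + w) (hw : ‖w‖ ≤ B) :
    z.re ≤ Real.log (1 + B) := by
  have h1 : Real.exp z.re ≤ 1 + B := by
    rw [← norm_exp, h]
    exact (norm_add_le _ _).trans (by simpa using hw)
  exact (Real.le_log_iff_exp_le ((Real.exp_pos _).trans_le h1)).mpr h1

lemma exists_log_mean (hx : ∀ k, 1 < x k) {c : ℝ} (hc : 1 < c) (hcx : ∀ k, c ≤ x k)
    (hs : ∀ σ : ℝ, 1 < σ → Summable fun k => ‖a k‖ * x k ^ (-σ)) {t₀ : ℝ}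
    (hne : ∀ s : ℂ, 1 < s.re → t₀ < s.im → 1 + genDirichlet a x s ≠ 0) {σ : ℝ} (hσ : 1 < σ)
    (hσ2 : σ ≤ 2) :
    ∃ (b : ℝ) (φ : ℝ → ℂ), ContinuousOn φ (Ici b) ∧
      (∀ t, b ≤ t → exp (φ t) = 1 + genDirichlet a x (σ + t * I)) ∧
      (∀ y, 0 < y → (∀ l : List ℕ, l ≠ [] → y ≠ (l.map x).prod) →
        HasMean b (fun t => φ t * osc y t) 0) ∧
      (∀ i, (∀ l : List ℕ, l ≠ [] → x i = (l.map x).prod → l = [i]) →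
        HasMean b (fun t => φ t * osc (x i) t) (a i * (x i ^ (-σ) : ℝ))) := by
  obtain ⟨σ₁, hσ₁, hhalf⟩ := exists_tsum_le_half hx hc hcx hs
  have hx0 : ∀ k, 0 < x k := fun k => by linarith [hx k]
  have hdiff : DifferentiableOn ℂ (fun s => 1 + genDirichlet a x s) {s | 1 < s.re} :=
    (differentiableOn_genDirichlet hx hs).const_add 1
  have hu : ∀ s : ℂ, σ₁ ≤ s.re → ‖genDirichlet a x s‖ ≤ 1 / 2 := fun s h =>
    (norm_genDirichlet_le hx hs (by linarith) h).trans hhalf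
  have half : ∀ r : ℝ, Convex ℝ {s : ℂ | r < s.re ∧ t₀ < s.im} ∧
      IsOpen {s : ℂ | r < s.re ∧ t₀ < s.im} := fun r =>
    ⟨(convex_halfSpace_re_gt r).inter (convex_halfSpace_im_gt t₀),
      (isOpen_lt continuous_const continuous_re).inter (isOpen_lt continuous_const continuous_im)⟩
  have hlogd : DifferentiableOn ℂ (fun s => log (1 + genDirichlet a x s))
      {s | σ₁ < s.re ∧ t₀ < s.im} := by
    intro s h
    have h1 : 1 < s.re := by linarith [h.1]
    have hopen : IsOpen {s : ℂ | 1 < s.re} := isOpen_lt continuous_const continuous_re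
    refine DifferentiableAt.differentiableWithinAt ?_
    refine (hdiff.differentiableAt (hopen.mem_nhds h1)).clog ?_
    exact mem_slitPlane_of_norm_lt_one (by linarith [hu s h.1.le])
  obtain ⟨g, hgd, hgexp, hglog⟩ := exists_log_extending (Q := {s | 1 < s.re ∧ t₀ < s.im})
    (P := {s | σ₁ < s.re ∧ t₀ < s.im}) (half 1).1 (half 1).2 (half σ₁).1 (half σ₁).2
    ⟨⟨σ₁ + 1, t₀ + 1⟩, by simp⟩ (fun s h => ⟨by linarith [h.1], h.2⟩)
    (G := fun s => 1 + genDirichlet a x s) (l := fun s => log (1 + genDirichlet a x s))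
    (hdiff.mono fun s h => h.1) (fun s h => hne s h.1 h.2) hlogd
    (fun s h => exp_log (hne s (by linarith [h.1]) h.2))
  set σ₂ := σ₁ + 1 with hσ₂
  set σ' := (1 + σ) / 2 with hσ'
  set b := t₀ + (σ₂ - σ') + 1 with hb
  set M := Real.log (1 + ∑' k, ‖a k‖ * x k ^ (-σ')) + 1 with hM
  have hSnn : 0 ≤ ∑' k, ‖a k‖ * x k ^ (-σ') :=
    tsum_nonneg fun k => mul_nonneg (norm_nonneg _) (Real.rpow_nonneg (hx0 k).le _)
  have hMpos : 0 < M := by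
    have := Real.log_nonneg (x := 1 + ∑' k, ‖a k‖ * x k ^ (-σ')) (by linarith)
    rw [hM]; linarith
  have hbound : ∃ C, ∀ s : ℂ, σ ≤ s.re → s.re ≤ σ₂ → b ≤ s.im → ‖g s‖ ≤ C := by
    set R := σ₂ - σ' with hR
    set r := σ₂ - σ with hr
    have hRr : 0 < R - r := by rw [hR, hr, hσ']; linarith
    have hr0 : 0 < r := by rw [hr]; linarith
    refine ⟨2 * M * r / (R - r) + 1 * (R + r) / (R - r), fun s h1 h2 h3 => ?_⟩
    set z₀ : ℂ := ⟨σ₂, s.im⟩ with hz₀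
    have hsz : s = z₀ + ((s.re - σ₂ : ℝ) : ℂ) := by
      apply Complex.ext <;> simp [hz₀]
    have hball : ∀ z ∈ Metric.ball (0 : ℂ) R, σ' ≤ (z₀ + z).re ∧ t₀ < (z₀ + z).im := by
      intro z hz
      rw [mem_ball_zero_iff] at hz
      have e1 := (abs_le.mp (abs_re_le_norm z)).1
      have e2 := (abs_le.mp (abs_im_le_norm z)).1
      simp only [hz₀, add_re, add_im]
      constructor <;> linarith
    have hBC := borelCaratheodory (f := fun z => g (z₀ + z)) (R := R)
      (z := ((s.re - σ₂ : ℝ) : ℂ)) hMpos ?_ ?_ (by linarith) ?_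
    · rw [← hsz, norm_real, Real.norm_eq_abs, abs_of_nonpos (by linarith), add_zero] at hBC
      have hz₀g : ‖g z₀‖ ≤ 1 := by
        have hmem : σ₁ < z₀.re ∧ t₀ < z₀.im := by
          constructor
          · simp [hz₀, hσ₂]
          · simp only [hz₀]; linarith
        rw [hglog z₀ hmem]
        have h5 := hu z₀ hmem.1.le
        linarith [norm_log_one_add_half_le_self h5]
      have hle : -(s.re - σ₂) ≤ r := by rw [hr]; linarith
      have hnn : 0 ≤ -(s.re - σ₂) := by linarith
      refine hBC.trans ?_
      gcongr
      · linarith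
      · linarith
    · refine hgd.comp ((differentiable_id.const_add z₀).differentiableOn) fun z hz => ?_
      have := hball z hz
      exact ⟨lt_of_lt_of_le (by linarith) this.1, this.2⟩
    · intro z hz
      have h5 := hball z hz
      have h6 : 1 < (z₀ + z).re := by linarith [h5.1]
      have := re_le_of_exp_eq (hgexp (z₀ + z) ⟨h6, h5.2⟩)
        (norm_genDirichlet_le hx hs (σ := σ') (by linarith) h5.1)
      change (g (z₀ + z)).re ≤ M
      rw [hM]; linarith
    · rw [mem_ball_zero_iff, norm_real, Real.norm_eq_abs, abs_of_nonpos (by linarith)]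
      linarith
  obtain ⟨C, hC⟩ := hbound
  have hmem : ∀ t, b ≤ t → 1 < ((σ : ℂ) + t * I).re ∧ t₀ < ((σ : ℂ) + t * I).im := by
    intro t ht
    simp only [add_re, ofReal_re, mul_re, I_re, mul_zero, ofReal_im, I_im, mul_one, sub_self,
      add_zero, add_im, mul_im, zero_add]
    exact ⟨hσ, by linarith⟩
  have hshift : ∀ y : ℝ, 0 < y → ∀ L, HasMean b (fun t => g (σ₂ + t * I) * osc y t) L →
      HasMean b (fun t => g (σ + t * I) * osc y t) ((y ^ (σ₂ - σ) : ℝ) * L) := fun y hy L h =>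
    HasMean.shift (by linarith) (hgd.mono fun s h => ⟨by linarith [h.1], by linarith [h.2]⟩) hC hy h
  have hg2 : ∀ t, b ≤ t → g (σ₂ + t * I) =
      log (1 + apSum (fun k => a k * (x k ^ (-σ₂) : ℝ)) x t) := by
    intro t ht
    rw [hglog _ ⟨by simp [hσ₂], by simp; linarith⟩, genDirichlet_eq_apSum hx]
  have hnorm : ∀ k, ‖a k * (x k ^ (-σ₂) : ℝ)‖ = ‖a k‖ * x k ^ (-σ₂) := fun k => by
    rw [norm_mul, norm_real, Real.norm_of_nonneg (Real.rpow_nonneg (hx0 k).le _)]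
  have hcs : Summable fun k => ‖a k * (x k ^ (-σ₂) : ℝ)‖ := by
    simp_rw [hnorm]; exact hs _ (by linarith)
  have hch : ∑' k, ‖a k * (x k ^ (-σ₂) : ℝ)‖ ≤ 1 / 2 := by
    refine le_trans ?_ hhalf
    refine hcs.tsum_le_tsum (fun k => ?_) (hs _ (by linarith))
    rw [hnorm]
    gcongr
    · exact (hx k).le
    · linarith
  refine ⟨b, fun t => g (σ + t * I), ?_, fun t ht => hgexp _ (hmem t ht), fun y hy h => ?_,
    fun i hi => ?_⟩
  · refine hgd.continuousOn.comp (by fun_prop) fun t ht => hmem t ht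
  · have := hshift y hy 0 ?_
    · simpa using this
    · have h7 := hasMean_log (b := b) (x := x) (y := y) hcs hch (M := fun _ => 0) fun m =>
        hasMean_apSum_pow hcs hch hx0 (m + 1) y hy fun l hl => h l (by rintro rfl; simp at hl)
      simp only [mul_zero, tsum_zero] at h7
      exact h7.congr fun t ht => by rw [hg2 t ht]
  · have := hshift (x i) (hx0 i) (a i * (x i ^ (-σ₂) : ℝ)) ?_
    · convert this using 1
      rw [mul_left_comm, ← ofReal_mul, ← Real.rpow_add (hx0 i)]
      congr 3; ring
    · have h7 := hasMean_log (b := b) (x := x) (y := x i) hcs hch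
        (M := fun m => if m = 0 then a i * (x i ^ (-σ₂) : ℝ) else 0) fun m => ?_
      · rw [tsum_eq_single 0 (fun m hm => by simp [hm])] at h7
        simp only [pow_zero, CharP.cast_eq_zero, zero_add, div_one, if_true, one_mul] at h7
        exact h7.congr fun t ht => by rw [hg2 t ht]
      · rcases m with _ | m
        · simp only [zero_add, pow_one, if_true]
          refine hasMean_apSum_single hcs hx0 fun k hk => ?_
          simpa using hi [k] (by simp) (by simp [hk])
        · simp only [Nat.add_eq_zero_iff, one_ne_zero, and_false, if_false]
          refine hasMean_apSum_pow hcs hch hx0 (m + 1 + 1) (x i) (hx0 i) fun l hl he => ?_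
          have := hi l (by rintro rfl; simp at hl) he
          rw [this] at hl
          simp at hl

end

lemma HasMean.re_nonneg {b : ℝ} {φ : ℝ → ℂ} {L : ℂ} (hφ : ContinuousOn φ (Ici b))
    (h : HasMean b φ L) (h0 : ∀ t, b ≤ t → 0 ≤ (φ t).re) : 0 ≤ L.re := by
  have h1 := (continuous_re.tendsto L).comp h
  refine ge_of_tendsto h1 ?_
  filter_upwards [eventually_gt_atTop 0, eventually_ge_atTop b] with T hT hTb
  have hint : IntervalIntegrable φ volume b T := by
    refine (hφ.mono ?_).intervalIntegrable
    rw [uIcc_of_le hTb]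
    exact Icc_subset_Ici_self
  have h2 : (∫ t in b..T, φ t).re = ∫ t in b..T, (φ t).re :=
    (reCLM.intervalIntegral_comp_comm hint).symm
  rw [Function.comp_apply, ← ofReal_inv, re_ofReal_mul, h2]
  refine mul_nonneg (inv_nonneg.mpr hT.le) (intervalIntegral.integral_nonneg hTb fun t ht => ?_)
  exact h0 t ht.1

/-- Testing a function with real part at most `M` against the nonnegative kernel
`|∑ osc (y S)| ^ 2`. -/
lemma re_sum_mean_le {ι : Type*} {b M : ℝ} {φ : ℝ → ℂ} (hφ : ContinuousOn φ (Ici b))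
    (hM : ∀ t, b ≤ t → (φ t).re ≤ M) (A : Finset ι) {y : ι → ℝ} (hy : ∀ S, 0 < y S)
    (hinj : ∀ S ∈ A, ∀ S' ∈ A, y S = y S' → S = S') {L : ι → ι → ℂ}
    (hL : ∀ S ∈ A, ∀ S' ∈ A, HasMean b (fun t => φ t * osc (y S * (y S')⁻¹) t) (L S S')) :
    (∑ S ∈ A, ∑ S' ∈ A, L S S').re ≤ M * A.card := by
  classical
  have hc1 : ∀ S S', ContinuousOn (fun t => ((M : ℂ) - φ t) * osc (y S * (y S')⁻¹) t) (Ici b) :=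
    fun S S' => (continuousOn_const.sub hφ).mul (continuous_osc _).continuousOn
  have hm : ∀ S ∈ A, ∀ S' ∈ A, HasMean b (fun t => ((M : ℂ) - φ t) * osc (y S * (y S')⁻¹) t)
      ((if S = S' then (M : ℂ) else 0) - L S S') := by
    intro S hS S' hS'
    have h1 : HasMean b (fun t => (M : ℂ) * osc (y S * (y S')⁻¹) t)
        (if S = S' then (M : ℂ) else 0) := by
      split_ifs with h
      · subst h
        rw [mul_inv_cancel₀ (hy S).ne']
        simpa [osc_one] using HasMean.const (b := b) (M : ℂ)
      · have := (HasMean.osc_of_ne_one (b := b) (y := y S * (y S')⁻¹)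
          (mul_pos (hy S) (inv_pos.mpr (hy S'))) ?_).const_mul (M : ℂ)
        · simpa using this
        · intro h2
          apply h
          apply hinj S hS S' hS'
          field_simp [(hy S').ne'] at h2
          exact h2
    have h2 := HasMean.sum (b := b) (s := Finset.univ)
      (φ := fun (j : Fin 2) t => if j = 0 then (M : ℂ) * osc (y S * (y S')⁻¹) t
        else -1 * (φ t * osc (y S * (y S')⁻¹) t))
      (L := fun j => if j = 0 then (if S = S' then (M : ℂ) else 0) else -1 * L S S')
      (fun j _ => ?_) (fun j _ => ?_)
    · simp only [Fin.sum_univ_two, if_true, one_ne_zero, if_false] at h2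
      have h3 := h2.congr (ψ := fun t => ((M : ℂ) - φ t) * osc (y S * (y S')⁻¹) t)
        (fun t _ => by ring)
      convert h3 using 1
      ring
    · fin_cases j
      · simpa [Pi.mul_def] using
          (continuous_const.mul (continuous_osc (y S * (y S')⁻¹))).continuousOn
      · simpa [Pi.mul_def, Pi.neg_def] using
          (hφ.mul (continuous_osc (y S * (y S')⁻¹)).continuousOn).neg
    · fin_cases j
      · simpa using h1
      · simpa using (hL S hS S' hS').const_mul (-1)
  have hm2 := HasMean.sum (s := A) (b := b) (fun S hS => continuousOn_finsetSum A
    fun S' _ => hc1 S S') (fun S hS => HasMean.sum (fun S' hS' => hc1 S S') (hm S hS))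
  have hker : ∀ t, ∑ S ∈ A, ∑ S' ∈ A, ((M : ℂ) - φ t) * osc (y S * (y S')⁻¹) t =
      ((M : ℂ) - φ t) * (normSq (∑ S ∈ A, osc (y S) t) : ℝ) := by
    intro t
    rw [← mul_conj, map_sum, Finset.sum_mul_sum, Finset.mul_sum]
    refine Finset.sum_congr rfl fun S _ => ?_
    rw [Finset.mul_sum]
    refine Finset.sum_congr rfl fun S' _ => ?_
    rw [osc_mul (hy S) (inv_pos.mpr (hy S')), osc_inv]
  have hfin := hm2.re_nonneg (continuousOn_finsetSum A
    fun S _ => continuousOn_finsetSum A fun S' _ => hc1 S S') (fun t ht => ?_)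
  · simp only [Finset.sum_sub_distrib, sub_re] at hfin
    have : (∑ S ∈ A, ∑ S' ∈ A, if S = S' then (M : ℂ) else 0).re = M * A.card := by
      have h5 : ∀ S ∈ A, (∑ S' ∈ A, if S = S' then (M : ℂ) else 0) = M := fun S hS => by
        rw [Finset.sum_ite_eq, if_pos hS]
      rw [Finset.sum_congr rfl h5]
      simp [mul_comm]
    linarith
  · rw [hker, re_mul_ofReal]
    refine mul_nonneg ?_ (normSq_nonneg _)
    simpa using hM t ht

lemma two_mul_sum_powerset_sum {ι : Type*} [DecidableEq ι] (I : Finset ι) (w : ι → ℝ) :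
    2 * ∑ S ∈ I.powerset, ∑ i ∈ S, w i = 2 ^ I.card * ∑ i ∈ I, w i := by
  induction I using Finset.induction_on with
  | empty => simp
  | insert a I ha ih =>
    rw [Finset.sum_powerset_insert ha, Finset.card_insert_of_notMem ha, Finset.sum_insert ha]
    have : ∀ S ∈ I.powerset, ∑ i ∈ insert a S, w i = w a + ∑ i ∈ S, w i := fun S hS =>
      Finset.sum_insert fun h => ha (Finset.mem_powerset.mp hS h)
    rw [Finset.sum_congr rfl this, Finset.sum_add_distrib, Finset.sum_const, Finset.card_powerset]
    simp only [nsmul_eq_mul]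
    push_cast
    rw [pow_succ]
    linear_combination 2 * ih

/-- Every subset of `I` lies in at most two unions of consecutive layers of the powerset. -/
lemma sum_card_two_layers_le {ι : Type*} (I : Finset ι) :
    ∑ j ∈ Finset.range (I.card + 2),
      (((I.powerset.filter fun S => S.card = j ∨ S.card + 1 = j).card : ℕ) : ℝ) ≤
      2 * 2 ^ I.card := by
  have : ∀ j, (I.powerset.filter fun S => S.card = j ∨ S.card + 1 = j).card ≤
      ∑ S ∈ I.powerset, ((if S.card = j then 1 else 0) + if S.card + 1 = j then 1 else 0) := by
    intro j
    rw [Finset.card_filter]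
    refine Finset.sum_le_sum fun S _ => ?_
    by_cases h1 : S.card = j <;> by_cases h2 : S.card + 1 = j <;> simp [h1, h2]
  have h5 : ∑ j ∈ Finset.range (I.card + 2),
      (I.powerset.filter fun S => S.card = j ∨ S.card + 1 = j).card ≤ 2 ^ I.card * 2 := by
    refine (Finset.sum_le_sum fun j _ => this j).trans ?_
    rw [Finset.sum_comm, ← Finset.card_powerset, ← smul_eq_mul]
    refine Finset.sum_le_card_nsmul _ _ _ fun S hS => ?_
    rw [Finset.sum_add_distrib, Finset.sum_ite_eq, Finset.sum_ite_eq]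
    split_ifs <;> simp
  have h6 : ((∑ j ∈ Finset.range (I.card + 2),
      (I.powerset.filter fun S => S.card = j ∨ S.card + 1 = j).card : ℕ) : ℝ) ≤
      (2 ^ I.card * 2 : ℕ) := by
    exact_mod_cast h5
  push_cast at h6
  linarith

/-- Absence of zeros high up in the half plane of convergence bounds the sum over
multiplicatively independent frequencies. -/
theorem sum_rpow_le_of_zero_free {a : ℕ → ℂ} {x : ℕ → ℝ} (hx : ∀ k, 1 < x k) {c : ℝ} (hc : 1 < c)
    (hcx : ∀ k, c ≤ x k) (hs : ∀ σ : ℝ, 1 < σ → Summable fun k => ‖a k‖ * x k ^ (-σ)) {t₀ : ℝ}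
    (hne : ∀ s : ℂ, 1 < s.re → t₀ < s.im → 1 + genDirichlet a x s ≠ 0) {σ : ℝ} (hσ : 1 < σ)
    (hσ2 : σ ≤ 2) (I : Finset ℕ) (haI : ∀ i ∈ I, a i = 1)
    (hadm : ∀ S ⊆ I, ∀ S' ⊆ I, ∀ l : List ℕ,
      ∏ i ∈ S, x i = (∏ i ∈ S', x i) * (l.map x).prod → S' ⊆ S)
    (hirr : ∀ i ∈ I, ∀ l : List ℕ, l ≠ [] → x i = (l.map x).prod → l = [i]) :
    ∑ i ∈ I, x i ^ (-σ) ≤ 4 * Real.log (1 + ∑' k, ‖a k‖ * x k ^ (-σ)) := by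
  obtain ⟨b, φ, hφ, hexp, h0, h1⟩ := exists_log_mean hx hc hcx hs hne hσ hσ2
  set M := Real.log (1 + ∑' k, ‖a k‖ * x k ^ (-σ)) with hMdef
  have hx0 : ∀ k, 0 < x k := fun k => by linarith [hx k]
  have hM : ∀ t, b ≤ t → (φ t).re ≤ M := fun t ht =>
    re_le_of_exp_eq (hexp t ht) (norm_genDirichlet_le hx hs hσ (by simp))
  have hM0 : 0 ≤ M := Real.log_nonneg (by
    have : 0 ≤ ∑' k, ‖a k‖ * x k ^ (-σ) :=
      tsum_nonneg fun k => mul_nonneg (norm_nonneg _) (Real.rpow_nonneg (hx0 k).le _)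
    linarith)
  have hprod : ∀ l : List ℕ, l ≠ [] → 1 < (l.map x).prod := by
    intro l
    induction l with
    | nil => simp
    | cons k l ih =>
      intro _
      rw [List.map_cons, List.prod_cons]
      rcases eq_or_ne l [] with rfl | h
      · simpa using hx k
      · exact one_lt_mul_of_lt_of_le (hx k) (ih h).le
  set y : Finset ℕ → ℝ := fun S => ∏ i ∈ S, x i with hy
  have hypos : ∀ S, 0 < y S := fun S => Finset.prod_pos fun i _ => hx0 i
  set w : ℕ → ℝ := fun i => x i ^ (-σ) with hw
  have hw0 : ∀ i, 0 ≤ w i := fun i => Real.rpow_nonneg (hx0 i).le _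
  set L : Finset ℕ → Finset ℕ → ℝ := fun S S' => ∑ i ∈ S, if S' = S.erase i then w i else 0 with hL
  set A : ℕ → Finset (Finset ℕ) := fun j =>
    I.powerset.filter fun S => S.card = j ∨ S.card + 1 = j with hA
  have hmean : ∀ j, ∀ S ∈ A j, ∀ S' ∈ A j,
      HasMean b (fun t => φ t * osc (y S * (y S')⁻¹) t) (L S S' : ℝ) := by
    intro j S hS S' hS'
    simp only [hA, Finset.mem_filter, Finset.mem_powerset] at hS hS'
    by_cases h : ∃ i ∈ S, S' = S.erase i
    · obtain ⟨i, hi, rfl⟩ := h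
      have e1 : y S * (y (S.erase i))⁻¹ = x i := by
        rw [mul_inv_eq_iff_eq_mul₀ (hypos _).ne']
        exact (Finset.mul_prod_erase S x hi).symm
      have e2 : L S (S.erase i) = w i := by
        simp only [hL]
        rw [Finset.sum_eq_single i]
        · simp
        · intro k hk hki
          rw [if_neg]
          intro h
          exact hki ((Finset.erase_injOn S hi hk h).symm)
        · exact fun h => absurd hi h
      have h3 := h1 i (hirr i (hS.1 hi))
      rw [haI i (hS.1 hi), one_mul] at h3
      rw [e1, e2]
      exact h3
    · have e2 : L S S' = 0 := by
        simp only [hL]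
        refine Finset.sum_eq_zero fun i hi => if_neg fun h' => h ⟨i, hi, h'⟩
      rw [e2, ofReal_zero]
      refine h0 _ (mul_pos (hypos S) (inv_pos.mpr (hypos S'))) fun l hl he => h ?_
      have h4 : y S = y S' * (l.map x).prod := by
        rw [← he]; field_simp [(hypos S').ne']
      have hsub := hadm S hS.1 S' hS'.1 l h4
      have hneq : S' ≠ S := by
        rintro rfl
        have := hprod l hl
        rw [left_eq_mul₀ (hypos _).ne'] at h4
        linarith
      have hlt := Finset.card_lt_card (hsub.ssubset_of_ne hneq)
      obtain ⟨i, hi, hins⟩ := Finset.exists_eq_insert_iff.mpr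
        ⟨hsub, (by omega : S'.card + 1 = S.card)⟩
      exact ⟨i, by rw [← hins]; exact Finset.mem_insert_self _ _,
        by rw [← hins, Finset.erase_insert hi]⟩
  have hinj : ∀ j, ∀ S ∈ A j, ∀ S' ∈ A j, y S = y S' → S = S' := by
    intro j S hS S' hS' h
    simp only [hA, Finset.mem_filter, Finset.mem_powerset] at hS hS'
    exact Finset.Subset.antisymm (hadm S' hS'.1 S hS.1 [] (by simpa using h.symm))
      (hadm S hS.1 S' hS'.1 [] (by simpa using h))
  have hineq : ∀ j, ∑ S ∈ A j, ∑ S' ∈ A j, L S S' ≤ M * (A j).card := by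
    intro j
    have := re_sum_mean_le hφ hM (A j) hypos (hinj j) (hmean j)
    simpa [← ofReal_sum] using this
  have hcard : ∀ S ∈ I.powerset, S.card < I.card + 1 := fun S hS =>
    Nat.lt_succ_of_le (Finset.card_le_card (Finset.mem_powerset.mp hS))
  have hlow : ∑ S ∈ I.powerset, ∑ i ∈ S, w i ≤
      ∑ j ∈ Finset.range (I.card + 2), ∑ S ∈ A j, ∑ S' ∈ A j, L S S' := by
    have hL0 : ∀ S S', 0 ≤ L S S' := fun S S' => Finset.sum_nonneg fun i _ => by
      split_ifs
      · exact hw0 i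
      · exact le_rfl
    rw [← Finset.sum_fiberwise_of_maps_to (s := I.powerset) (t := Finset.range (I.card + 2))
      (g := Finset.card) (fun S hS => Finset.mem_range.mpr (by have := hcard S hS; omega))]
    refine Finset.sum_le_sum fun j _ => ?_
    calc ∑ S ∈ I.powerset with S.card = j, ∑ i ∈ S, w i
        ≤ ∑ S ∈ I.powerset with S.card = j, ∑ S' ∈ A j, L S S' := by
          refine Finset.sum_le_sum fun S hS => ?_
          rw [Finset.mem_filter, Finset.mem_powerset] at hS
          simp only [hL]
          rw [Finset.sum_comm]
          refine Finset.sum_le_sum fun i hi => ?_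
          rw [Finset.sum_ite_eq', if_pos]
          simp only [hA, Finset.mem_filter, Finset.mem_powerset]
          refine ⟨(Finset.erase_subset _ _).trans hS.1, Or.inr ?_⟩
          rw [Finset.card_erase_add_one hi, hS.2]
      _ ≤ ∑ S ∈ A j, ∑ S' ∈ A j, L S S' := by
          refine Finset.sum_le_sum_of_subset_of_nonneg (fun S hS => ?_) fun S _ _ =>
            Finset.sum_nonneg fun S' _ => hL0 S S'
          simp only [hA, Finset.mem_filter] at hS ⊢
          exact ⟨hS.1, Or.inl hS.2⟩
  have hup := sum_card_two_layers_le I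
  have hfinal : ∑ S ∈ I.powerset, ∑ i ∈ S, w i ≤ M * (2 * 2 ^ I.card) := by
    refine hlow.trans ((Finset.sum_le_sum fun j _ => hineq j).trans ?_)
    rw [← Finset.mul_sum]
    gcongr
  have h7 := two_mul_sum_powerset_sum I w
  have h8 : (0 : ℝ) < 2 ^ I.card := by positivity
  have h9 : 2 ^ I.card * ∑ i ∈ I, w i ≤ 2 ^ I.card * (4 * M) := by linarith
  exact le_of_mul_le_mul_left h9 h8

end

section
open Polynomial

theorem exists_root_zmod_of_dvd_eval_reverse {μ : ℤ[X]} (hμ : μ.Monic) {p : ℕ} [Fact p.Prime] {e : ℤ}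
    (hpe : (p : ℤ) ∣ μ.reverse.eval e) :
    (e : ZMod p) ≠ 0 ∧ μ.eval₂ (Int.castRingHom (ZMod p)) (e : ZMod p)⁻¹ = 0 := by
  have h0 : μ.reverse.eval₂ (Int.castRingHom (ZMod p)) (e : ZMod p) = 0 := by
    have := eval₂_at_apply (p := μ.reverse) (Int.castRingHom (ZMod p)) e
    rw [eq_intCast] at this
    rw [this, eq_intCast, ZMod.intCast_zmod_eq_zero_iff_dvd]
    exact hpe
  have he : (e : ZMod p) ≠ 0 := by
    intro he
    rw [he, eval₂_at_zero, coeff_zero_reverse, hμ.leadingCoeff] at h0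
    simp at h0
  refine ⟨he, ?_⟩
  have : Invertible ((e : ZMod p)⁻¹) := invertibleOfNonzero (inv_ne_zero he)
  have h := eval₂_reverse_mul_pow (Int.castRingHom (ZMod p)) ((e : ZMod p)⁻¹) μ
  rw [← h, invOf_eq_inv, inv_inv, h0, zero_mul]

theorem eval_zmod_eq_of_aeval_eq {R : Type*} [CommRing R] {β : R} {μ : ℤ[X]} (hdvd : ∀ A : ℤ[X], aeval β A = 0 → μ ∣ A)
    {p : ℕ} {ρ : ZMod p} (hρ : μ.eval₂ (Int.castRingHom (ZMod p)) ρ = 0) {A B : ℤ[X]}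
    (h : aeval β A = aeval β B) :
    A.eval₂ (Int.castRingHom (ZMod p)) ρ = B.eval₂ (Int.castRingHom (ZMod p)) ρ := by
  obtain ⟨C, hC⟩ := hdvd (A - B) (by rw [map_sub, h, sub_self])
  have : (A - B).eval₂ (Int.castRingHom (ZMod p)) ρ = 0 := by rw [hC, eval₂_mul, hρ, zero_mul]
  rwa [eval₂_sub, sub_eq_zero] at this

/-- A prime dividing `μ.reverse.eval e` singles out the factor `L - L e β` among the numbers
`L - (k + 1) β`. -/
theorem zmod_specialization {β : ℝ} {μ : ℤ[X]} (hμ : μ.Monic)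
    (hdvd : ∀ A : ℤ[X], aeval β A = 0 → μ ∣ A) {L : ℕ} {x : ℕ → ℝ}
    (hx : ∀ k, (L : ℝ) * x k = L - (k + 1) * β) {p : ℕ} [Fact p.Prime] {e : ℤ}
    (hpe : (p : ℤ) ∣ μ.reverse.eval e) (S S' : Multiset ℕ)
    (h : (S.map x).prod = (S'.map x).prod) :
    (L : ZMod p) ^ S'.card * (S.map fun k : ℕ => (L : ZMod p) - ((k : ZMod p) + 1) * (e : ZMod p)⁻¹).prod =
      (L : ZMod p) ^ S.card * (S'.map fun k : ℕ => (L : ZMod p) - ((k : ZMod p) + 1) * (e : ZMod p)⁻¹).prod := by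
  obtain ⟨he, hr⟩ := exists_root_zmod_of_dvd_eval_reverse hμ hpe
  have key : ∀ T : Multiset ℕ, aeval β (T.map fun k : ℕ => (C (L : ℤ) - C ((k : ℤ) + 1) * X)).prod =
      (L : ℝ) ^ T.card * (T.map x).prod := by
    intro T
    induction T using Multiset.induction_on with
    | empty => simp
    | cons a T ih =>
      simp only [Multiset.map_cons, Multiset.prod_cons, map_mul, ih, Multiset.card_cons, pow_succ]
      have := hx a
      simp only [map_sub, map_mul, aeval_X, eq_intCast]
      push_cast
      simp only [map_add, map_natCast, map_one]
      rw [← this]; ring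
  have key2 : ∀ T : Multiset ℕ, eval₂ (Int.castRingHom (ZMod p)) (e : ZMod p)⁻¹
      (T.map fun k : ℕ => (C (L : ℤ) - C ((k : ℤ) + 1) * X)).prod =
      (T.map fun k : ℕ => (L : ZMod p) - ((k : ZMod p) + 1) * (e : ZMod p)⁻¹).prod := by
    intro T
    induction T using Multiset.induction_on with
    | empty => simp
    | cons a T ih =>
      simp only [Multiset.map_cons, Multiset.prod_cons, eval₂_mul, ih]
      simp
  have hfin := eval_zmod_eq_of_aeval_eq hdvd hr (A := C ((L : ℤ) ^ S'.card) *
      (S.map fun k : ℕ => (C (L : ℤ) - C ((k : ℤ) + 1) * X)).prod)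
      (B := C ((L : ℤ) ^ S.card) * (S'.map fun k : ℕ => (C (L : ℤ) - C ((k : ℤ) + 1) * X)).prod) (by
    rw [map_mul, map_mul, key, key, h, aeval_C, aeval_C, eq_intCast, eq_intCast]
    push_cast
    ring)
  rw [eval₂_mul, eval₂_mul, key2, key2, eval₂_C, eval₂_C] at hfin
  simpa using hfin

theorem factor_eq_zero_iff {p : ℕ} [Fact p.Prime] {L e k : ℕ} (he : ((e : ℤ) : ZMod p) ≠ 0) :
    (L : ZMod p) - (k + 1) * ((e : ℤ) : ZMod p)⁻¹ = 0 ↔ (p : ℤ) ∣ (L * e : ℤ) - (k + 1) := by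
  rw [sub_eq_zero, eq_mul_inv_iff_mul_eq₀ he, ← sub_eq_zero, ← ZMod.intCast_zmod_eq_zero_iff_dvd]
  push_cast
  rfl

theorem eq_singleton_of_eq_prod {β : ℝ} {μ : ℤ[X]} (hμ : μ.Monic)
    (hdvd : ∀ A : ℤ[X], aeval β A = 0 → μ ∣ A) {L : ℕ} (hL : 0 < L) {x : ℕ → ℝ}
    (hx : ∀ k, (L : ℝ) * x k = L - (k + 1) * β) {J : Finset ℕ} (hJ : ∀ e ∈ J, 1 ≤ e) {p : ℕ → ℕ}
    (hp : ∀ e ∈ J, (p e).Prime) (hpL : ∀ e ∈ J, L * e < p e)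
    (hpe : ∀ e ∈ J, (p e : ℤ) ∣ μ.reverse.eval (e : ℤ))
    (hβ : β < 0) {e : ℕ} (he : e ∈ J) {l : List ℕ}
    (h : x (L * e - 1) = (l.map x).prod) : l = [L * e - 1] := by
  have := Fact.mk (hp e he)
  have hLe : 1 ≤ L * e := Nat.mul_pos hL (hJ e he)
  have hLr : (0 : ℝ) < L := by exact_mod_cast hL
  obtain ⟨he0, -⟩ := exists_root_zmod_of_dvd_eval_reverse hμ (hpe e he)
  have hxv : ∀ k, x k = 1 - (k + 1) * β / L := fun k => by
    have := hx k; field_simp; linarith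
  have hx1 : ∀ k, 1 < x k := fun k => by
    rw [hxv]
    have : (k + 1) * β / L < 0 := div_neg_of_neg_of_pos (mul_neg_of_pos_of_neg (by positivity) hβ) hLr
    linarith
  have hmono : ∀ k k', k ≤ k' → x k ≤ x k' := fun k k' hk => by
    have : (k : ℝ) ≤ k' := by exact_mod_cast hk
    rw [hxv, hxv]
    have : (k' + 1) * β / L ≤ (k + 1) * β / L := by gcongr ?_ / _; nlinarith
    linarith
  have hinj : ∀ k k', x k = x k' → k = k' := fun k k' hk => by
    have h1 := hx k; have h2 := hx k'
    rw [hk, h2] at h1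
    have : ((k' : ℝ) - k) * β = 0 := by linarith
    rcases mul_eq_zero.1 this with h | h
    · exact_mod_cast (sub_eq_zero.1 h).symm
    · exact absurd h hβ.ne
  have hs := zmod_specialization hμ hdvd hx (hpe e he) {L * e - 1} (l : Multiset ℕ)
    (by simpa using h)
  have hz : (L : ZMod (p e)) - (((L * e - 1 : ℕ) : ZMod (p e)) + 1) * ((e : ℤ) : ZMod (p e))⁻¹ = 0 := by
    rw [factor_eq_zero_iff he0]
    simp [Nat.cast_sub hLe]
  have hL0 : (L : ZMod (p e)) ≠ 0 := by
    rw [Ne, ZMod.natCast_eq_zero_iff]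
    intro hd
    have := Nat.le_of_dvd hL hd
    have := hpL e he
    have := hJ e he
    nlinarith
  rw [Multiset.map_singleton, Multiset.prod_singleton, hz, mul_zero, eq_comm, mul_eq_zero,
    or_iff_right (pow_ne_zero _ hL0), Multiset.prod_eq_zero_iff] at hs
  simp only [Multiset.map_coe, Multiset.mem_coe, List.mem_map] at hs
  obtain ⟨k, hk, hk0⟩ := hs
  rw [factor_eq_zero_iff he0] at hk0
  have hge : L * e - 1 ≤ k := by
    by_contra! hlt
    have h1 : (0 : ℤ) < (L * e : ℤ) - (k + 1) := by
      have : k + 1 < L * e := by omega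
      have : ((k + 1 : ℕ) : ℤ) < ((L * e : ℕ) : ℤ) := by exact_mod_cast this
      push_cast at this; linarith
    have h2 := Int.le_of_dvd h1 hk0
    have : ((L * e : ℕ) : ℤ) < p e := by exact_mod_cast hpL e he
    push_cast at this; linarith
  obtain ⟨l₁, l₂, rfl⟩ := List.append_of_mem hk
  have hone : ∀ l : List ℕ, 1 ≤ (l.map x).prod ∧ (l ≠ [] → 1 < (l.map x).prod) := by
    intro l
    induction l with
    | nil => simp
    | cons a t ih =>
      have : 1 < ((a :: t).map x).prod := by
        simp only [List.map_cons, List.prod_cons]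
        have := hx1 a
        nlinarith [ih.1]
      exact ⟨this.le, fun _ => this⟩
  simp only [List.map_append, List.map_cons, List.prod_append, List.prod_cons] at h
  have h1 := hone l₁
  have h2 := hone l₂
  have hk1 := hmono _ _ hge
  have hk2 := hx1 k
  have hl₁ : l₁ = [] := by
    by_contra hc
    have := h1.2 hc
    have : x k < x k * ((l₁.map x).prod * (l₂.map x).prod) := by
      have : 1 < (l₁.map x).prod * (l₂.map x).prod := by nlinarith [h2.1]
      nlinarith
    rw [h] at hk1
    nlinarith
  have hl₂ : l₂ = [] := by
    by_contra hc
    have := h2.2 hc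
    have : x k < x k * ((l₁.map x).prod * (l₂.map x).prod) := by
      have : 1 < (l₁.map x).prod * (l₂.map x).prod := by nlinarith [h1.1]
      nlinarith
    rw [h] at hk1
    nlinarith
  subst hl₁ hl₂
  simp at h
  simp [hinj _ _ h]

theorem subset_of_prod_eq {β : ℝ} {μ : ℤ[X]} (hμ : μ.Monic)
    (hdvd : ∀ A : ℤ[X], aeval β A = 0 → μ ∣ A) {L : ℕ} (hL : 0 < L) {x : ℕ → ℝ}
    (hx : ∀ k, (L : ℝ) * x k = L - (k + 1) * β) {J : Finset ℕ} (hJ : ∀ e ∈ J, 1 ≤ e) {p : ℕ → ℕ}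
    (hp : ∀ e ∈ J, (p e).Prime) (hpL : ∀ e ∈ J, L * e < p e)
    (hpe : ∀ e ∈ J, (p e : ℤ) ∣ μ.reverse.eval (e : ℤ))
    (hsep : ∀ e ∈ J, ∀ e' ∈ J, e ≠ e' → ¬ (p e : ℤ) ∣ (e' : ℤ) - e)
    {S S' : Finset ℕ} (hS : S ⊆ J.image fun e => L * e - 1)
    (hS' : S' ⊆ J.image fun e => L * e - 1) {l : List ℕ}
    (h : ∏ i ∈ S, x i = (∏ i ∈ S', x i) * (l.map x).prod) : S' ⊆ S := by
  intro i hi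
  by_contra hiS
  obtain ⟨e, he, rfl⟩ := Finset.mem_image.1 (hS' hi)
  have := Fact.mk (hp e he)
  have hLe : 1 ≤ L * e := Nat.mul_pos hL (hJ e he)
  obtain ⟨he0, -⟩ := exists_root_zmod_of_dvd_eval_reverse hμ (hpe e he)
  have hL0 : ¬ p e ∣ L := by
    intro hd
    have := Nat.le_of_dvd hL hd
    have := hpL e he
    have := hJ e he
    nlinarith
  have hL0' : (L : ZMod (p e)) ≠ 0 := by rwa [Ne, ZMod.natCast_eq_zero_iff]
  have hs := zmod_specialization hμ hdvd hx (hpe e he) S.val (S'.val + (l : Multiset ℕ)) (by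
    rw [Multiset.map_add, Multiset.prod_add]; simpa using h)
  have hz : (((S'.val + (l : Multiset ℕ)).map fun k : ℕ => (L : ZMod (p e)) -
      ((k : ZMod (p e)) + 1) * ((e : ℤ) : ZMod (p e))⁻¹)).prod = 0 := by
    rw [Multiset.prod_eq_zero_iff, Multiset.mem_map]
    refine ⟨L * e - 1, by simp [hi], ?_⟩
    rw [factor_eq_zero_iff he0]
    simp [Nat.cast_sub hLe]
  rw [hz, mul_zero, mul_eq_zero, or_iff_right (pow_ne_zero _ hL0'), Multiset.prod_eq_zero_iff,
    Multiset.mem_map] at hs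
  obtain ⟨k, hk, hk0⟩ := hs
  obtain ⟨e', he', rfl⟩ := Finset.mem_image.1 (hS hk)
  have hne : e ≠ e' := fun hc => hiS (hc ▸ hk)
  rw [factor_eq_zero_iff he0, Nat.cast_sub (Nat.mul_pos hL (hJ e' he'))] at hk0
  have : (p e : ℤ) ∣ L * ((e' : ℤ) - e) := by
    rw [← dvd_neg]
    push_cast at hk0
    exact (by ring : -((L : ℤ) * ((e' : ℤ) - e)) = L * e - (L * e' - 1 + 1)) ▸ hk0
  rcases (Nat.prime_iff_prime_int.1 (hp e he)).dvd_or_dvd this with h1 | h1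
  · exact hL0 (by exact_mod_cast h1)
  · exact hsep e he e' he' hne h1

end

section
open Polynomial NumberField Filter Topology

theorem algebraMap_aeval_ringOfIntegers {K : Type*} [Field K] (b : 𝓞 K) (A : ℤ[X]) :
    algebraMap (𝓞 K) K (aeval b A) = aeval (algebraMap (𝓞 K) K b) A :=
  (aeval_algebraMap_apply K b A).symm

section
variable {K : Type*} [Field K] [NumberField K] {b : 𝓞 K} {μ : ℤ[X]}

theorem exists_maximal_of_dvd_eval_reverse (hμ : μ.Monic)
    (hdvd : ∀ A : ℤ[X], aeval b A = 0 → μ ∣ A) {Δ : ℤ}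
    (hΔ : ∀ y : 𝓞 K, ∃ A : ℤ[X], (Δ : 𝓞 K) * y = aeval b A) {p : ℕ} (hp : p.Prime)
    (hpΔ : ¬ (p : ℤ) ∣ Δ) {e : ℕ} (hpe : (p : ℤ) ∣ μ.reverse.eval (e : ℤ)) :
    ∃ M : Ideal (𝓞 K), M.IsMaximal ∧ (p : 𝓞 K) ∈ M ∧ 1 - (e : 𝓞 K) * b ∈ M ∧
      Ideal.absNorm M ≤ p := by
  have := Fact.mk hp
  obtain ⟨he0, hr⟩ := exists_root_zmod_of_dvd_eval_reverse hμ hpe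
  have hΔ0 : (Δ : ZMod p) ≠ 0 := by rwa [Ne, ZMod.intCast_zmod_eq_zero_iff_dvd]
  have hne : Ideal.span {(p : 𝓞 K), 1 - (e : 𝓞 K) * b} ≠ ⊤ := by
    intro htop
    have h1 : (1 : 𝓞 K) ∈ Ideal.span {(p : 𝓞 K), 1 - (e : 𝓞 K) * b} := htop ▸ trivial
    obtain ⟨u, v, huv⟩ := Ideal.mem_span_pair.1 h1
    obtain ⟨U, hU⟩ := hΔ u
    obtain ⟨V, hV⟩ := hΔ v
    have := eval_zmod_eq_of_aeval_eq hdvd hr (A := C Δ)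
      (B := U * C (p : ℤ) + V * (1 - C (e : ℤ) * X)) (by
        rw [map_add, map_mul, map_mul, map_sub, map_mul, ← hU, ← hV, map_one, aeval_X]
        simp only [eq_intCast, map_intCast, map_natCast]
        rw [mul_assoc, mul_assoc, ← mul_add, huv, mul_one])
    simp [eval₂_add, eval₂_mul, eval₂_sub] at this
    rw [mul_inv_cancel₀ (by simpa using he0)] at this
    rw [sub_self, mul_zero, ← eq_intCast (C : ℤ →+* ℤ[X]) Δ, eval₂_C] at this
    exact hΔ0 (by simpa using this)
  obtain ⟨M, hM, hle⟩ := Ideal.exists_le_maximal _ hne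
  have hpM : (p : 𝓞 K) ∈ M := hle (Ideal.subset_span (by simp))
  have heM : 1 - (e : 𝓞 K) * b ∈ M := hle (Ideal.subset_span (by simp))
  refine ⟨M, hM, hpM, heM, ?_⟩
  have hch : CharP (𝓞 K ⧸ M) p := by
    have h0 : ((p : ℕ) : 𝓞 K ⧸ M) = 0 := by
      have := Ideal.Quotient.eq_zero_iff_mem.2 hpM
      simpa using this
    have : Nontrivial (𝓞 K ⧸ M) := Ideal.Quotient.nontrivial_iff.2 hM.ne_top
    exact (CharP.charP_iff_prime_eq_zero hp).2 h0
  let φ : ZMod p →+* 𝓞 K ⧸ M := ZMod.castHom dvd_rfl _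
  obtain ⟨z, hz⟩ := ZMod.intCast_surjective ((e : ℤ) : ZMod p)⁻¹
  obtain ⟨δ, hδ⟩ := ZMod.intCast_surjective (Δ : ZMod p)⁻¹
  have cast_eq : ∀ m n : ℤ, (m : ZMod p) = n → (m : 𝓞 K ⧸ M) = n := fun m n h => by
    have := congrArg φ h
    simpa using this
  have hδ' : (δ : 𝓞 K ⧸ M) * Δ = 1 := by
    have := cast_eq (δ * Δ) 1 (by push_cast; rw [hδ, inv_mul_cancel₀ hΔ0])
    simpa using this
  have hz' : (e : 𝓞 K ⧸ M) * z = 1 := by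
    have := cast_eq (e * z) 1 (by
      push_cast at he0 hz ⊢; rw [hz]; exact mul_inv_cancel₀ he0)
    simpa using this
  have hb : Ideal.Quotient.mk M b = z := by
    have := Ideal.Quotient.eq_zero_iff_mem.2 heM
    simp only [map_sub, map_one, map_mul, map_natCast] at this
    linear_combination (Ideal.Quotient.mk M b) * (-hz') - z * this
  have hsurj : Function.Surjective φ := by
    intro y
    obtain ⟨y, rfl⟩ := Ideal.Quotient.mk_surjective y
    obtain ⟨A, hA⟩ := hΔ y
    have h1 : (Δ : 𝓞 K ⧸ M) * Ideal.Quotient.mk M y = (A.eval z : ℤ) := by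
      have := congrArg (Ideal.Quotient.mk M) hA
      rw [map_mul, map_intCast, aeval_def, Polynomial.hom_eval₂, hb] at this
      rw [this]
      have := eval₂_at_apply (p := A) (Int.castRingHom (𝓞 K ⧸ M)) z
      rw [eq_intCast, eq_intCast] at this
      rw [← this]
      congr 1
    refine ⟨((δ * A.eval z : ℤ) : ZMod p), ?_⟩
    rw [map_intCast]
    push_cast
    rw [← h1, ← mul_assoc, hδ', one_mul]
  have : Ideal.absNorm M = Nat.card (𝓞 K ⧸ M) := rfl
  rw [this]
  calc Nat.card (𝓞 K ⧸ M) ≤ Nat.card (ZMod p) := Nat.card_le_card_of_surjective φ hsurj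
    _ = p := by simp

theorem exists_discr_mul_mem_of_powerBasis (B : PowerBasis ℚ K) (hb : algebraMap (𝓞 K) K b = B.gen) :
    ∃ Δ : ℤ, Δ ≠ 0 ∧ ∀ y : 𝓞 K, ∃ A : ℤ[X], (Δ : 𝓞 K) * y = aeval b A := by
  have hint : IsIntegral ℤ B.gen := hb ▸ b.2
  have hd : IsIntegral ℤ (Algebra.discr ℚ B.basis) := by
    refine Algebra.discr_isIntegral ℚ fun i => ?_
    rw [B.basis_eq_pow]
    exact hint.pow _
  obtain ⟨Δ, hΔ⟩ := IsIntegrallyClosed.isIntegral_iff.1 hd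
  refine ⟨Δ, ?_, ?_⟩
  · rintro rfl
    exact Algebra.discr_not_zero_of_basis ℚ B.basis (hΔ.symm.trans (by simp))
  · intro y
    have := Algebra.discr_mul_isIntegral_mem_adjoin (R := ℤ) ℚ hint (z := (y : K)) y.2
    rw [Algebra.adjoin_singleton_eq_range_aeval] at this
    obtain ⟨A, hA⟩ := this
    refine ⟨A, ?_⟩
    apply FaithfulSMul.algebraMap_injective (𝓞 K) K
    rw [algebraMap_aeval_ringOfIntegers, map_mul, map_intCast, hb]
    refine Eq.trans ?_ hA.symm
    rw [← hΔ, Algebra.smul_def]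
    simp

theorem exists_discr_mul_mem {β : ℝ} (hβ : IsIntegral ℤ β) :
    ∃ (K : Type) (_ : Field K) (_ : NumberField K) (b : 𝓞 K),
      (∀ A : ℤ[X], aeval b A = 0 → aeval β A = 0) ∧
      ∃ Δ : ℤ, Δ ≠ 0 ∧ ∀ y : 𝓞 K, ∃ A : ℤ[X], (Δ : 𝓞 K) * y = aeval b A := by
  have hβQ : IsIntegral ℚ β := hβ.tower_top
  have : FiniteDimensional ℚ (IntermediateField.adjoin ℚ {β}) :=
    IntermediateField.adjoin.finiteDimensional hβQ
  have hNF : NumberField (IntermediateField.adjoin ℚ {β}) := { }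
  let B := IntermediateField.adjoin.powerBasis hβQ
  have hgen : B.gen = IntermediateField.AdjoinSimple.gen ℚ β :=
    IntermediateField.adjoin.powerBasis_gen hβQ
  have hcoe : algebraMap (IntermediateField.adjoin ℚ {β}) ℝ B.gen = β := by
    rw [hgen]; exact IntermediateField.AdjoinSimple.algebraMap_gen ℚ β
  have hint : IsIntegral ℤ B.gen := by
    rw [← isIntegral_algebraMap_iff (algebraMap (IntermediateField.adjoin ℚ {β}) ℝ).injective, hcoe]
    exact hβ
  obtain ⟨b, hb⟩ := IsIntegralClosure.isIntegral_iff (A := 𝓞 (IntermediateField.adjoin ℚ {β})).1 hint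
  refine ⟨IntermediateField.adjoin ℚ {β}, inferInstance, hNF, b, ?_,
    exists_discr_mul_mem_of_powerBasis B hb⟩
  intro A hA
  have h1 := algebraMap_aeval_ringOfIntegers b A
  rw [hA, map_zero, hb] at h1
  have := congrArg (algebraMap (IntermediateField.adjoin ℚ {β}) ℝ) h1
  rw [← aeval_algebraMap_apply, map_zero, hcoe] at this
  exact this.symm
end

section
variable {K : Type*} [Field K] [NumberField K]

theorem prod_one_add_rpow_le_tsum {ι : Type*} [DecidableEq ι] (P : Finset ι) (M : ι → Ideal (𝓞 K))
    (hM : ∀ i ∈ P, (M i).IsMaximal) (hinj : Set.InjOn M P) (hbot : ∀ i ∈ P, M i ≠ ⊥) {n : ι → ℕ}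
    (hn : ∀ i ∈ P, Ideal.absNorm (M i) ≤ n i) {s : ℝ} (hs : 0 < s)
    (hsum : Summable fun n : ℕ => (Nat.card {I : Ideal (𝓞 K) // Ideal.absNorm I = n} : ℝ) *
      (n : ℝ) ^ (-s)) :
    ∏ i ∈ P, (1 + (n i : ℝ) ^ (-s)) ≤
      ∑' n : ℕ, (Nat.card {I : Ideal (𝓞 K) // Ideal.absNorm I = n} : ℝ) * (n : ℝ) ^ (-s) := by
  have hpos : ∀ i ∈ P, 0 < Ideal.absNorm (M i) := fun i hi => by
    rw [Nat.pos_iff_ne_zero, Ne, Ideal.absNorm_eq_zero_iff]; exact hbot i hi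
  have hI : Set.InjOn (fun U : Finset ι => ∏ i ∈ U, M i) P.powerset := by
    have key : ∀ U ⊆ P, ∀ U' ⊆ P, ∏ i ∈ U, M i = ∏ i ∈ U', M i → U ⊆ U' := by
      intro U hU U' hU' h i hi
      have hp : Prime (M i) := Ideal.prime_of_isPrime (hbot i (hU hi)) (hM i (hU hi)).isPrime
      have hd : M i ∣ ∏ i ∈ U', M i := h ▸ Finset.dvd_prod_of_mem M hi
      obtain ⟨j, hj, hij⟩ := (Prime.dvd_finsetProd_iff hp M).1 hd
      have := (hM j (hU' hj)).eq_of_le (hM i (hU hi)).ne_top (Ideal.le_of_dvd hij)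
      rw [← hinj (hU' hj) (hU hi) this]
      exact hj
    intro U hU U' hU' h
    rw [Finset.mem_coe, Finset.mem_powerset] at hU hU'
    exact (key U hU U' hU' h).antisymm (key U' hU' U hU h.symm)
  calc ∏ i ∈ P, (1 + (n i : ℝ) ^ (-s))
      = ∑ U ∈ P.powerset, ∏ i ∈ U, (n i : ℝ) ^ (-s) := Finset.prod_one_add _
    _ ≤ ∑ U ∈ P.powerset, (Ideal.absNorm (∏ i ∈ U, M i) : ℝ) ^ (-s) := by
        refine Finset.sum_le_sum fun U hU => ?_
        rw [Finset.mem_powerset] at hU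
        rw [map_prod, Nat.cast_prod, ← Real.finsetProd_rpow _ _ fun i _ => Nat.cast_nonneg _]
        refine Finset.prod_le_prod (fun i _ => by positivity) fun i hi => ?_
        refine Real.rpow_le_rpow_of_nonpos (by exact_mod_cast hpos i (hU hi))
          (by exact_mod_cast hn i (hU hi)) (by linarith)
    _ = ∑ m ∈ P.powerset.image fun U => Ideal.absNorm (∏ i ∈ U, M i),
          ((P.powerset.filter fun U => Ideal.absNorm (∏ i ∈ U, M i) = m).card : ℝ) *
            (m : ℝ) ^ (-s) := by
        rw [Finset.sum_comp (fun m : ℕ => (m : ℝ) ^ (-s))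
          (fun U => Ideal.absNorm (∏ i ∈ U, M i))]
        simp only [nsmul_eq_mul]
    _ ≤ ∑ m ∈ P.powerset.image fun U => Ideal.absNorm (∏ i ∈ U, M i),
          (Nat.card {I : Ideal (𝓞 K) // Ideal.absNorm I = m} : ℝ) * (m : ℝ) ^ (-s) := by
        refine Finset.sum_le_sum fun m _ => mul_le_mul_of_nonneg_right ?_ (by positivity)
        have hfin : Set.Finite {I : Ideal (𝓞 K) | Ideal.absNorm I = m} :=
          Ideal.finite_setOfPred_absNorm_eq m
        have hcard : Nat.card {I : Ideal (𝓞 K) // Ideal.absNorm I = m} =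
          {I : Ideal (𝓞 K) | Ideal.absNorm I = m}.ncard := Nat.card_coe_set_eq _
        rw [Nat.cast_le, hcard, ← Set.ncard_coe_finset]
        refine Set.ncard_le_ncard_of_injOn (fun U => ∏ i ∈ U, M i) (fun U hU => ?_)
          (hI.mono fun U hU => ?_) hfin
        · exact (Finset.mem_filter.1 hU).2
        · exact (Finset.mem_filter.1 hU).1
    _ ≤ _ := hsum.sum_le_tsum _ fun m _ => by positivity

variable (K) in
theorem exists_forall_summable_dedekindZeta_le : ∃ C : ℝ, ∀ᶠ s : ℝ in 𝓝[>] 1,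
    (Summable fun n : ℕ => (Nat.card {I : Ideal (𝓞 K) // Ideal.absNorm I = n} : ℝ) *
      (n : ℝ) ^ (-s)) ∧
    ∑' n : ℕ, (Nat.card {I : Ideal (𝓞 K) // Ideal.absNorm I = n} : ℝ) * (n : ℝ) ^ (-s) ≤
      C / (s - 1) := by
  have ht := tendsto_sub_one_mul_dedekindZeta_nhdsGT K
  have hpos := dedekindZeta_residue_pos K
  have hnorm := ht.norm
  have hres : ‖(dedekindZeta_residue K : ℂ)‖ = dedekindZeta_residue K := by
    rw [Complex.norm_real, Real.norm_of_nonneg hpos.le]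
  rw [hres] at hnorm
  refine ⟨dedekindZeta_residue K + 1, ?_⟩
  filter_upwards [hnorm.eventually_lt_const (lt_add_one _), hnorm.eventually_const_lt hpos,
    self_mem_nhdsWithin] with s h1 h2 hs
  have hs1 : 0 < s - 1 := sub_pos.2 hs
  have hne : dedekindZeta K s ≠ 0 := by
    intro h; rw [h, mul_zero, norm_zero] at h2; exact h2.false
  have hsm : LSeriesSummable
      (fun n ↦ (Nat.card {I : Ideal (𝓞 K) // Ideal.absNorm I = n} : ℂ)) s := by
    by_contra hc
    exact hne (tsum_eq_zero_of_not_summable hc)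
  have hterm : ∀ n, LSeries.term
      (fun n ↦ (Nat.card {I : Ideal (𝓞 K) // Ideal.absNorm I = n} : ℂ)) s n =
      (((Nat.card {I : Ideal (𝓞 K) // Ideal.absNorm I = n} : ℝ) * (n : ℝ) ^ (-s) : ℝ) : ℂ) := by
    intro n
    rcases eq_or_ne n 0 with rfl | hn
    · have : (-s) ≠ 0 := by have := Set.mem_Ioi.1 hs; linarith
      simp [Real.zero_rpow this]
    · rw [LSeries.term_of_ne_zero hn]
      push_cast
      rw [Complex.ofReal_cpow (Nat.cast_nonneg _), Complex.ofReal_neg, Complex.cpow_neg,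
        div_eq_mul_inv]
      simp
  have hsm' : Summable fun n : ℕ => (Nat.card {I : Ideal (𝓞 K) // Ideal.absNorm I = n} : ℝ) *
      (n : ℝ) ^ (-s) := by
    have : Summable _ := hsm
    rw [funext hterm] at this
    exact_mod_cast this
  refine ⟨hsm', ?_⟩
  have hval : dedekindZeta K s = ((∑' n : ℕ, (Nat.card {I : Ideal (𝓞 K) // Ideal.absNorm I = n} : ℝ)
      * (n : ℝ) ^ (-s) : ℝ) : ℂ) := by
    rw [Complex.ofReal_tsum]
    exact tsum_congr hterm
  rw [hval, ← Complex.ofReal_one, ← Complex.ofReal_sub, ← Complex.ofReal_mul, Complex.norm_real,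
    Real.norm_eq_abs] at h1
  rw [le_div_iff₀ hs1, mul_comm]
  exact (le_abs_self _).trans h1.le
end

/-- The representatives in `[0, p)` of the roots of `W` modulo `p`. -/
def rootsBelow (W : ℤ[X]) (p : ℕ) : Finset ℕ :=
  (Finset.range p).filter fun e => (p : ℤ) ∣ W.eval (e : ℤ)

/-- The number of roots of `W` modulo `p`, with the divisors of `R` discarded. -/
def rootCount (W : ℤ[X]) (R p : ℕ) : ℕ := if p ∣ R then 0 else (rootsBelow W p).card

theorem rootCount_le {W : ℤ[X]} (hW0 : W.coeff 0 = 1) (R : ℕ) {p : ℕ} (hp : p.Prime) :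
    rootCount W R p ≤ W.natDegree := by
  have := Fact.mk hp
  unfold rootCount
  split_ifs
  · exact Nat.zero_le _
  have hne : W.map (Int.castRingHom (ZMod p)) ≠ 0 := by
    intro h
    have := congrArg (fun q => coeff q 0) h
    simp [coeff_map, hW0] at this
  calc (rootsBelow W p).card ≤ (W.map (Int.castRingHom (ZMod p))).roots.toFinset.card := by
        refine Finset.card_le_card_of_injOn (fun e : ℕ => (e : ZMod p)) (fun e he => ?_) ?_
        · have h := (Finset.mem_filter.1 he).2
          rw [Finset.mem_coe, Multiset.mem_toFinset, mem_roots hne, IsRoot, eval_map]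
          have h2 := eval₂_at_apply (p := W) (Int.castRingHom (ZMod p)) (e : ℤ)
          rw [eq_intCast, eq_intCast, Int.cast_natCast] at h2
          rw [h2, ZMod.intCast_zmod_eq_zero_iff_dvd]
          exact h
        · intro e he e' he' h
          have h1 := Finset.mem_range.1 (Finset.mem_filter.1 he).1
          have h2 := Finset.mem_range.1 (Finset.mem_filter.1 he').1
          have := (ZMod.natCast_eq_natCast_iff' _ _ _).1 h
          rwa [Nat.mod_eq_of_lt h1, Nat.mod_eq_of_lt h2] at this
    _ ≤ (W.map (Int.castRingHom (ZMod p))).roots.card := Multiset.toFinset_card_le _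
    _ ≤ (W.map (Int.castRingHom (ZMod p))).natDegree := card_roots' _
    _ ≤ W.natDegree := natDegree_map_le

section
variable {K : Type*} [Field K] [NumberField K] {b : 𝓞 K} {μ : ℤ[X]}

theorem not_mem_of_coprime {M : Ideal (𝓞 K)} (hM : M.IsMaximal) {m n : ℤ} (h : IsCoprime m n)
    (hm : (m : 𝓞 K) ∈ M) : (n : 𝓞 K) ∉ M := by
  intro hn
  obtain ⟨u, v, huv⟩ := h
  apply hM.ne_top
  rw [Ideal.eq_top_iff_one]
  have : (u : 𝓞 K) * m + v * n = 1 := by exact_mod_cast congrArg (Int.cast : ℤ → 𝓞 K) huv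
  rw [← this]
  exact M.add_mem (M.mul_mem_left _ hm) (M.mul_mem_left _ hn)

theorem prod_one_add_rpow_pow_rootCount_le (hμ : μ.Monic)
    (hdvd : ∀ A : ℤ[X], aeval b A = 0 → μ ∣ A) {Δ : ℤ}
    (hΔ : ∀ y : 𝓞 K, ∃ A : ℤ[X], (Δ : 𝓞 K) * y = aeval b A) {R : ℕ} (hR : Δ ∣ R)
    {Q : Finset ℕ} (hQ : ∀ p ∈ Q, p.Prime) {s : ℝ} (hs : 0 < s)
    (hsum : Summable fun n : ℕ => (Nat.card {I : Ideal (𝓞 K) // Ideal.absNorm I = n} : ℝ) *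
      (n : ℝ) ^ (-s)) :
    ∏ p ∈ Q, (1 + (p : ℝ) ^ (-s)) ^ rootCount μ.reverse R p ≤
      ∑' n : ℕ, (Nat.card {I : Ideal (𝓞 K) // Ideal.absNorm I = n} : ℝ) * (n : ℝ) ^ (-s) := by
  classical
  have hex : ∀ i : Σ _ : ℕ, ℕ, ∃ M : Ideal (𝓞 K), (i.1.Prime ∧ ¬ i.1 ∣ R ∧
      (i.1 : ℤ) ∣ μ.reverse.eval (i.2 : ℤ)) → M.IsMaximal ∧ (i.1 : 𝓞 K) ∈ M ∧
      1 - (i.2 : 𝓞 K) * b ∈ M ∧ Ideal.absNorm M ≤ i.1 := by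
    intro i
    by_cases h : i.1.Prime ∧ ¬ i.1 ∣ R ∧ (i.1 : ℤ) ∣ μ.reverse.eval (i.2 : ℤ)
    · obtain ⟨M, hM⟩ := exists_maximal_of_dvd_eval_reverse hμ hdvd hΔ h.1
        (fun hc => h.2.1 (by exact_mod_cast hc.trans hR)) h.2.2
      exact ⟨M, fun _ => hM⟩
    · exact ⟨⊥, fun hc => absurd hc h⟩
  choose M hM using hex
  set P : Finset (Σ _ : ℕ, ℕ) := (Q.filter fun p => ¬ p ∣ R).sigma fun p => rootsBelow μ.reverse p
    with hP
  have hmem : ∀ i ∈ P, i.2 < i.1 ∧ (i.1.Prime ∧ ¬ i.1 ∣ R ∧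
      (i.1 : ℤ) ∣ μ.reverse.eval (i.2 : ℤ)) := by
    intro i hi
    rw [hP, Finset.mem_sigma, Finset.mem_filter, rootsBelow, Finset.mem_filter,
      Finset.mem_range] at hi
    exact ⟨hi.2.1, hQ _ hi.1.1, hi.1.2, hi.2.2⟩
  have hprod : ∏ p ∈ Q, (1 + (p : ℝ) ^ (-s)) ^ rootCount μ.reverse R p =
      ∏ i ∈ P, (1 + (i.1 : ℝ) ^ (-s)) := by
    rw [hP, Finset.prod_sigma, Finset.prod_filter]
    refine Finset.prod_congr rfl fun p _ => ?_
    rw [rootCount]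
    split_ifs <;> simp
  rw [hprod]
  refine prod_one_add_rpow_le_tsum P M (fun i hi => (hM i (hmem i hi).2).1) ?_ ?_
    (fun i hi => (hM i (hmem i hi).2).2.2.2) hs hsum
  · rintro ⟨p, e⟩ hi ⟨p', e'⟩ hi' h
    obtain ⟨hlt, hi⟩ := hmem _ hi
    obtain ⟨hlt', hi'⟩ := hmem _ hi'
    obtain ⟨hmax, hp, he, -⟩ := hM _ hi
    obtain ⟨-, hp', he', -⟩ := hM _ hi'
    rw [← h] at hp' he'
    dsimp only at hlt hlt' hp hp' he he' hi hi'
    have hpp : p = p' := by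
      by_contra hne
      have := not_mem_of_coprime hmax
        (Nat.isCoprime_iff_coprime.2 ((Nat.coprime_primes hi.1 hi'.1).2 hne)) (by exact_mod_cast hp)
      exact this (by exact_mod_cast hp')
    subst hpp
    have hee : e = e' := by
      by_contra hne
      have hcop : IsCoprime (p : ℤ) ((e : ℤ) - e') := by
        rw [(Nat.prime_iff_prime_int.1 hi.1).coprime_iff_not_dvd]
        intro hd
        have := Int.eq_zero_of_abs_lt_dvd hd (by rw [abs_lt]; constructor <;> omega)
        omega
      have h1 := not_mem_of_coprime hmax hcop (by exact_mod_cast hp)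
      have h2 : (((e : ℤ) - e' : ℤ) : 𝓞 K) * b ∈ M ⟨p, e⟩ := by
        have := (M ⟨p, e⟩).sub_mem he' he
        convert this using 1
        push_cast
        ring
      have hb := (hmax.isPrime.mem_or_mem h2).resolve_left h1
      apply hmax.ne_top
      rw [Ideal.eq_top_iff_one]
      have := (M ⟨p, e⟩).add_mem he ((M ⟨p, e⟩).mul_mem_left (e : 𝓞 K) hb)
      simpa using this
    rw [hee]
  · intro i hi hbot
    have := (hM i (hmem i hi).2).2.1
    rw [hbot, Ideal.mem_bot, Nat.cast_eq_zero] at this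
    exact (hmem i hi).2.1.ne_zero this
end

end

section
open Polynomial NumberField Filter Topology

theorem half_le_prod_one_sub_sq (N : ℕ) :
    (1 / 2 : ℝ) ≤ ∏ p ∈ N.primesBelow, (1 - ((p : ℝ) ^ 2)⁻¹) := by
  have key : ∀ k : ℕ, ∏ n ∈ Finset.Ico 2 (k + 2), (1 - ((n : ℝ) ^ 2)⁻¹) = (k + 2) / (2 * (k + 1)) := by
    intro k
    induction k with
    | zero => norm_num
    | succ k ih =>
      rw [show k + 1 + 2 = (k + 2) + 1 by ring, Finset.prod_Ico_succ_top (by omega), ih]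
      push_cast
      field_simp
      ring
  have hterm : ∀ n : ℕ, 2 ≤ n → 0 ≤ 1 - ((n : ℝ) ^ 2)⁻¹ ∧ 1 - ((n : ℝ) ^ 2)⁻¹ ≤ 1 := by
    intro n hn
    have : (2 : ℝ) ≤ n := by exact_mod_cast hn
    refine ⟨sub_nonneg.2 (inv_le_one_of_one_le₀ (by nlinarith)), ?_⟩
    have : (0 : ℝ) ≤ ((n : ℝ) ^ 2)⁻¹ := by positivity
    linarith
  have hsub : N.primesBelow ⊆ Finset.Ico 2 (N + 2) := by
    intro p hp
    have := Nat.lt_of_mem_primesBelow hp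
    have := (Nat.prime_of_mem_primesBelow hp).two_le
    rw [Finset.mem_Ico]; omega
  calc (1 / 2 : ℝ) ≤ (N + 2) / (2 * (N + 1)) := by
        rw [div_le_div_iff₀ (by norm_num) (by positivity)]; linarith
    _ = (∏ n ∈ Finset.Ico 2 (N + 2) \ N.primesBelow, (1 - ((n : ℝ) ^ 2)⁻¹)) *
          ∏ p ∈ N.primesBelow, (1 - ((p : ℝ) ^ 2)⁻¹) := by
        rw [Finset.prod_sdiff hsub, key]
    _ ≤ 1 * ∏ p ∈ N.primesBelow, (1 - ((p : ℝ) ^ 2)⁻¹) := by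
        gcongr
        · exact Finset.prod_nonneg fun p hp => (hterm p (Nat.prime_of_mem_primesBelow hp).two_le).1
        · exact Finset.prod_le_one
            (fun n hn => (hterm n (Finset.mem_Ico.1 (Finset.mem_sdiff.1 hn).1).1).1)
            (fun n hn => (hterm n (Finset.mem_Ico.1 (Finset.mem_sdiff.1 hn).1).1).2)
    _ = _ := one_mul _

theorem exists_quarter_tsum_le_prod {s : ℝ} (hs : 1 < s) :
    ∃ N : ℕ, (∑' n : ℕ, (n : ℝ) ^ (-s)) / 4 ≤ ∏ p ∈ N.primesBelow, (1 + (p : ℝ) ^ (-s)) := by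
  let f : ℕ →* ℝ :=
    { toFun := fun n => (n : ℝ) ^ (-s)
      map_one' := by simp
      map_mul' := fun m n => by
        push_cast
        rw [Real.mul_rpow (Nat.cast_nonneg _) (Nat.cast_nonneg _)] }
  have hsum : Summable f := by
    have := Real.summable_nat_rpow_inv.2 hs
    refine this.congr fun n => ?_
    rw [← Real.rpow_neg (Nat.cast_nonneg _)]; rfl
  have hf0 : f 0 = 0 := by
    change ((0 : ℕ) : ℝ) ^ (-s) = 0
    rw [Nat.cast_zero, Real.zero_rpow (by linarith)]
  have hnn : ∀ n, 0 ≤ f n := fun n => Real.rpow_nonneg (Nat.cast_nonneg _) _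
  have hpos : 0 < ∑' n, f n := hsum.tsum_pos hnn 1 (by simp)
  obtain ⟨N, hN⟩ := EulerProduct.norm_tsum_smoothNumbers_sub_tsum_lt (f := f) hsum hf0 (half_pos hpos)
  refine ⟨N, ?_⟩
  have h1 := (abs_lt.1 (Real.norm_eq_abs _ ▸ hN N le_rfl)).2
  rw [← EulerProduct.prod_primesBelow_geometric_eq_tsum_smoothNumbers hsum] at h1
  have h2 : (∏ p ∈ N.primesBelow, (1 - f p)⁻¹) * (1 / 2) ≤ ∏ p ∈ N.primesBelow, (1 + f p) := by
    have hfp : ∀ p ∈ N.primesBelow, 0 ≤ f p ∧ f p ^ 2 ≤ ((p : ℝ) ^ 2)⁻¹ ∧ f p < 1 := by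
      intro p hp
      have h2 : (2 : ℝ) ≤ p := by exact_mod_cast (Nat.prime_of_mem_primesBelow hp).two_le
      have h3 : f p ≤ (p : ℝ)⁻¹ := by
        rw [← Real.rpow_neg_one]
        exact Real.rpow_le_rpow_of_exponent_le (by linarith) (by linarith)
      refine ⟨hnn p, ?_, ?_⟩
      · rw [← inv_pow]; exact pow_le_pow_left₀ (hnn p) h3 2
      · refine h3.trans_lt (inv_lt_one_of_one_lt₀ (by linarith))
    calc (∏ p ∈ N.primesBelow, (1 - f p)⁻¹) * (1 / 2)
        ≤ (∏ p ∈ N.primesBelow, (1 - f p)⁻¹) * ∏ p ∈ N.primesBelow, (1 - ((p : ℝ) ^ 2)⁻¹) := by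
          refine mul_le_mul_of_nonneg_left (half_le_prod_one_sub_sq N) ?_
          exact Finset.prod_nonneg fun p hp => inv_nonneg.2 (by linarith [(hfp p hp).2.2])
      _ = ∏ p ∈ N.primesBelow, ((1 - f p)⁻¹ * (1 - ((p : ℝ) ^ 2)⁻¹)) := Finset.prod_mul_distrib.symm
      _ ≤ ∏ p ∈ N.primesBelow, (1 + f p) := by
          refine Finset.prod_le_prod (fun p hp => ?_) fun p hp => ?_
          · refine mul_nonneg (inv_nonneg.2 (by linarith [(hfp p hp).2.2])) ?_
            have h2 : (2 : ℝ) ≤ p := by exact_mod_cast (Nat.prime_of_mem_primesBelow hp).two_le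
            exact sub_nonneg.2 (inv_le_one_of_one_le₀ (by nlinarith))
          · have h := hfp p hp
            rw [inv_mul_le_iff₀ (by linarith)]
            nlinarith
  have h3 : (∑' n, f n) / 4 ≤ ∏ p ∈ N.primesBelow, (1 + f p) := by linarith
  exact h3

section
variable {K : Type*} [Field K] [NumberField K] {b : 𝓞 K} {μ : ℤ[X]}

theorem not_summable_natDegree_sub_rootCount (hμ : μ.Monic) (hμd : 2 ≤ μ.natDegree)
    (hdvd : ∀ A : ℤ[X], aeval b A = 0 → μ ∣ A) {Δ : ℤ}
    (hΔ : ∀ y : 𝓞 K, ∃ A : ℤ[X], (Δ : 𝓞 K) * y = aeval b A) {R : ℕ} (hR : Δ ∣ R) :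
    ¬ Summable fun p : ℕ => if p.Prime then
      ((μ.natDegree : ℝ) - rootCount μ.reverse R p) / p else 0 := by
  intro hw
  set d := μ.natDegree
  set r := rootCount μ.reverse R with hr
  have hrd : ∀ p : ℕ, p.Prime → r p ≤ d := fun p hp =>
    (rootCount_le (by rw [coeff_zero_reverse, hμ.leadingCoeff]) R hp).trans (reverse_natDegree_le _)
  set B := ∑' p : ℕ, if p.Prime then ((d : ℝ) - r p) / p else 0
  obtain ⟨C, hC⟩ := exists_forall_summable_dedekindZeta_le K
  have hev1 : ∀ᶠ s : ℝ in 𝓝[>] 1, (1 / 2 : ℝ) < (s - 1) * ∑' (n : ℕ), 1 / (n : ℝ) ^ s :=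
    tendsto_sub_mul_tsum_nat_rpow.eventually_const_lt (by norm_num)
  have hev2 : ∀ᶠ s : ℝ in 𝓝[>] 1, 64 * (C * Real.exp B) * (s - 1) < 1 := by
    have : Tendsto (fun s : ℝ => 64 * (C * Real.exp B) * (s - 1)) (𝓝[>] 1) (𝓝 0) := by
      have : Continuous fun s : ℝ => 64 * (C * Real.exp B) * (s - 1) := by fun_prop
      have := (this.tendsto 1).mono_left (nhdsWithin_le_nhds (s := Set.Ioi 1))
      simpa using this
    exact this.eventually_lt_const one_pos
  obtain ⟨s, hCs, h1, h2, hs⟩ := (hC.and (hev1.and (hev2.and self_mem_nhdsWithin))).exists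
  have hs : 1 < s := hs
  obtain ⟨N, hN⟩ := exists_quarter_tsum_le_prod hs
  set Z := ∑' n : ℕ, (n : ℝ) ^ (-s)
  set T := ∏ p ∈ N.primesBelow, (1 + (p : ℝ) ^ (-s)) with hT
  have hZ : 1 / 2 < (s - 1) * Z := by
    refine h1.trans_eq ?_
    congr 1
    exact tsum_congr fun n => by rw [Real.rpow_neg (Nat.cast_nonneg _), one_div]
  have hf1 : ∀ p : ℕ, 1 ≤ 1 + (p : ℝ) ^ (-s) := fun p =>
    le_add_of_nonneg_right (Real.rpow_nonneg (Nat.cast_nonneg _) _)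
  have hT1 : 1 ≤ T := Finset.one_le_prod fun p _ => hf1 p
  have hTd : T ^ d = (∏ p ∈ N.primesBelow, (1 + (p : ℝ) ^ (-s)) ^ r p) *
      ∏ p ∈ N.primesBelow, (1 + (p : ℝ) ^ (-s)) ^ (d - r p) := by
    rw [hT, ← Finset.prod_pow, ← Finset.prod_mul_distrib]
    refine Finset.prod_congr rfl fun p hp => ?_
    rw [← pow_add, Nat.add_sub_of_le (hrd p (Nat.prime_of_mem_primesBelow hp))]
  have hw2 : ∏ p ∈ N.primesBelow, (1 + (p : ℝ) ^ (-s)) ^ (d - r p) ≤ Real.exp B := by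
    calc ∏ p ∈ N.primesBelow, (1 + (p : ℝ) ^ (-s)) ^ (d - r p)
        ≤ ∏ p ∈ N.primesBelow, Real.exp (if p.Prime then ((d : ℝ) - r p) / p else 0) := by
          refine Finset.prod_le_prod (fun p _ => by have := hf1 p; positivity) fun p hp => ?_
          have hp := Nat.prime_of_mem_primesBelow hp
          have hp2 : (2 : ℝ) ≤ p := by exact_mod_cast hp.two_le
          rw [if_pos hp, ← Nat.cast_sub (hrd p hp), div_eq_mul_inv, Real.exp_nat_mul]
          refine pow_le_pow_left₀ (by linarith [hf1 p]) ?_ _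
          have h3 : (p : ℝ) ^ (-s) ≤ (p : ℝ)⁻¹ := by
            rw [← Real.rpow_neg_one]
            exact Real.rpow_le_rpow_of_exponent_le (by linarith) (by linarith)
          linarith [Real.add_one_le_exp ((p : ℝ)⁻¹)]
      _ = Real.exp (∑ p ∈ N.primesBelow, if p.Prime then ((d : ℝ) - r p) / p else 0) :=
          (Real.exp_sum _ _).symm
      _ ≤ Real.exp B := by
          refine Real.exp_le_exp.2 (hw.sum_le_tsum _ fun p _ => ?_)
          split_ifs with hp
          · exact div_nonneg (sub_nonneg.2 (by exact_mod_cast hrd p hp)) (Nat.cast_nonneg _)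
          · exact le_rfl
  have hs1 : 0 < s - 1 := by linarith
  have hr2 := (prod_one_add_rpow_pow_rootCount_le hμ hdvd hΔ hR (Q := N.primesBelow)
    (fun p hp => Nat.prime_of_mem_primesBelow hp) (s := s) (by linarith) hCs.1).trans hCs.2
  have hTle : T ^ 2 ≤ C / (s - 1) * Real.exp B := by
    calc T ^ 2 ≤ T ^ d := pow_le_pow_right₀ hT1 hμd
      _ ≤ _ := by
        rw [hTd]
        refine mul_le_mul hr2 hw2 (Finset.prod_nonneg fun p _ => by have := hf1 p; positivity) ?_
        exact (Finset.prod_nonneg fun p _ => by have := hf1 p; positivity).trans hr2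
  have hZpos : 0 < Z := by
    by_contra! hc
    nlinarith
  have h4 : (Z / 4) ^ 2 ≤ C / (s - 1) * Real.exp B :=
    (pow_le_pow_left₀ (by positivity) hN 2).trans hTle
  have h5 : ((s - 1) * Z) ^ 2 ≤ 16 * (C * Real.exp B) * (s - 1) := by
    have : C / (s - 1) * Real.exp B * (s - 1) = C * Real.exp B := by field_simp
    nlinarith [mul_le_mul_of_nonneg_right h4 (sq_nonneg (s - 1))]
  nlinarith
end

end

section
open Filter Topology

theorem exists_sqrt_log_le_sum_mul_log {g : ℕ → ℝ} (hg : ∀ n, 0 ≤ g n) (hns : ¬ Summable g) (X₀ : ℕ) :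
    ∃ X : ℕ, X₀ ≤ X ∧ √(Real.log X) ≤ ∑ n ∈ Finset.range (X + 1), g n * Real.log n := by
  by_contra! hcon
  apply hns
  set x : ℕ → ℕ := fun k => 2 ^ 2 ^ k with hx
  have hxk : ∀ k, k ≤ x k := fun k => (Nat.lt_two_pow_self.le).trans Nat.lt_two_pow_self.le
  have hmono : ∀ k, x k ≤ x (k + 1) := fun k =>
    Nat.pow_le_pow_right two_pos (Nat.pow_le_pow_right two_pos k.le_succ)
  have hlog : ∀ k, Real.log (x k) = 2 ^ k * Real.log 2 := fun k => by
    simp only [hx]; push_cast; rw [Real.log_pow]; push_cast; ring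
  set a : ℕ → ℝ := fun k => √(Real.log (x k)) with ha
  have hl2 : 0 < Real.log 2 := Real.log_pos one_lt_two
  have hlpos : ∀ k, 0 < Real.log (x k) := fun k => by rw [hlog]; positivity
  have hapos : ∀ k, 0 < a k := fun k => Real.sqrt_pos.2 (hlpos k)
  have hsq : ∀ k, a k ^ 2 = Real.log (x k) := fun k => Real.sq_sqrt (hlpos k).le
  have hasucc : ∀ k, a (k + 1) = √2 * a k := fun k => by
    simp only [ha]
    rw [← Real.sqrt_mul (by norm_num), hlog, hlog]; ring_nf
  set S : ℕ → ℝ := fun k => ∑ n ∈ Finset.range (x k + 1), g n with hS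
  have h2 : √2 ^ 2 = 2 := Real.sq_sqrt (by norm_num)
  have h2lo : (1.4 : ℝ) ≤ √2 := Real.le_sqrt_of_sq_le (by norm_num)
  have hstep : ∀ k, X₀ ≤ x k → S (k + 1) + 5 / a (k + 1) ≤ S k + 5 / a k := by
    intro k hk
    have hlt := hcon (x (k + 1)) (hk.trans (hmono k))
    have hinc : S (k + 1) - S k ≤ √2 / a k := by
      have h1 : (S (k + 1) - S k) * Real.log (x k) ≤ a (k + 1) := by
        have : S (k + 1) - S k = ∑ n ∈ Finset.Ico (x k + 1) (x (k + 1) + 1), g n := by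
          rw [Finset.sum_Ico_eq_sub _ (by have := hmono k; omega)]
        rw [this, Finset.sum_mul]
        refine le_trans ?_ hlt.le
        calc ∑ n ∈ Finset.Ico (x k + 1) (x (k + 1) + 1), g n * Real.log (x k)
            ≤ ∑ n ∈ Finset.Ico (x k + 1) (x (k + 1) + 1), g n * Real.log n := by
              refine Finset.sum_le_sum fun n hn => mul_le_mul_of_nonneg_left ?_ (hg n)
              have : x k ≤ n := by have := (Finset.mem_Ico.1 hn).1; omega
              exact Real.log_le_log (by simp only [hx]; positivity) (by exact_mod_cast this)
          _ ≤ _ := by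
              refine Finset.sum_le_sum_of_subset_of_nonneg (fun n hn => ?_) fun n _ _ =>
                mul_nonneg (hg n) (Real.log_natCast_nonneg n)
              exact Finset.mem_range.2 (Finset.mem_Ico.1 hn).2
      rw [← hsq, hasucc] at h1
      rw [le_div_iff₀ (hapos k)]
      have := hapos k
      nlinarith
    have h5 : 5 / a (k + 1) = 5 / √2 / a k := by rw [hasucc]; field_simp
    have h6 : √2 / a k + 5 / √2 / a k ≤ 5 / a k := by
      rw [← add_div]
      gcongr
      rw [← le_sub_iff_add_le', div_le_iff₀ (by positivity)]
      nlinarith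
    rw [h5]
    linarith
  have hall : ∀ j, S (X₀ + j) + 5 / a (X₀ + j) ≤ S X₀ + 5 / a X₀ := by
    intro j
    induction j with
    | zero => exact le_rfl
    | succ j ih => exact (hstep (X₀ + j) ((Nat.le_add_right _ _).trans (hxk _))).trans ih
  refine summable_of_sum_range_le (c := S X₀ + 5 / a X₀) hg fun n => ?_
  have h7 := hall n
  have h8 : 0 < 5 / a (X₀ + n) := div_pos (by norm_num) (hapos _)
  have h9 : ∑ i ∈ Finset.range n, g i ≤ S (X₀ + n) := by
    refine Finset.sum_le_sum_of_subset_of_nonneg (fun i hi => ?_) fun i _ _ => hg i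
    have := hxk (X₀ + n)
    rw [Finset.mem_range] at hi ⊢
    omega
  linarith

end

section
open Polynomial

theorem log_eq_sum_of_primeFactors_subset {n : ℕ} {s : Finset ℕ} (hs : n.primeFactors ⊆ s) :
    Real.log n = ∑ p ∈ s, (n.factorization p : ℝ) * Real.log p := by
  rw [Real.log_nat_eq_sum_factorization]
  exact Finsupp.sum_of_support_subset _ (by simpa using hs) _ (by simp)

theorem pow_dvd_sub_of_pow_dvd_eval {W : ℤ[X]} {p k : ℕ} (hp : p.Prime) {e e' : ℤ}
    (he : (p : ℤ) ^ k ∣ W.eval e) (he' : (p : ℤ) ^ k ∣ W.eval e') (hpe : (p : ℤ) ∣ e' - e)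
    (hder : ¬ (p : ℤ) ∣ W.derivative.eval e) : (p : ℤ) ^ k ∣ e' - e := by
  obtain ⟨q, hq⟩ := W.binomExpansion e (e' - e)
  rw [add_sub_cancel] at hq
  have h1 : (p : ℤ) ^ k ∣ (e' - e) * (W.derivative.eval e + q * (e' - e)) := by
    have : (e' - e) * (W.derivative.eval e + q * (e' - e)) = W.eval e' - W.eval e := by
      rw [hq]; ring
    rw [this]
    exact dvd_sub he' he
  refine IsCoprime.dvd_of_dvd_mul_right (IsCoprime.pow_left ?_) h1
  rw [(Nat.prime_iff_prime_int.1 hp).coprime_iff_not_dvd]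
  intro hd
  exact hder ((dvd_add_left (hpe.mul_left q)).1 hd)

theorem card_pow_dvd_eval_le {W : ℤ[X]} (hW0 : W.coeff 0 = 1) {R : ℕ} {U T : ℤ[X]} {R₀ : ℤ}
    (hUT : U * W + T * W.derivative = C R₀) (hR : R₀ ∣ R) {p k : ℕ} (hp : p.Prime) (hk : 1 ≤ k)
    (Y : ℕ) :
    ((Finset.Icc 1 Y).filter fun m : ℕ => p ^ k ∣ (W.eval ((R * m : ℕ) : ℤ)).natAbs).card ≤
      rootCount W R p * (Y / p ^ k + 1) := by
  have hdv : ∀ e : ℤ, p ^ k ∣ (W.eval e).natAbs ↔ (p : ℤ) ^ k ∣ W.eval e := fun e => by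
    rw [← Int.natCast_dvd, Nat.cast_pow]
  simp only [hdv]
  have hdv1 : ∀ e : ℤ, (p : ℤ) ^ k ∣ W.eval e → (p : ℤ) ∣ W.eval e := fun e h =>
    (dvd_pow_self _ (by omega)).trans h
  unfold rootCount
  split_ifs with hpR
  · rw [zero_mul, Nat.le_zero, Finset.card_eq_zero, Finset.filter_eq_empty_iff]
    intro m _ h
    have h1 := hdv1 _ h
    have h2 : ((R * m : ℕ) : ℤ) - 0 ∣ W.eval ((R * m : ℕ) : ℤ) - W.eval 0 := W.sub_dvd_eval_sub _ _
    rw [sub_zero, ← coeff_zero_eq_eval_zero, hW0] at h2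
    have h3 : (p : ℤ) ∣ ((R * m : ℕ) : ℤ) := by exact_mod_cast hpR.mul_right m
    have h4 := (dvd_sub_right h1).1 (h3.trans h2)
    exact (Nat.prime_iff_prime_int.1 hp).not_isUnit (isUnit_of_dvd_one h4)
  have hpR' : ¬ (p : ℤ) ∣ R := by exact_mod_cast hpR
  set A := (Finset.Icc 1 Y).filter fun m : ℕ => (p : ℤ) ^ k ∣ W.eval ((R * m : ℕ) : ℤ) with hA
  have himg : A.image (fun m => (R * m) % p) ⊆ rootsBelow W p := by
    intro e he
    obtain ⟨m, hm, rfl⟩ := Finset.mem_image.1 he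
    rw [rootsBelow, Finset.mem_filter, Finset.mem_range]
    refine ⟨Nat.mod_lt _ hp.pos, ?_⟩
    have h1 := hdv1 _ (Finset.mem_filter.1 hm).2
    have h2 := W.sub_dvd_eval_sub ((R * m : ℕ) : ℤ) ((R * m % p : ℕ) : ℤ)
    have h3 : (p : ℤ) ∣ ((R * m : ℕ) : ℤ) - ((R * m % p : ℕ) : ℤ) := by
      push_cast
      exact Int.dvd_self_sub_emod
    exact (dvd_sub_right h1).1 (h3.trans h2)
  have hfib : ∀ e ∈ A.image (fun m => (R * m) % p),
      (A.filter fun m => (R * m) % p = e).card ≤ Y / p ^ k + 1 := by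
    intro e _
    rw [← Finset.card_range (Y / p ^ k + 1)]
    refine Finset.card_le_card_of_injOn (fun m => m / p ^ k) (fun m hm => ?_) ?_
    · have h1 := (Finset.mem_filter.1 (Finset.mem_filter.1 hm).1).1
      rw [Finset.mem_coe, Finset.mem_range]
      exact Nat.lt_succ_of_le (Nat.div_le_div_right (Finset.mem_Icc.1 h1).2)
    · intro m hm m' hm' hmm
      obtain ⟨hmA, hme⟩ := Finset.mem_filter.1 hm
      obtain ⟨hmA', hme'⟩ := Finset.mem_filter.1 hm'
      have hv := (Finset.mem_filter.1 hmA).2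
      have hv' := (Finset.mem_filter.1 hmA').2
      have hp1 : (p : ℤ) ∣ ((R * m' : ℕ) : ℤ) - ((R * m : ℕ) : ℤ) :=
        (Nat.modEq_iff_dvd).1 (show R * m ≡ R * m' [MOD p] from hme.trans hme'.symm)
      have hder : ¬ (p : ℤ) ∣ W.derivative.eval ((R * m : ℕ) : ℤ) := by
        intro hd
        have := congrArg (fun q => q.eval ((R * m : ℕ) : ℤ)) hUT
        simp only [eval_add, eval_mul, eval_C] at this
        apply hpR'
        refine dvd_trans ?_ hR
        rw [← this]
        exact dvd_add ((hdv1 _ hv).mul_left _) (hd.mul_left _)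
      have h5 := pow_dvd_sub_of_pow_dvd_eval hp hv hv' hp1 hder
      have h6 : (p : ℤ) ^ k ∣ R * ((m' : ℤ) - m) := by
        convert h5 using 1; push_cast; ring
      have h7 : (p : ℤ) ^ k ∣ (m' : ℤ) - m := by
        refine IsCoprime.dvd_of_dvd_mul_left (IsCoprime.pow_left ?_) h6
        rwa [(Nat.prime_iff_prime_int.1 hp).coprime_iff_not_dvd]
      have h8 : m ≡ m' [MOD p ^ k] := Nat.modEq_iff_dvd.2 (by push_cast; exact h7)
      have hmm : m / p ^ k = m' / p ^ k := hmm
      rw [← Nat.div_add_mod m (p ^ k), ← Nat.div_add_mod m' (p ^ k), hmm, h8]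
  calc A.card ≤ (Y / p ^ k + 1) * (A.image fun m => (R * m) % p).card :=
        Finset.card_le_mul_card_image A _ hfib
    _ ≤ (Y / p ^ k + 1) * (rootsBelow W p).card := Nat.mul_le_mul_left _ (Finset.card_le_card himg)
    _ = _ := mul_comm _ _

theorem factorization_le_card_pow_dvd {n p b : ℕ} (hp : p.Prime) (hn : n ≠ 0) (hb : Nat.log p n ≤ b) :
    n.factorization p ≤ ((Finset.Ico 1 (b + 1)).filter fun k => p ^ k ∣ n).card := by
  have hsub : Finset.Ico 1 (n.factorization p + 1) ⊆
      (Finset.Ico 1 (b + 1)).filter fun k => p ^ k ∣ n := by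
    intro k hk
    rw [Finset.mem_Ico] at hk
    have h1 : p ^ k ∣ n := (hp.pow_dvd_iff_le_factorization hn).2 (by omega)
    have h2 : k ≤ Nat.log p n := Nat.le_log_of_pow_le hp.one_lt (Nat.le_of_dvd (by omega) h1)
    rw [Finset.mem_filter, Finset.mem_Ico]
    exact ⟨by omega, h1⟩
  simpa using Finset.card_le_card hsub

/-- The elements of `[1, Y]` at which `N` has a prime factor exceeding `Z`. -/
noncomputable def largePrimeSet (N : ℕ → ℕ) (Y Z : ℕ) : Finset ℕ :=
  open Classical in (Finset.Icc 1 Y).filter fun m => ∃ p : ℕ, p.Prime ∧ Z < p ∧ p ∣ N m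

theorem sum_log_le_of_card_pow_dvd_le {N r : ℕ → ℕ} {d Y D B : ℕ} (hN0 : ∀ m ∈ Finset.Icc 1 Y, N m ≠ 0)
    (hNB : ∀ m ∈ Finset.Icc 1 Y, N m ≤ B) (hYB : Y ≤ B) (hr : ∀ p, p.Prime → r p ≤ d)
    (hcount : ∀ p, p.Prime → ∀ k, 1 ≤ k →
      ((Finset.Icc 1 Y).filter fun m => p ^ k ∣ N m).card ≤ r p * (Y / p ^ k + 1)) (hD : 1 ≤ D) :
    ∑ m ∈ Finset.Icc 1 Y, Real.log (N m) ≤ (largePrimeSet N Y (D * Y)).card * Real.log B +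
      (d * Real.log (Y.factorial) - (Y / 2 : ℝ) * ∑ p ∈ Finset.range (Y + 1),
        (if p.Prime then ((d : ℝ) - r p) / p else 0) * Real.log p) +
      d * Nat.primeCounting (D * Y) * Real.log B := by
  classical
  set P := (Finset.range (D * Y + 1)).filter Nat.Prime with hP
  have hPp : ∀ p ∈ P, p.Prime := fun p hp => (Finset.mem_filter.1 hp).2
  set G := largePrimeSet N Y (D * Y) with hG
  have hGsub : G ⊆ Finset.Icc 1 Y := by rw [hG, largePrimeSet]; exact Finset.filter_subset _ _
  have hlogB : ∀ m ∈ Finset.Icc 1 Y, Real.log (N m) ≤ Real.log B := fun m hm =>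
    Real.log_le_log (by exact_mod_cast Nat.pos_of_ne_zero (hN0 m hm)) (by exact_mod_cast hNB m hm)
  have hlp : ∀ p : ℕ, 0 ≤ Real.log p := fun p => Real.log_natCast_nonneg p
  have hYfac : Y.factorial.primeFactors ⊆ P := by
    intro p hp
    have hpp := Nat.prime_of_mem_primeFactors hp
    have h1 : p ≤ Y := hpp.dvd_factorial.1 (Nat.dvd_of_mem_primeFactors hp)
    rw [hP, Finset.mem_filter, Finset.mem_range]
    exact ⟨by nlinarith, hpp⟩
  have hval : ∀ p ∈ P, Y.factorial.factorization p = ∑ k ∈ Finset.Ico 1 (Nat.log p B + 1), Y / p ^ k := by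
    intro p hp
    have := Fact.mk (hPp p hp)
    rw [Nat.factorization_def _ (hPp p hp)]
    exact padicValNat_factorial (Nat.lt_succ_of_le (Nat.log_mono_right hYB))
  have hbad : ∑ m ∈ Finset.Icc 1 Y \ G, Real.log (N m) ≤
      ∑ p ∈ P, (r p * (Y.factorial.factorization p + Nat.log p B) : ℝ) * Real.log p := by
    calc ∑ m ∈ Finset.Icc 1 Y \ G, Real.log (N m)
        ≤ ∑ m ∈ Finset.Icc 1 Y \ G, ∑ p ∈ P, ∑ k ∈ Finset.Ico 1 (Nat.log p B + 1),
            (if p ^ k ∣ N m then Real.log p else 0) := by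
          refine Finset.sum_le_sum fun m hm => ?_
          obtain ⟨hm1, hmG⟩ := Finset.mem_sdiff.1 hm
          rw [log_eq_sum_of_primeFactors_subset (s := P)]
          · refine Finset.sum_le_sum fun p hp => ?_
            rw [← Finset.sum_filter, Finset.sum_const, nsmul_eq_mul]
            refine mul_le_mul_of_nonneg_right ?_ (hlp p)
            exact_mod_cast factorization_le_card_pow_dvd (hPp p hp) (hN0 m hm1)
              (Nat.log_mono_right (hNB m hm1))
          · intro p hp
            have hpp := Nat.prime_of_mem_primeFactors hp
            rw [hP, Finset.mem_filter, Finset.mem_range, Nat.lt_succ_iff]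
            refine ⟨?_, hpp⟩
            by_contra! hc
            exact hmG (by
              rw [hG, largePrimeSet, Finset.mem_filter]
              exact ⟨hm1, p, hpp, hc, Nat.dvd_of_mem_primeFactors hp⟩)
      _ ≤ ∑ m ∈ Finset.Icc 1 Y, ∑ p ∈ P, ∑ k ∈ Finset.Ico 1 (Nat.log p B + 1),
            (if p ^ k ∣ N m then Real.log p else 0) := by
          refine Finset.sum_le_sum_of_subset_of_nonneg Finset.sdiff_subset fun m _ _ => ?_
          refine Finset.sum_nonneg fun p _ => Finset.sum_nonneg fun k _ => ?_
          split_ifs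
          · exact hlp p
          · exact le_rfl
      _ = ∑ p ∈ P, ∑ k ∈ Finset.Ico 1 (Nat.log p B + 1),
            (((Finset.Icc 1 Y).filter fun m => p ^ k ∣ N m).card : ℝ) * Real.log p := by
          rw [Finset.sum_comm]
          refine Finset.sum_congr rfl fun p _ => ?_
          rw [Finset.sum_comm]
          refine Finset.sum_congr rfl fun k _ => ?_
          rw [← Finset.sum_filter, Finset.sum_const, nsmul_eq_mul]
      _ ≤ ∑ p ∈ P, (r p * (Y.factorial.factorization p + Nat.log p B) : ℝ) * Real.log p := by
          refine Finset.sum_le_sum fun p hp => ?_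
          rw [← Finset.sum_mul]
          refine mul_le_mul_of_nonneg_right ?_ (hlp p)
          rw [hval p hp]
          have : ∑ k ∈ Finset.Ico 1 (Nat.log p B + 1),
              ((Finset.Icc 1 Y).filter fun m => p ^ k ∣ N m).card ≤
              r p * ((∑ k ∈ Finset.Ico 1 (Nat.log p B + 1), Y / p ^ k) + Nat.log p B) := by
            calc _ ≤ ∑ k ∈ Finset.Ico 1 (Nat.log p B + 1), r p * (Y / p ^ k + 1) :=
                  Finset.sum_le_sum fun k hk => hcount p (hPp p hp) k (Finset.mem_Ico.1 hk).1
              _ = _ := by rw [← Finset.mul_sum, Finset.sum_add_distrib]; simp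
          exact_mod_cast this
  have hsplit : ∑ p ∈ P, (r p * (Y.factorial.factorization p + Nat.log p B) : ℝ) * Real.log p ≤
      (d * Real.log (Y.factorial) - (Y / 2 : ℝ) * ∑ p ∈ Finset.range (Y + 1),
        (if p.Prime then ((d : ℝ) - r p) / p else 0) * Real.log p) +
      d * Nat.primeCounting (D * Y) * Real.log B := by
    have hsecond : ∑ p ∈ P, (r p : ℝ) * (Nat.log p B) * Real.log p ≤
        d * Nat.primeCounting (D * Y) * Real.log B := by
      calc ∑ p ∈ P, (r p : ℝ) * (Nat.log p B) * Real.log p ≤ ∑ p ∈ P, d * Real.log B := by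
            refine Finset.sum_le_sum fun p hp => ?_
            have h1 : (Nat.log p B : ℝ) * Real.log p ≤ Real.log B := by
              rcases Nat.eq_zero_or_pos B with rfl | hB
              · simp
              rw [← Real.log_pow]
              have : p ^ Nat.log p B ≤ B := Nat.pow_log_le_self p hB.ne'
              refine Real.log_le_log (by have := (hPp p hp).pos; positivity) (by exact_mod_cast this)
            have h2 : (r p : ℝ) ≤ d := by exact_mod_cast hr p (hPp p hp)
            rw [mul_assoc]
            exact mul_le_mul h2 h1 (mul_nonneg (Nat.cast_nonneg _) (hlp p)) (Nat.cast_nonneg _)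
        _ = _ := by
            rw [Finset.sum_const, nsmul_eq_mul, Nat.primeCounting, Nat.primeCounting',
              Nat.count_eq_card_filter_range]
            ring
    have hfirst : ∑ p ∈ P, (r p : ℝ) * Y.factorial.factorization p * Real.log p =
        d * Real.log Y.factorial - ∑ p ∈ P, ((d : ℝ) - r p) * Y.factorial.factorization p * Real.log p := by
      rw [log_eq_sum_of_primeFactors_subset hYfac, Finset.mul_sum, ← Finset.sum_sub_distrib]
      exact Finset.sum_congr rfl fun p _ => by ring
    have hw : (Y / 2 : ℝ) * ∑ p ∈ Finset.range (Y + 1),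
        (if p.Prime then ((d : ℝ) - r p) / p else 0) * Real.log p ≤
        ∑ p ∈ P, ((d : ℝ) - r p) * Y.factorial.factorization p * Real.log p := by
      calc _ = ∑ p ∈ (Finset.range (Y + 1)).filter Nat.Prime,
            ((d : ℝ) - r p) * (Y / (2 * p)) * Real.log p := by
            rw [Finset.mul_sum, Finset.sum_filter]
            refine Finset.sum_congr rfl fun p _ => ?_
            split_ifs with hp
            · have : (p : ℝ) ≠ 0 := by exact_mod_cast hp.ne_zero
              field_simp
            · simp
        _ ≤ ∑ p ∈ (Finset.range (Y + 1)).filter Nat.Prime,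
            ((d : ℝ) - r p) * Y.factorial.factorization p * Real.log p := by
            refine Finset.sum_le_sum fun p hp => ?_
            obtain ⟨hpY, hpp⟩ := Finset.mem_filter.1 hp
            rw [Finset.mem_range, Nat.lt_succ_iff] at hpY
            have h2 : (r p : ℝ) ≤ d := by exact_mod_cast hr p hpp
            have hp0 : (0 : ℝ) < p := by exact_mod_cast hpp.pos
            refine mul_le_mul_of_nonneg_right (mul_le_mul_of_nonneg_left ?_ (sub_nonneg.2 h2)) (hlp p)
            have h3 : Y / p ≤ Y.factorial.factorization p := by
              have := Fact.mk hpp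
              rw [Nat.factorization_def _ hpp, padicValNat_factorial (Nat.lt_succ_self _)]
              have hmem : 1 ∈ Finset.Ico 1 (Nat.log p Y + 1) := by
                rw [Finset.mem_Ico]
                have := Nat.log_pos hpp.one_lt hpY
                omega
              have := Finset.single_le_sum (f := fun k => Y / p ^ k) (fun _ _ => Nat.zero_le _) hmem
              simpa using this
            have h4 : (Y : ℝ) / (2 * p) ≤ (Y / p : ℕ) := by
              rw [div_le_iff₀ (by positivity)]
              have h5 : 1 ≤ Y / p := Nat.div_pos hpY hpp.pos
              have h6 : Y < p * (Y / p + 1) := Nat.lt_mul_div_succ Y hpp.pos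
              have h7 : Y ≤ (Y / p) * (2 * p) := by nlinarith
              exact_mod_cast h7
            exact h4.trans (by exact_mod_cast h3)
        _ ≤ _ := by
            refine Finset.sum_le_sum_of_subset_of_nonneg ?_ fun p hp _ => ?_
            · refine Finset.filter_subset_filter _ (Finset.range_subset_range.2 ?_)
              nlinarith
            · have h2 : (r p : ℝ) ≤ d := by exact_mod_cast hr p (hPp p hp)
              exact mul_nonneg (mul_nonneg (sub_nonneg.2 h2) (Nat.cast_nonneg _)) (hlp p)
    have : ∑ p ∈ P, (r p * (Y.factorial.factorization p + Nat.log p B) : ℝ) * Real.log p =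
        ∑ p ∈ P, (r p : ℝ) * Y.factorial.factorization p * Real.log p +
        ∑ p ∈ P, (r p : ℝ) * (Nat.log p B) * Real.log p := by
      rw [← Finset.sum_add_distrib]
      exact Finset.sum_congr rfl fun p _ => by ring
    rw [this, hfirst]
    linarith
  have hgood : ∑ m ∈ G, Real.log (N m) ≤ G.card * Real.log B := by
    rw [← nsmul_eq_mul]
    exact Finset.sum_le_card_nsmul _ _ _ fun m hm => hlogB m (hGsub hm)
  rw [← Finset.sum_sdiff hGsub]
  linarith

end

section
open Polynomial Filter Asymptotics

theorem isTheta_natAbs_eval_mul {W : ℤ[X]} (hW : W ≠ 0) {R : ℕ} (hR : R ≠ 0) :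
    (fun m : ℕ => ((W.eval ((R * m : ℕ) : ℤ)).natAbs : ℝ)) =Θ[atTop]
      fun m : ℕ => (m : ℝ) ^ W.natDegree := by
  set P : ℝ[X] := W.map (Int.castRingHom ℝ) with hP
  have hinj : Function.Injective (Int.castRingHom ℝ) := Int.cast_injective
  have hPd : P.natDegree = W.natDegree := natDegree_map_eq_of_injective hinj W
  have hlead : P.leadingCoeff ≠ 0 :=
    leadingCoeff_ne_zero.2 ((Polynomial.map_ne_zero_iff hinj).2 hW)
  have ht : Tendsto (fun m : ℕ => (R : ℝ) * m) atTop atTop :=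
    (tendsto_natCast_atTop_atTop (R := ℝ)).const_mul_atTop (by positivity)
  have h0 := (Polynomial.isEquivalent_atTop_lead P).isTheta
  have h1 := (show _ =Θ[atTop] _ from ⟨h0.1.comp_tendsto ht, h0.2.comp_tendsto ht⟩)
  have h2 : (fun m : ℕ => ((W.eval ((R * m : ℕ) : ℤ)).natAbs : ℝ)) =
      fun m : ℕ => ‖P.eval ((R : ℝ) * m)‖ := by
    funext m
    have := eval₂_at_apply (p := W) (Int.castRingHom ℝ) ((R * m : ℕ) : ℤ)
    rw [← eval_map] at this
    rw [Nat.cast_natAbs, Int.cast_abs, Real.norm_eq_abs]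
    simpa using congrArg abs this.symm
  rw [h2]
  refine (isTheta_norm_left.2 h1).trans ?_
  have h3 : ((fun x => P.leadingCoeff * x ^ P.natDegree) ∘ fun m : ℕ => (R : ℝ) * m) =
      fun m : ℕ => (P.leadingCoeff * (R : ℝ) ^ P.natDegree) * (m : ℝ) ^ W.natDegree := by
    funext m; simp only [Function.comp, mul_pow, hPd]; ring
  rw [h3]
  exact isTheta_const_mul_left (by positivity) |>.2 (isTheta_refl _ _)

/-- The density bound for the integers `m` at which a squarefree integer polynomial takes a value
with a prime factor larger than `D * Y`. -/
theorem exists_card_largePrimeSet_ge {W : ℤ[X]} (hW0 : W.coeff 0 = 1) (hWne : ∀ e : ℤ, W.eval e ≠ 0)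
    (hd : 1 ≤ W.natDegree) {R : ℕ} (hR0 : R ≠ 0) {U T : ℤ[X]} {R₀ : ℤ}
    (hUT : U * W + T * W.derivative = C R₀) (hR : R₀ ∣ R)
    (hns : ¬ Summable fun p : ℕ => if p.Prime then ((W.natDegree : ℝ) - rootCount W R p) / p else 0)
    {D : ℕ} (hD : 1 ≤ D) :
    ∃ c : ℝ, 0 < c ∧ ∀ X₀ : ℕ, ∃ X, X₀ ≤ X ∧ ∀ Y : ℕ, X ≤ Y → Y ≤ X ^ 2 →
      c * Y ≤ √(Real.log X) *
        (largePrimeSet (fun m => (W.eval ((R * m : ℕ) : ℤ)).natAbs) Y (D * Y)).card := by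
  set d := W.natDegree with hdd
  set N : ℕ → ℕ := fun m => (W.eval ((R * m : ℕ) : ℤ)).natAbs with hN
  have hNne : ∀ m, N m ≠ 0 := fun m => Int.natAbs_ne_zero.2 (hWne _)
  have hTh := isTheta_natAbs_eval_mul (W := W) (by rintro rfl; simp at hW0) hR0
  obtain ⟨C0, hC0, hup⟩ := bound_of_isBigO_nat_atTop hTh.1
  obtain ⟨C1, hC1, hlo⟩ := bound_of_isBigO_nat_atTop hTh.2
  obtain ⟨A, hA⟩ := exists_nat_ge (max C0 1)
  have hA1 : 1 ≤ A := by exact_mod_cast (le_max_right _ _).trans hA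
  have hup' : ∀ m, 1 ≤ m → N m ≤ A * m ^ d := by
    intro m hm
    have h := hup (x := m) (by positivity)
    rw [Real.norm_of_nonneg (by positivity), Real.norm_of_nonneg (by positivity)] at h
    have : (N m : ℝ) ≤ A * (m : ℝ) ^ d :=
      h.trans (mul_le_mul_of_nonneg_right ((le_max_left _ _).trans hA) (by positivity))
    exact_mod_cast this
  have hlo' : ∀ m : ℕ, 1 ≤ m → d * Real.log m - Real.log C1 ≤ Real.log (N m) := by
    intro m hm
    have hNm : (0 : ℝ) < N m := by exact_mod_cast (hNne m).bot_lt
    have h := hlo (x := m) hNm.ne'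
    rw [Real.norm_of_nonneg (by positivity), Real.norm_of_nonneg (by positivity)] at h
    have h2 := Real.log_le_log (by positivity) h
    rw [Real.log_pow, Real.log_mul hC1.ne' hNm.ne'] at h2
    linarith
  set g : ℕ → ℝ := fun p => if p.Prime then ((d : ℝ) - rootCount W R p) / p else 0 with hg
  have hg0 : ∀ n, 0 ≤ g n := by
    intro n
    simp only [hg]
    split_ifs with hn
    · have : (rootCount W R n : ℝ) ≤ d := by exact_mod_cast rootCount_le hW0 R hn
      exact div_nonneg (by linarith) (by positivity)
    · exact le_rfl
  have hpi : ∀ᶠ Y : ℕ in atTop, (Nat.primeCounting (D * Y) : ℝ) ≤ 2 * (D * Y) / Real.log (D * Y) := by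
    have h1 : Tendsto (fun Y : ℕ => (D : ℝ) * Y) atTop atTop :=
      (tendsto_natCast_atTop_atTop (R := ℝ)).const_mul_atTop (by positivity)
    have hl4 : Real.log 4 < 2 := by
      have : Real.log 4 = 2 * Real.log 2 := by
        rw [show (4 : ℝ) = 2 ^ 2 by norm_num, Real.log_pow]; norm_num
      have := Real.log_two_lt_d9
      linarith
    have h2 := h1.eventually (Chebyshev.eventually_primeCounting_le (ε := 2 - Real.log 4) (by linarith))
    filter_upwards [h2] with Y hY
    have h3 : ⌊(D : ℝ) * Y⌋₊ = D * Y := by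
      rw [← Nat.cast_mul, Nat.floor_natCast]
    rw [h3] at hY
    simpa using hY
  obtain ⟨Y₁, hY₁⟩ := eventually_atTop.1 hpi
  set C4 : ℝ := max (Real.log C1 + 2 * d * D * (d + 1)) 1 with hC4
  have hroot : Tendsto (fun X : ℕ => √(Real.log X)) atTop atTop :=
    Real.tendsto_sqrt_atTop.comp (Real.tendsto_log_atTop.comp tendsto_natCast_atTop_atTop)
  obtain ⟨X₂, hX₂⟩ := eventually_atTop.1 (hroot.eventually_ge_atTop (4 * C4))
  refine ⟨1 / (8 * (d + 1)), by positivity, fun X₀ => ?_⟩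
  obtain ⟨X, hX, hsq⟩ := exists_sqrt_log_le_sum_mul_log hg0 hns (X₀ + Y₁ + X₂ + A + 2)
  refine ⟨X, by omega, fun Y hXY hYX => ?_⟩
  have hY2 : 2 ≤ Y := by omega
  have hYr : (2 : ℝ) ≤ Y := by exact_mod_cast hY2
  have hlogY : 0 < Real.log Y := Real.log_pos (by linarith)
  have hXr : (2 : ℝ) ≤ X := by exact_mod_cast (by omega : 2 ≤ X)
  have hlogX : 0 < Real.log X := Real.log_pos (by linarith)
  have hYB : Y ≤ A * Y ^ d := by
    calc Y = 1 * Y ^ 1 := by simp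
      _ ≤ A * Y ^ d := Nat.mul_le_mul hA1 (Nat.pow_le_pow_right (by omega) hd)
  have key := sum_log_le_of_card_pow_dvd_le (N := N) (r := rootCount W R) (d := d) (Y := Y) (D := D)
    (B := A * Y ^ d) (fun m _ => hNne m)
    (fun m hm => (hup' m (Finset.mem_Icc.1 hm).1).trans
      (Nat.mul_le_mul_left _ (Nat.pow_le_pow_left (Finset.mem_Icc.1 hm).2 _)))
    hYB (fun p hp => rootCount_le hW0 R hp)
    (fun p hp k hk => card_pow_dvd_eval_le hW0 hUT hR hp hk Y) hD
  have hfac : ∑ m ∈ Finset.Icc 1 Y, Real.log m = Real.log (Y.factorial) := by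
    have hprod : ∏ m ∈ Finset.Icc 1 Y, m = Y.factorial := by
      rw [← Finset.prod_range_add_one_eq_factorial, Finset.range_eq_Ico, Finset.prod_Ico_add' (fun i => i)]
      rfl
    rw [← hprod, Nat.cast_prod, Real.log_prod]
    intro m hm
    have := (Finset.mem_Icc.1 hm).1
    positivity
  have hlow : d * Real.log (Y.factorial) - Y * Real.log C1 ≤
      ∑ m ∈ Finset.Icc 1 Y, Real.log (N m) := by
    calc _ = ∑ m ∈ Finset.Icc 1 Y, (d * Real.log m - Real.log C1) := by
          rw [Finset.sum_sub_distrib, ← Finset.mul_sum, hfac]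
          simp
      _ ≤ _ := Finset.sum_le_sum fun m hm => hlo' m (Finset.mem_Icc.1 hm).1
  have hlogB : Real.log ((A * Y ^ d : ℕ) : ℝ) ≤ (d + 1) * Real.log Y := by
    push_cast
    rw [Real.log_mul (by positivity) (by positivity), Real.log_pow]
    have : Real.log A ≤ Real.log Y := Real.log_le_log (by positivity) (by exact_mod_cast (by omega : A ≤ Y))
    linarith
  have hB0 : 0 ≤ Real.log ((A * Y ^ d : ℕ) : ℝ) := Real.log_natCast_nonneg _
  have hpi' : d * (Nat.primeCounting (D * Y) : ℝ) * Real.log ((A * Y ^ d : ℕ) : ℝ) ≤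
      2 * d * D * (d + 1) * Y := by
    have h1 := hY₁ Y (by omega)
    have h2 : Real.log Y ≤ Real.log (D * Y) := by
      refine Real.log_le_log (by linarith) ?_
      have : (1 : ℝ) ≤ D := by exact_mod_cast hD
      nlinarith
    calc _ ≤ d * (2 * (D * Y) / Real.log Y) * ((d + 1) * Real.log Y) := by
          gcongr
          exact h1.trans (by gcongr)
      _ = _ := by field_simp
  have hDelta : √(Real.log X) ≤ ∑ p ∈ Finset.range (Y + 1), g p * Real.log p := by
    refine hsq.trans (Finset.sum_le_sum_of_subset_of_nonneg ?_ fun n _ _ =>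
      mul_nonneg (hg0 n) (Real.log_natCast_nonneg n))
    exact Finset.range_subset_range.2 (by omega)
  have hbig := hX₂ X (by omega)
  set S := √(Real.log X) with hS
  have hSS : S * S = Real.log X := Real.mul_self_sqrt hlogX.le
  have hS0 : 0 < S := Real.sqrt_pos.2 hlogX
  have hlogYX : Real.log Y ≤ 2 * (S * S) := by
    rw [hSS]
    calc Real.log Y ≤ Real.log ((X : ℝ) ^ 2) := Real.log_le_log (by linarith) (by exact_mod_cast hYX)
      _ = _ := by rw [Real.log_pow]; norm_num
  set G : ℝ := ((largePrimeSet N Y (D * Y)).card : ℝ) with hG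
  have hG0 : 0 ≤ G := by positivity
  have h1 : (Y : ℝ) * (S / 4) ≤ G * ((d + 1) * Real.log Y) := by
    have h2 : G * Real.log ((A * Y ^ d : ℕ) : ℝ) ≤ G * ((d + 1) * Real.log Y) := by gcongr
    have h3 : (Y / 2 : ℝ) * S ≤ (Y / 2 : ℝ) * ∑ p ∈ Finset.range (Y + 1), g p * Real.log p := by gcongr
    have h4 : (Y : ℝ) * (Real.log C1 + 2 * d * D * (d + 1)) ≤ Y * (S / 4) := by
      gcongr
      have := le_max_left (Real.log C1 + 2 * d * D * (d + 1)) 1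
      linarith
    linarith
  have h5 : (Y : ℝ) * (S / 4) ≤ G * ((d + 1) * (2 * (S * S))) := h1.trans (by gcongr)
  have h6 : (Y : ℝ) / 4 ≤ G * ((d + 1) * (2 * S)) := by
    have : S * (Y / 4) ≤ S * (G * ((d + 1) * (2 * S))) := by linarith
    exact le_of_mul_le_mul_left this hS0
  rw [div_mul_eq_mul_div, div_le_iff₀ (by positivity)]
  linarith

end

section
open Polynomial Filter

theorem exists_coloring_of_card_filter_lt_le {r : ℕ → ℕ → Prop} [DecidableRel r] {B : ℕ} (G : Finset ℕ)
    (h : ∀ i ∈ G, (G.filter fun j => j < i ∧ r j i).card ≤ B) :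
    ∃ col : ℕ → ℕ, ∀ i ∈ G, col i ≤ B ∧ ∀ j ∈ G, j < i → r j i → col j ≠ col i := by
  induction G using Finset.induction_on_max with
  | empty => exact ⟨fun _ => 0, by simp⟩
  | insert a s hs ih =>
    have has : a ∉ s := fun ha => lt_irrefl _ (hs a ha)
    obtain ⟨col, hcol⟩ := ih fun i hi =>
      (Finset.card_le_card (Finset.filter_subset_filter _ (Finset.subset_insert a s))).trans
        (h i (Finset.mem_insert_of_mem hi))
    set V := ((insert a s).filter fun j => j < a ∧ r j a).image col with hV
    have hVc : V.card < (Finset.range (B + 1)).card := by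
      rw [Finset.card_range, Nat.lt_succ_iff]
      exact Finset.card_image_le.trans (h a (Finset.mem_insert_self _ _))
    obtain ⟨k, hk, hkV⟩ := Finset.exists_mem_notMem_of_card_lt_card hVc
    refine ⟨Function.update col a k, fun i hi => ?_⟩
    rcases Finset.mem_insert.1 hi with rfl | hi
    · refine ⟨by simpa using Nat.lt_succ_iff.1 (Finset.mem_range.1 hk), fun j hj hji hr => ?_⟩
      rw [Function.update_of_ne hji.ne, Function.update_self]
      rintro rfl
      exact hkV (Finset.mem_image_of_mem _ (Finset.mem_filter.2 ⟨hj, hji, hr⟩))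
    · have hia := hs i hi
      rw [Function.update_of_ne hia.ne]
      refine ⟨(hcol i hi).1, fun j hj hji hr => ?_⟩
      rw [Function.update_of_ne (hji.trans hia).ne]
      refine (hcol i hi).2 j ?_ hji hr
      exact (Finset.mem_insert.1 hj).resolve_left (hji.trans hia).ne

theorem exists_independent_subset {r : ℕ → ℕ → Prop} [DecidableRel r] {B : ℕ} (G : Finset ℕ)
    (h : ∀ i ∈ G, (G.filter fun j => j < i ∧ r j i).card ≤ B) (w : ℕ → ℝ) :
    ∃ J ⊆ G, (∀ i ∈ J, ∀ j ∈ J, j < i → ¬ r j i) ∧ ∑ i ∈ G, w i ≤ (B + 1) * ∑ i ∈ J, w i := by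
  obtain ⟨col, hcol⟩ := exists_coloring_of_card_filter_lt_le G h
  have hmap : ∀ i ∈ G, col i ∈ Finset.range (B + 1) := fun i hi =>
    Finset.mem_range.2 (Nat.lt_succ_of_le (hcol i hi).1)
  by_contra! hcon
  have h1 : ∀ k ∈ Finset.range (B + 1), ∑ i ∈ G with col i = k, w i <
      (∑ i ∈ G, w i) / (B + 1) := by
    intro k _
    rw [lt_div_iff₀' (by positivity)]
    refine hcon _ (Finset.filter_subset _ _) fun i hi j hj hji hr => ?_
    rw [Finset.mem_filter] at hi hj
    exact (hcol i hi.1).2 j hj.1 hji hr (hj.2.trans hi.2.symm)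
  have h2 := Finset.sum_lt_sum_of_nonempty (by simp) h1
  rw [Finset.sum_fiberwise_of_maps_to hmap, Finset.sum_const, Finset.card_range, nsmul_eq_mul] at h2
  push_cast at h2
  rw [mul_div_cancel₀ _ (by positivity)] at h2
  exact lt_irrefl _ h2

theorem log_div_le_sum_inv_of_card_ge {H : Finset ℕ} {η : ℝ} (hη : 0 ≤ η) {X M : ℕ} (hX : 1 ≤ X)
    (hXM : X ≤ M) (hH : ∀ m ∈ H, 1 ≤ m ∧ m ≤ M)
    (hc : ∀ Y, X ≤ Y → Y ≤ M → η * Y ≤ (H.filter (· ≤ Y)).card) :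
    η * (Real.log (M + 2) - Real.log (X + 1)) ≤ ∑ m ∈ H, (m : ℝ)⁻¹ := by
  have htel : ∀ a b : ℕ, 1 ≤ a → a ≤ b + 1 →
      ∑ Y ∈ Finset.Ico a (b + 1), ((Y : ℝ) * (Y + 1))⁻¹ = (a : ℝ)⁻¹ - ((b + 1 : ℕ) : ℝ)⁻¹ := by
    intro a b ha hab
    rw [← neg_sub, ← Finset.sum_Ico_sub (fun n : ℕ => (n : ℝ)⁻¹) hab, ← Finset.sum_neg_distrib]
    refine Finset.sum_congr rfl fun Y hY => ?_
    have : (Y : ℝ) ≠ 0 := by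
      have := (Finset.mem_Ico.1 hY).1
      exact_mod_cast (by omega : Y ≠ 0)
    push_cast
    field_simp
    ring
  calc η * (Real.log (M + 2) - Real.log (X + 1))
      = η * ∑ Y ∈ Finset.Ico X (M + 1), (Real.log ((Y + 1 : ℕ) + 1) - Real.log (Y + 1)) := by
        rw [Finset.sum_Ico_sub (fun n : ℕ => Real.log (n + 1)) (by omega)]
        push_cast
        ring_nf
    _ ≤ ∑ Y ∈ Finset.Ico X (M + 1), ((H.filter (· ≤ Y)).card : ℝ) * ((Y : ℝ) * (Y + 1))⁻¹ := by
        rw [Finset.mul_sum]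
        refine Finset.sum_le_sum fun Y hY => ?_
        have hY' := Finset.mem_Ico.1 hY
        have hY0 : (0 : ℝ) < Y := by exact_mod_cast (by omega : 0 < Y)
        have h1 : Real.log ((Y + 1 : ℕ) + 1) - Real.log (Y + 1) ≤ ((Y : ℝ) + 1)⁻¹ := by
          rw [← Real.log_div (by positivity) (by positivity)]
          refine (Real.log_le_sub_one_of_pos (by positivity)).trans_eq ?_
          push_cast
          field_simp
          ring
        calc _ ≤ η * ((Y : ℝ) + 1)⁻¹ := by gcongr
          _ = η * Y * ((Y : ℝ) * (Y + 1))⁻¹ := by field_simp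
          _ ≤ _ := by gcongr; exact hc Y hY'.1 (by omega)
    _ = ∑ Y ∈ Finset.Ico X (M + 1), ∑ m ∈ H, if m ≤ Y then ((Y : ℝ) * (Y + 1))⁻¹ else 0 := by
        refine Finset.sum_congr rfl fun Y _ => ?_
        rw [← Finset.sum_filter, Finset.sum_const, nsmul_eq_mul]
    _ = ∑ m ∈ H, ∑ Y ∈ Finset.Ico X (M + 1), if m ≤ Y then ((Y : ℝ) * (Y + 1))⁻¹ else 0 :=
        Finset.sum_comm
    _ ≤ ∑ m ∈ H, (m : ℝ)⁻¹ := by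
        refine Finset.sum_le_sum fun m hm => ?_
        obtain ⟨hm1, hmM⟩ := hH m hm
        rw [← Finset.sum_filter]
        calc _ ≤ ∑ Y ∈ Finset.Ico m (M + 1), ((Y : ℝ) * (Y + 1))⁻¹ := by
              refine Finset.sum_le_sum_of_subset_of_nonneg (fun Y hY => ?_) fun _ _ _ => by positivity
              simp only [Finset.mem_filter, Finset.mem_Ico] at hY ⊢
              omega
          _ ≤ _ := by
              rw [htel m M hm1 (by omega)]
              exact sub_le_self _ (by positivity)

theorem card_le_of_prime_dvd_of_lt {s : Finset ℕ} {n X k : ℕ} (hn : n ≠ 0) (hX : 1 < X)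
    (hs : ∀ p ∈ s, p.Prime ∧ p ∣ n ∧ X < p) (hnX : n < X ^ (k + 1)) : s.card ≤ k := by
  have h1 : ∏ p ∈ s, p ∣ n := Finset.prod_primes_dvd n (fun p hp => (hs p hp).1.prime)
    fun p hp => (hs p hp).2.1
  have h2 : X ^ s.card ≤ ∏ p ∈ s, p := Finset.pow_card_le_prod _ _ _ fun p hp => (hs p hp).2.2.le
  have h3 := (h2.trans (Nat.le_of_dvd hn.bot_lt h1)).trans_lt hnX
  exact Nat.lt_succ_iff.1 ((Nat.pow_lt_pow_iff_right hX).1 h3)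

/-- There are many integers `m` that can be assigned primes `p m ∣ W (R m)` which are larger than
`D m` and divide none of the differences of the chosen integers. -/
theorem exists_separated_prime_divisors {W : ℤ[X]} (hW0 : W.coeff 0 = 1) (hWne : ∀ e : ℤ, W.eval e ≠ 0)
    (hd : 1 ≤ W.natDegree) {R : ℕ} (hR0 : R ≠ 0) {U T : ℤ[X]} {R₀ : ℤ}
    (hUT : U * W + T * W.derivative = C R₀) (hR : R₀ ∣ R)
    (hns : ¬ Summable fun p : ℕ => if p.Prime then ((W.natDegree : ℝ) - rootCount W R p) / p else 0)
    {D : ℕ} (hD : 1 ≤ D) :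
    ∃ c : ℝ, 0 < c ∧ ∀ X₀ : ℕ, ∃ X, X₀ ≤ X ∧ ∃ (J : Finset ℕ) (p : ℕ → ℕ),
      (∀ m ∈ J, 1 ≤ m ∧ m ≤ X ^ 2 ∧ (p m).Prime ∧ D * m < p m ∧
        (p m : ℤ) ∣ W.eval ((R * m : ℕ) : ℤ)) ∧
      (∀ i ∈ J, ∀ j ∈ J, i ≠ j → ¬ (p i : ℤ) ∣ (j : ℤ) - i) ∧
      c * √(Real.log X) ≤ ∑ m ∈ J, (m : ℝ)⁻¹ := by
  obtain ⟨c, hc, hcX⟩ := exists_card_largePrimeSet_ge hW0 hWne hd hR0 hUT hR hns hD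
  set d := W.natDegree with hdd
  set N : ℕ → ℕ := fun m => (W.eval ((R * m : ℕ) : ℤ)).natAbs with hN
  have hNne : ∀ m, N m ≠ 0 := fun m => Int.natAbs_ne_zero.2 (hWne _)
  have hTh := isTheta_natAbs_eval_mul (W := W) (by rintro rfl; simp at hW0) hR0
  obtain ⟨C0, hC0, hup⟩ := Asymptotics.bound_of_isBigO_nat_atTop hTh.1
  obtain ⟨A, hA⟩ := exists_nat_ge C0
  have hup' : ∀ m, 1 ≤ m → N m ≤ A * m ^ d := by
    intro m hm
    have h := hup (x := m) (by positivity)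
    rw [Real.norm_of_nonneg (by positivity), Real.norm_of_nonneg (by positivity)] at h
    have : (N m : ℝ) ≤ A * (m : ℝ) ^ d := h.trans (mul_le_mul_of_nonneg_right hA (by positivity))
    exact_mod_cast this
  refine ⟨c / (2 * (2 * d + 1)), by positivity, fun X₀ => ?_⟩
  obtain ⟨X, hX, hcX⟩ := hcX (X₀ + A + 4)
  refine ⟨X, by omega, ?_⟩
  have hX4 : (4 : ℝ) ≤ X := by exact_mod_cast (by omega : 4 ≤ X)
  have hlogX : 0 < Real.log X := Real.log_pos (by linarith)
  set S := √(Real.log X) with hS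
  have hSS : S * S = Real.log X := Real.mul_self_sqrt hlogX.le
  have hS0 : 0 < S := Real.sqrt_pos.2 hlogX
  classical
  set G : Finset ℕ := (Finset.Icc 1 (X ^ 2)).filter
    fun m => ∃ p : ℕ, p.Prime ∧ p ∣ N m ∧ D * m < p ∧ X < p with hG
  have hGmem : ∀ m ∈ G, (1 ≤ m ∧ m ≤ X ^ 2) ∧ ∃ p : ℕ, p.Prime ∧ p ∣ N m ∧ D * m < p ∧ X < p := by
    intro m hm
    simpa [hG] using hm
  have hXX : X ≤ X ^ 2 := Nat.le_self_pow (by norm_num) X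
  have hGsum := log_div_le_sum_inv_of_card_ge (H := G) (η := c / S) (by positivity)
    (by omega : 1 ≤ X) hXX (fun m hm => (hGmem m hm).1) (by
      intro Y hXY hYX
      have h1 := hcX Y hXY hYX
      rw [div_mul_eq_mul_div, div_le_iff₀ hS0, mul_comm _ S]
      refine h1.trans ?_
      gcongr
      intro m hm
      rw [largePrimeSet, Finset.mem_filter, Finset.mem_Icc] at hm
      obtain ⟨⟨hm1, hmY⟩, p, hp, hDp, hpN⟩ := hm
      rw [Finset.mem_filter, hG, Finset.mem_filter, Finset.mem_Icc]
      exact ⟨⟨⟨hm1, hmY.trans hYX⟩, p, hp, hpN, (Nat.mul_le_mul_left D hmY).trans_lt hDp,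
        (hXY.trans (Nat.le_mul_of_pos_left Y hD)).trans_lt hDp⟩, hmY⟩)
  have hlog : Real.log X / 2 ≤ Real.log ((X ^ 2 : ℕ) + 2) - Real.log (X + 1) := by
    have h1 : Real.log ((X : ℝ) ^ 2) ≤ Real.log ((X ^ 2 : ℕ) + 2) :=
      Real.log_le_log (by positivity) (by push_cast; linarith)
    have h2 : Real.log (X + 1) ≤ Real.log (2 * X) := Real.log_le_log (by positivity) (by linarith)
    have h3 : Real.log ((2 : ℝ) ^ 2) ≤ Real.log X := Real.log_le_log (by positivity) (by linarith)
    rw [Real.log_pow] at h1 h3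
    rw [Real.log_mul (by norm_num) (by positivity)] at h2
    push_cast at h1 h3 ⊢
    linarith
  choose! p hp using fun m hm => (hGmem m hm).2
  have hdvd : ∀ m, ∀ n : ℕ, n ∣ N m ↔ (n : ℤ) ∣ W.eval ((R * m : ℕ) : ℤ) := fun m n =>
    Int.natCast_dvd.symm
  have hlt : ∀ j ∈ G, j < p j := fun j hj =>
    (Nat.le_mul_of_pos_left j hD).trans_lt (hp j hj).2.2.1
  have hconf : ∀ i ∈ G, (G.filter fun j => j < i ∧ (p j : ℤ) ∣ (i : ℤ) - j).card ≤ 2 * d := by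
    intro i hi
    set s := G.filter fun j => j < i ∧ (p j : ℤ) ∣ (i : ℤ) - j with hs
    have hinj : Set.InjOn p s := by
      intro j hj j' hj' h
      rw [hs, Finset.mem_coe, Finset.mem_filter] at hj hj'
      have h1 : (p j : ℤ) ∣ (j' : ℤ) - j := by
        have := dvd_sub hj.2.2 (h ▸ hj'.2.2)
        simpa using this
      have h2 := (Nat.modEq_iff_dvd.2 h1)
      have h3 := h2.eq_of_lt_of_lt (hlt j hj.1) (h ▸ hlt j' hj'.1)
      exact h3
    rw [← Finset.card_image_of_injOn hinj]
    refine card_le_of_prime_dvd_of_lt (n := N i) (X := X) (hNne i) (by omega) ?_ ?_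
    · intro P hP
      obtain ⟨j, hj, rfl⟩ := Finset.mem_image.1 hP
      rw [hs, Finset.mem_filter] at hj
      obtain ⟨h1, h2, h3, h4⟩ := hp j hj.1
      refine ⟨h1, ?_, h4⟩
      rw [hdvd] at h2 ⊢
      have h5 := W.sub_dvd_eval_sub ((R * i : ℕ) : ℤ) ((R * j : ℕ) : ℤ)
      have h6 : (p j : ℤ) ∣ ((R * i : ℕ) : ℤ) - ((R * j : ℕ) : ℤ) := by
        push_cast
        rw [← mul_sub]
        exact hj.2.2.mul_left _
      exact (dvd_iff_dvd_of_dvd_sub (h6.trans h5)).2 h2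
    · obtain ⟨hi1, hi2⟩ := (hGmem i hi).1
      calc N i ≤ A * i ^ d := hup' i hi1
        _ ≤ A * (X ^ 2) ^ d := by gcongr
        _ < X * (X ^ 2) ^ d := Nat.mul_lt_mul_of_pos_right (by omega) (pow_pos (pow_pos (by omega) _) _)
        _ = X ^ (2 * d + 1) := by ring
  obtain ⟨J, hJG, hJ, hJsum⟩ := exists_independent_subset G hconf fun m => (m : ℝ)⁻¹
  refine ⟨J, p, fun m hm => ?_, fun i hi j hj hij h => ?_, ?_⟩
  · obtain ⟨⟨h1, h2⟩, -⟩ := hGmem m (hJG hm)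
    obtain ⟨h3, h4, h5, -⟩ := hp m (hJG hm)
    exact ⟨h1, h2, h3, h5, (hdvd _ _).1 h4⟩
  · rcases lt_or_gt_of_ne hij with hij | hij
    · exact hJ j hj i hi hij h
    · have h2 := (Nat.modEq_iff_dvd.2 h)
      have h3 := h2.eq_of_lt_of_lt (hlt i (hJG hi)) (hij.trans (hlt i (hJG hi)))
      omega
  · have h1 : c / S * (Real.log X / 2) ≤ (2 * d + 1) * ∑ m ∈ J, (m : ℝ)⁻¹ := by
      refine (le_trans (by gcongr) hGsum).trans (hJsum.trans_eq ?_)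
      push_cast
      rfl
    rw [← hSS] at h1
    have h2 : c / S * (S * S / 2) = c * S / 2 := by field_simp
    rw [h2] at h1
    rw [div_mul_eq_mul_div, div_le_iff₀ (by positivity)]
    linarith

end

section
open Polynomial Filter

theorem irreducible_mirror {K : Type*} [Field K] {p : K[X]} (hp : Irreducible p) :
    Irreducible p.mirror := by
  have hu : ∀ a : K[X], IsUnit a → IsUnit a.mirror := by
    intro a ha
    obtain ⟨r, hr, rfl⟩ := Polynomial.isUnit_iff.1 ha
    rw [mirror_C]
    exact ha
  refine ⟨fun h => hp.not_isUnit (p.mirror_mirror ▸ hu _ h), fun a b hab => ?_⟩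
  have h : p = a.mirror * b.mirror := by rw [← mirror_mul_of_domain, ← hab, mirror_mirror]
  refine (hp.isUnit_or_isUnit h).imp (fun h => a.mirror_mirror ▸ hu _ h)
    fun h => b.mirror_mirror ▸ hu _ h

theorem exists_mul_add_mul_derivative_eq_C {W : ℤ[X]}
    (h : (W.map (Int.castRingHom ℚ)).Separable) :
    ∃ (U T : ℤ[X]) (R₀ : ℤ), R₀ ≠ 0 ∧ U * W + T * W.derivative = C R₀ := by
  obtain ⟨u, v, huv⟩ := h
  obtain ⟨b, hb0, hb⟩ := IsLocalization.integerNormalization_spec (nonZeroDivisors ℤ) u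
  obtain ⟨c, hc0, hc⟩ := IsLocalization.integerNormalization_spec (nonZeroDivisors ℤ) v
  refine ⟨C c * IsLocalization.integerNormalization (nonZeroDivisors ℤ) u,
    C b * IsLocalization.integerNormalization (nonZeroDivisors ℤ) v, b * c,
    mul_ne_zero (nonZeroDivisors.ne_zero hb0) (nonZeroDivisors.ne_zero hc0),
    map_injective (Int.castRingHom ℚ) Int.cast_injective ?_⟩
  rw [algebraMap_int_eq] at hb hc
  rw [derivative_map] at huv
  simp only [Polynomial.map_add, Polynomial.map_mul, hb, hc, map_C, map_mul, zsmul_eq_mul]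
  rw [show (b : ℚ[X]) = C (Int.castRingHom ℚ b) by simp,
    show (c : ℚ[X]) = C (Int.castRingHom ℚ c) by simp]
  linear_combination (C (Int.castRingHom ℚ b) * C (Int.castRingHom ℚ c)) * huv

theorem reverse_minpoly_of_irrational {β : ℝ} (hβ : IsIntegral ℤ β) (hirr : Irrational β) :
    2 ≤ (minpoly ℤ β).natDegree ∧ (minpoly ℤ β).reverse.natDegree = (minpoly ℤ β).natDegree ∧
      (∀ e : ℤ, (minpoly ℤ β).reverse.eval e ≠ 0) ∧
      ((minpoly ℤ β).reverse.map (Int.castRingHom ℚ)).Separable := by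
  set μ := minpoly ℤ β with hμ
  have hβQ : IsIntegral ℚ β := hβ.tower_top
  have hmon : μ.Monic := minpoly.monic hβ
  have hmap : minpoly ℚ β = μ.map (Int.castRingHom ℚ) := by
    rw [minpoly.isIntegrallyClosed_eq_field_fractions' ℚ hβ, algebraMap_int_eq]
  have hdeg : (minpoly ℚ β).natDegree = μ.natDegree := by
    rw [hmap, hmon.natDegree_map]
  have hirrd := minpoly.irreducible hβQ
  have hd2 : 2 ≤ μ.natDegree := by
    rw [← hdeg, minpoly.two_le_natDegree_iff hβQ]
    rintro ⟨r, hr⟩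
    exact hirr ⟨r, by simpa using hr⟩
  have hroot : ∀ x : ℚ, ¬ (minpoly ℚ β).IsRoot x := by
    intro x hx
    have : (minpoly ℚ β).natDegree = 1 := natDegree_eq_of_degree_eq_some (degree_eq_one_of_irreducible_of_root hirrd hx)
    omega
  have h0 : (minpoly ℚ β).coeff 0 ≠ 0 := by
    rw [coeff_zero_eq_eval_zero]
    exact hroot 0
  have h0' : μ.coeff 0 ≠ 0 := by
    intro h
    rw [hmap, coeff_map, h] at h0
    simp at h0
  have hrev : μ.reverse.map (Int.castRingHom ℚ) = (minpoly ℚ β).mirror := by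
    rw [mirror, natTrailingDegree_eq_zero.2 (Or.inr h0), pow_zero, mul_one, reverse, reverse, hdeg,
      hmap, reflect_map]
  refine ⟨hd2, ?_, fun e he => ?_, ?_⟩
  · rw [reverse_natDegree, natTrailingDegree_eq_zero.2 (Or.inr h0'), Nat.sub_zero]
  · rcases eq_or_ne e 0 with rfl | he0
    · rw [← coeff_zero_eq_eval_zero, coeff_zero_reverse, hmon.leadingCoeff] at he
      exact one_ne_zero he
    · have heQ : (e : ℚ)⁻¹ ≠ 0 := inv_ne_zero (by exact_mod_cast he0)
      let _ : Invertible ((e : ℚ)⁻¹) := invertibleOfNonzero heQ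
      refine hroot (e : ℚ)⁻¹ ?_
      rw [IsRoot, hmap, eval_map]
      rw [← eval₂_reverse_eq_zero_iff, invOf_eq_inv, inv_inv]
      have := eval₂_at_apply (p := μ.reverse) (Int.castRingHom ℚ) e
      rw [he] at this
      simpa using this
  · rw [hrev]
    exact (irreducible_mirror hirrd).separable

/-- For `L - (k + 1) β = L x k` with `β` an irrational algebraic integer, there are many indices `i`
such that the numbers `x i` are multiplicatively independent of all other `x k`. -/
theorem exists_independent_indices {β : ℝ} (hβ : IsIntegral ℤ β) (hirr : Irrational β) (hneg : β < 0)
    {L : ℕ} (hL : 0 < L) {x : ℕ → ℝ} (hx : ∀ k, (L : ℝ) * x k = L - (k + 1) * β) :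
    ∃ c : ℝ, 0 < c ∧ ∀ X₀ : ℕ, ∃ X, X₀ ≤ X ∧ ∃ I : Finset ℕ,
      (∀ i ∈ I, L ∣ i + 1 ∧ i + 1 ≤ X ^ 3) ∧
      (∀ S ⊆ I, ∀ S' ⊆ I, ∀ l : List ℕ,
        ∏ i ∈ S, x i = (∏ i ∈ S', x i) * (l.map x).prod → S' ⊆ S) ∧
      (∀ i ∈ I, ∀ l : List ℕ, l ≠ [] → x i = (l.map x).prod → l = [i]) ∧
      c * √(Real.log X) ≤ ∑ i ∈ I, ((i : ℝ) + 1)⁻¹ := by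
  obtain ⟨hd2, hrd, hWne, hsep⟩ := reverse_minpoly_of_irrational hβ hirr
  obtain ⟨U, T, R₀, hR₀, hUT⟩ := exists_mul_add_mul_derivative_eq_C hsep
  obtain ⟨K, _, _, b, hb, Δ, hΔ, hΔb⟩ := exists_discr_mul_mem hβ
  have hmon : (minpoly ℤ β).Monic := minpoly.monic hβ
  have hdvd : ∀ A : ℤ[X], aeval β A = 0 → minpoly ℤ β ∣ A := fun A hA =>
    minpoly.isIntegrallyClosed_dvd hβ hA
  set μ := minpoly ℤ β with hμ
  set R : ℕ := (Δ * R₀).natAbs with hR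
  have hR0 : R ≠ 0 := Int.natAbs_ne_zero.2 (mul_ne_zero hΔ hR₀)
  have hRpos : 0 < R := hR0.bot_lt
  have hW0 : μ.reverse.coeff 0 = 1 := by rw [coeff_zero_reverse, hmon.leadingCoeff]
  have hns := not_summable_natDegree_sub_rootCount hmon hd2 (fun A hA => hdvd A (hb A hA)) hΔb
    (R := R) (Int.dvd_natAbs.2 (dvd_mul_right _ _))
  rw [← hrd] at hns
  obtain ⟨c, hc, hcX⟩ := exists_separated_prime_divisors hW0 hWne (by omega) hR0 hUT
    (Int.dvd_natAbs.2 (dvd_mul_left _ _)) hns (D := L * R) (Nat.mul_pos hL hRpos)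
  refine ⟨c / (L * R), by positivity, fun X₀ => ?_⟩
  obtain ⟨X, hX, J, p, hJ, hJsep, hJsum⟩ := hcX (X₀ + L * R)
  have hpR : ∀ m ∈ J, ¬ (p m : ℤ) ∣ R := by
    intro m hm h
    obtain ⟨-, -, hp, -, hpd⟩ := hJ m hm
    have h2 := μ.reverse.sub_dvd_eval_sub ((R * m : ℕ) : ℤ) 0
    rw [sub_zero, ← coeff_zero_eq_eval_zero, hW0] at h2
    have h3 : (p m : ℤ) ∣ ((R * m : ℕ) : ℤ) := by
      push_cast
      exact h.mul_right _
    exact (Nat.prime_iff_prime_int.1 hp).not_isUnit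
      (isUnit_of_dvd_one ((dvd_sub_right hpd).1 (h3.trans h2)))
  set J' := J.image fun m => R * m with hJ'
  set P : ℕ → ℕ := fun e => p (e / R) with hP
  have hPR : ∀ m, P (R * m) = p m := fun m => by rw [hP]; simp [Nat.mul_div_cancel_left _ hRpos]
  have hJ1 : ∀ e ∈ J', 1 ≤ e := by
    simp only [hJ', Finset.forall_mem_image]
    exact fun m hm => Nat.mul_pos hRpos (hJ m hm).1
  have hp : ∀ e ∈ J', (P e).Prime := by
    simp only [hJ', Finset.forall_mem_image, hPR]
    exact fun m hm => (hJ m hm).2.2.1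
  have hpL : ∀ e ∈ J', L * e < P e := by
    simp only [hJ', Finset.forall_mem_image, hPR, ← mul_assoc]
    exact fun m hm => (hJ m hm).2.2.2.1
  have hpe : ∀ e ∈ J', (P e : ℤ) ∣ μ.reverse.eval (e : ℤ) := by
    simp only [hJ', Finset.forall_mem_image, hPR]
    exact fun m hm => (hJ m hm).2.2.2.2
  have hsep' : ∀ e ∈ J', ∀ e' ∈ J', e ≠ e' → ¬ (P e : ℤ) ∣ (e' : ℤ) - e := by
    simp only [hJ', Finset.forall_mem_image, hPR]
    intro i hi j hj hij h
    push_cast at h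
    rw [← mul_sub] at h
    rcases (Nat.prime_iff_prime_int.1 (hJ i hi).2.2.1).dvd_or_dvd h with h | h
    · exact hpR i hi h
    · exact hJsep i hi j hj (by rintro rfl; exact hij rfl) h
  have hinj : Set.InjOn (fun e => L * e - 1) J' := by
    intro e he e' he' h
    have h1 := Nat.mul_pos hL (hJ1 e he)
    have h2 := Nat.mul_pos hL (hJ1 e' he')
    have h3 : L * e = L * e' := by simp only at h; omega
    exact Nat.eq_of_mul_eq_mul_left hL h3
  refine ⟨X, by omega, J'.image fun e => L * e - 1, ?_, ?_, ?_, ?_⟩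
  · simp only [Finset.forall_mem_image]
    intro e he
    rw [Nat.sub_add_cancel (Nat.mul_pos hL (hJ1 e he))]
    refine ⟨dvd_mul_right _ _, ?_⟩
    obtain ⟨m, hm, rfl⟩ := Finset.mem_image.1 he
    calc L * (R * m) = L * R * m := by ring
      _ ≤ X * X ^ 2 := Nat.mul_le_mul (by omega) (hJ m hm).2.1
      _ = X ^ 3 := by ring
  · intro S hS S' hS' l h
    exact subset_of_prod_eq hmon hdvd hL hx hJ1 hp hpL hpe hsep' hS hS' h
  · simp only [Finset.forall_mem_image]
    intro e he l _ h
    exact eq_singleton_of_eq_prod hmon hdvd hL hx hJ1 hp hpL hpe hneg he h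
  · rw [Finset.sum_image hinj, hJ', Finset.sum_image fun i _ j _ h => Nat.eq_of_mul_eq_mul_left hRpos h]
    calc c / (L * R) * √(Real.log X) = ((L : ℝ) * R)⁻¹ * (c * √(Real.log X)) := by
          field_simp
      _ ≤ ((L : ℝ) * R)⁻¹ * ∑ m ∈ J, (m : ℝ)⁻¹ := by gcongr
      _ = _ := by
          rw [Finset.mul_sum]
          refine Finset.sum_congr rfl fun m hm => ?_
          have h1 : 1 ≤ L * (R * m) := Nat.mul_pos hL (Nat.mul_pos hRpos (hJ m hm).1)
          rw [Nat.cast_sub h1]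
          push_cast
          rw [sub_add_cancel, ← mul_inv, mul_assoc]

end

section
open Filter Topology

theorem exists_forall_tsum_rpow_le : ∃ δ : ℝ, 0 < δ ∧ ∀ σ : ℝ, 1 < σ → σ < 1 + δ →
    ∑' k : ℕ, ((k : ℝ) + 1) ^ (-σ) ≤ 2 / (σ - 1) := by
  have h := tendsto_sub_mul_tsum_nat_rpow.eventually (eventually_le_nhds (by norm_num : (1 : ℝ) < 2))
  obtain ⟨u, hu, hu2⟩ := mem_nhdsGT_iff_exists_Ioo_subset.1 h
  refine ⟨u - 1, sub_pos.2 hu, fun σ hσ hσu => ?_⟩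
  have h1 : (σ - 1) * ∑' n : ℕ, 1 / (n : ℝ) ^ σ ≤ 2 := hu2 ⟨hσ, by linarith⟩
  have h2 : ∑' n : ℕ, 1 / (n : ℝ) ^ σ = ∑' k : ℕ, ((k : ℝ) + 1) ^ (-σ) := by
    rw [(Real.summable_one_div_nat_rpow.2 hσ).tsum_eq_zero_add, Nat.cast_zero,
      Real.zero_rpow (by linarith), div_zero, zero_add]
    refine tsum_congr fun k => ?_
    push_cast
    rw [Real.rpow_neg (by positivity), one_div]
  rw [h2] at h1
  rw [le_div_iff₀' (by linarith)]
  exact h1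

section
variable {a : ℕ → ℂ} {A τ : ℝ}

theorem norm_mul_rpow_neg_le (hτ : 0 < τ) (ha : ∀ k, ‖a k‖ ≤ A) {σ : ℝ} (hσ : 0 < σ) (k : ℕ) :
    ‖a k‖ * (1 + (k + 1) * τ) ^ (-σ) ≤ A * τ ^ (-σ) * ((k : ℝ) + 1) ^ (-σ) := by
  rw [mul_assoc, ← Real.mul_rpow (by positivity) (by positivity)]
  have h0 : (0 : ℝ) ≤ A := (norm_nonneg _).trans (ha k)
  refine mul_le_mul (ha k) ?_ (by positivity) h0
  exact Real.rpow_le_rpow_of_nonpos (by positivity) (by linarith) (by linarith)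

theorem summable_succ_rpow_neg {σ : ℝ} (hσ : 1 < σ) : Summable fun k : ℕ => ((k : ℝ) + 1) ^ (-σ) := by
  have := (summable_nat_add_iff 1).2 (Real.summable_nat_rpow.2 (by linarith : -σ < -1))
  simpa using this

theorem summable_norm_mul_rpow_neg (hτ : 0 < τ) (ha : ∀ k, ‖a k‖ ≤ A) {σ : ℝ} (hσ : 1 < σ) :
    Summable fun k : ℕ => ‖a k‖ * (1 + (k + 1) * τ) ^ (-σ) :=
  Summable.of_nonneg_of_le (fun k => by positivity)
    (fun k => norm_mul_rpow_neg_le hτ ha (by linarith) k)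
    ((summable_succ_rpow_neg hσ).mul_left _)

theorem exists_one_add_genDirichlet_eq_zero (hτ : 0 < τ) (ha : ∀ k, ‖a k‖ ≤ A) {L : ℕ} (hL : 0 < L)
    (haL : ∀ k, L ∣ k + 1 → a k = 1) (hint : IsIntegral ℤ (-(L * τ))) (hirr : Irrational τ) (t₀ : ℝ) :
    ∃ s : ℂ, 1 < s.re ∧ t₀ < s.im ∧ 1 + genDirichlet a (fun k => 1 + (k + 1) * τ) s = 0 := by
  by_contra! hne
  have hA : 0 ≤ A := (norm_nonneg _).trans (ha 0)
  have hLr : (0 : ℝ) < L := by exact_mod_cast hL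
  have hirr' : Irrational (-(L * τ)) := (hirr.natCast_mul hL.ne').neg
  obtain ⟨c, hc, hcX⟩ := exists_independent_indices hint hirr' (by simp; positivity) hL
    (x := fun k => 1 + (k + 1) * τ) (fun k => by ring)
  obtain ⟨δ, hδ, hδs⟩ := exists_forall_tsum_rpow_le
  set M : ℝ := 2 * A * (1 + τ⁻¹) ^ 2 with hM
  have hM0 : 0 ≤ M := by positivity
  set c' : ℝ := c * ((1 + τ) ^ 2 * Real.exp 3)⁻¹ with hc'
  have hc0 : 0 < c' := by positivity
  have hlogt : Tendsto (fun X : ℕ => Real.log X) atTop atTop :=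
    Real.tendsto_log_atTop.comp tendsto_natCast_atTop_atTop
  have hlit := (isLittleO_log_rpow_atTop (r := 1 / 2) (by norm_num)).bound
    (c := c' / (8 * √(2 + M))) (by positivity)
  have hy : Tendsto (fun X : ℕ => 1 + M * Real.log X + Real.log X) atTop atTop :=
    tendsto_atTop_mono' _ (by
      filter_upwards [hlogt.eventually_ge_atTop 0] with X hX
      nlinarith [mul_nonneg hM0 hX]) hlogt
  obtain ⟨X₀, hX₀⟩ := eventually_atTop.1 ((hlogt.eventually_gt_atTop (1 + δ⁻¹)).and (hy.eventually hlit))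
  obtain ⟨X, hX, I, hI, hadm, hir, hsum⟩ := hcX X₀
  obtain ⟨hX1, hX2⟩ := hX₀ X hX
  set u := Real.log X with hu
  have hδ' : 0 < δ⁻¹ := by positivity
  have hu1 : 1 < u := by linarith
  have hu0 : 0 < u := by linarith
  have hXpos : (0 : ℝ) < X := by
    rcases Nat.eq_zero_or_pos X with h | h
    · rw [hu, h] at hu1; simp at hu1; linarith
    · exact_mod_cast h
  set σ : ℝ := 1 + u⁻¹ with hσ
  have hσ1 : 1 < σ := by simp [hσ, hu0]
  have hσ2 : σ ≤ 2 := by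
    have := inv_le_one_of_one_le₀ hu1.le
    linarith
  have hσδ : σ < 1 + δ := by
    have : u⁻¹ < δ := inv_lt_of_inv_lt₀ hδ (by linarith)
    linarith
  have key := sum_rpow_le_of_zero_free (a := a) (x := fun k => 1 + (k + 1) * τ)
    (fun k => by simp; positivity) (c := 1 + τ) (by linarith)
    (fun k => by nlinarith [mul_nonneg (Nat.cast_nonneg (α := ℝ) k) hτ.le])
    (fun σ hσ => summable_norm_mul_rpow_neg hτ ha hσ) hne hσ1 hσ2 I (fun i hi => haL i (hI i hi).1)
    hadm hir
  have hupper : ∑' k : ℕ, ‖a k‖ * (1 + (k + 1) * τ) ^ (-σ) ≤ M * u := by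
    calc _ ≤ ∑' k : ℕ, A * τ ^ (-σ) * ((k : ℝ) + 1) ^ (-σ) :=
          (summable_norm_mul_rpow_neg hτ ha hσ1).tsum_le_tsum
            (fun k => norm_mul_rpow_neg_le hτ ha (by linarith) k)
            ((summable_succ_rpow_neg hσ1).mul_left _)
      _ = A * τ ^ (-σ) * ∑' k : ℕ, ((k : ℝ) + 1) ^ (-σ) := tsum_mul_left
      _ ≤ A * (1 + τ⁻¹) ^ 2 * (2 / (σ - 1)) := by
          have h1 : τ ^ (-σ) ≤ (1 + τ⁻¹) ^ 2 := by
            rw [Real.rpow_neg hτ.le, ← Real.inv_rpow hτ.le, ← Real.rpow_two]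
            calc (τ⁻¹) ^ σ ≤ (1 + τ⁻¹) ^ σ :=
                  Real.rpow_le_rpow (by positivity) (by linarith) (by linarith)
              _ ≤ _ := Real.rpow_le_rpow_of_exponent_le (by linarith [inv_pos.2 hτ]) hσ2
          exact mul_le_mul (mul_le_mul_of_nonneg_left h1 hA) (hδs σ hσ1 hσδ)
            (tsum_nonneg fun k => by positivity) (by positivity)
      _ = M * u := by
          rw [hσ, hM]
          field_simp
          ring
  have hlower : c' * √u ≤ ∑ i ∈ I, (1 + ((i : ℝ) + 1) * τ) ^ (-σ) := by
    have h1 : ∀ i ∈ I, ((1 + τ) ^ 2 * Real.exp 3)⁻¹ * ((i : ℝ) + 1)⁻¹ ≤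
        (1 + ((i : ℝ) + 1) * τ) ^ (-σ) := by
      intro i hi
      have hi1 : (0 : ℝ) < (i : ℝ) + 1 := by positivity
      rw [Real.rpow_neg (by positivity), ← mul_inv]
      refine inv_anti₀ (by positivity) ?_
      have h2 : 1 + ((i : ℝ) + 1) * τ ≤ (1 + τ) * (i + 1) := by
        nlinarith [Nat.cast_nonneg (α := ℝ) i]
      have h3 : ((i : ℝ) + 1) ^ u⁻¹ ≤ Real.exp 3 := by
        have h4 : (i : ℝ) + 1 ≤ (X : ℝ) ^ 3 := by exact_mod_cast (hI i hi).2
        have h5 : Real.log ((i : ℝ) + 1) ≤ 3 * u := by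
          have := Real.log_le_log hi1 h4
          rwa [Real.log_pow] at this
        rw [Real.rpow_def_of_pos hi1, Real.exp_le_exp, ← div_eq_mul_inv, div_le_iff₀ hu0]
        exact h5
      calc (1 + ((i : ℝ) + 1) * τ) ^ σ ≤ ((1 + τ) * (i + 1)) ^ σ :=
            Real.rpow_le_rpow (by positivity) h2 (by linarith)
        _ = (1 + τ) ^ σ * (((i : ℝ) + 1) ^ u⁻¹ * (i + 1)) := by
            rw [Real.mul_rpow (by positivity) hi1.le, hσ, Real.rpow_add hi1, Real.rpow_one,
              mul_comm ((i : ℝ) + 1) (((i : ℝ) + 1) ^ u⁻¹)]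
        _ ≤ (1 + τ) ^ 2 * (Real.exp 3 * (i + 1)) := by
            rw [← Real.rpow_two]
            gcongr
            linarith
        _ = _ := by ring
    calc c' * √u = ((1 + τ) ^ 2 * Real.exp 3)⁻¹ * (c * √u) := by rw [hc']; ring
      _ ≤ ((1 + τ) ^ 2 * Real.exp 3)⁻¹ * ∑ i ∈ I, ((i : ℝ) + 1)⁻¹ := by gcongr
      _ ≤ _ := by
          rw [Finset.mul_sum]
          exact Finset.sum_le_sum h1
  have hS : 0 < √u := Real.sqrt_pos.2 hu0
  have hS0 : 0 ≤ ∑' k : ℕ, ‖a k‖ * (1 + (k + 1) * τ) ^ (-σ) := tsum_nonneg fun k => by positivity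
  have hMu : 0 ≤ M * u := by positivity
  have hlog : Real.log (1 + ∑' k : ℕ, ‖a k‖ * (1 + (k + 1) * τ) ^ (-σ)) ≤ c' / 8 * √u := by
    calc _ ≤ Real.log (1 + M * u + u) := Real.log_le_log (by linarith) (by linarith)
      _ ≤ c' / (8 * √(2 + M)) * √(1 + M * u + u) := by
          rw [Real.norm_of_nonneg (Real.log_nonneg (by linarith)), Real.norm_of_nonneg (by positivity),
            ← Real.sqrt_eq_rpow] at hX2
          exact hX2
      _ ≤ c' / (8 * √(2 + M)) * √((2 + M) * u) := by
          gcongr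
          nlinarith
      _ = c' / 8 * √u := by
          rw [Real.sqrt_mul (by positivity)]
          field_simp
  have hcS : 0 < c' * √u := mul_pos hc0 hS
  linarith
end

end

section
open Filter Topology

theorem tsum_div_cpow_eq_zero_of_one_add_genDirichlet_eq_zero {f : ℕ → ℂ} {α : ℝ} (hα : 0 < α) {n₀ : ℕ}
    (hlt : ∀ n < n₀, f n = 0) (hn₀ : f n₀ ≠ 0) {A : ℝ} (hA : ∀ n, ‖f n‖ ≤ A) {s : ℂ} (hs : 1 < s.re)
    (h : 1 + genDirichlet (fun k => f (k + (n₀ + 1)) / f n₀)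
      (fun k => 1 + (k + 1) * ((n₀ : ℝ) + α)⁻¹) s = 0) :
    ∑' n : ℕ, f n / ((n : ℂ) + (α : ℂ)) ^ s = 0 := by
  set y : ℝ := (n₀ : ℝ) + α with hy
  have hy0 : 0 < y := by positivity
  have hA' : ∀ k, ‖f (k + (n₀ + 1)) / f n₀‖ ≤ A / ‖f n₀‖ := fun k => by
    rw [norm_div]
    exact div_le_div_of_nonneg_right (hA _) (norm_nonneg _)
  have hsum := summable_genDirichlet (a := fun k => f (k + (n₀ + 1)) / f n₀)
    (x := fun k => 1 + (k + 1) * y⁻¹) (fun k => by simp; positivity)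
    (fun σ hσ => summable_norm_mul_rpow_neg (inv_pos.2 hy0) hA' hσ) hs
  have hterm : ∀ k : ℕ, f (k + (n₀ + 1)) / (((k + (n₀ + 1) : ℕ) : ℂ) + (α : ℂ)) ^ s =
      f n₀ / (y : ℂ) ^ s * (f (k + (n₀ + 1)) / f n₀ * ((1 + (k + 1) * y⁻¹ : ℝ) : ℂ) ^ (-s)) := by
    intro k
    have h1 : (((k + (n₀ + 1) : ℕ) : ℂ) + (α : ℂ)) = (y : ℂ) * ((1 + (k + 1) * y⁻¹ : ℝ) : ℂ) := by
      have : ((k + (n₀ + 1) : ℕ) : ℝ) + α = y * (1 + (k + 1) * y⁻¹) := by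
        field_simp
        rw [hy]
        push_cast
        ring
      exact_mod_cast congrArg (Complex.ofReal) this
    rw [h1, Complex.mul_cpow_ofReal_nonneg hy0.le (by positivity), Complex.cpow_neg]
    field_simp
  have hsum' : Summable fun k : ℕ => f (k + (n₀ + 1)) / (((k + (n₀ + 1) : ℕ) : ℂ) + (α : ℂ)) ^ s := by
    simp only [hterm]
    exact hsum.of_norm.mul_left _
  have hfull := (summable_nat_add_iff (f := fun n : ℕ => f n / ((n : ℂ) + (α : ℂ)) ^ s) (n₀ + 1)).1 hsum'
  rw [← hfull.sum_add_tsum_nat_add (n₀ + 1), Finset.sum_range_succ,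
    Finset.sum_eq_zero fun n hn => by rw [hlt n (Finset.mem_range.1 hn), zero_div]]
  simp only [hterm]
  rw [tsum_mul_left]
  have h2 : (∑' k : ℕ, f (k + (n₀ + 1)) / f n₀ * ((1 + (k + 1) * y⁻¹ : ℝ) : ℂ) ^ (-s)) = -1 :=
    eq_neg_of_add_eq_zero_right h
  rw [h2, hy]
  push_cast
  ring

end

/-- For `f` periodic of period `q ≥ 1`, not identically zero, and `α`
algebraic irrational with `0 < α < 1`, the series `F(s, f, α) = ∑ f(n)/(n+α)^s` has
infinitely many zeros with `Re s > 1`. -/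
theorem generalized_hurwitz_zeros_algebraic_irrational
    (f : ℕ → ℂ) (hf : f ≠ 0) (q : ℕ) (hq : 1 ≤ q) (hper : ∀ n, f (n + q) = f n)
    (α : ℝ) (hα0 : 0 < α) (hα1 : α < 1)
    (halg : IsAlgebraic ℚ α) (hirr : Irrational α) :
    {s : ℂ | 1 < s.re ∧ ∑' n : ℕ, f n / ((n : ℂ) + (α : ℂ)) ^ s = 0}.Infinite := by
  intro hfin
  obtain ⟨t₀, ht₀⟩ := (hfin.image Complex.im).bddAbove
  have hex : ∃ n, f n ≠ 0 := Function.ne_iff.1 hf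
  classical
  set n₀ := Nat.find hex with hn₀
  have hf0 : f n₀ ≠ 0 := Nat.find_spec hex
  have hlt : ∀ n < n₀, f n = 0 := fun n hn => not_not.1 (Nat.find_min hex hn)
  have hperiodic : Function.Periodic f q := hper
  have hA : ∀ n, ‖f n‖ ≤ ∑ r ∈ Finset.range q, ‖f r‖ := fun n => by
    rw [← hperiodic.map_mod_nat n]
    exact Finset.single_le_sum (f := fun r => ‖f r‖) (fun _ _ => norm_nonneg _)
      (Finset.mem_range.2 (Nat.mod_lt _ hq))
  have hy0 : 0 < (n₀ : ℝ) + α := by positivity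
  have hτalg : IsAlgebraic ℤ ((n₀ : ℝ) + α)⁻¹ :=
    (IsFractionRing.isAlgebraic_iff ℤ ℚ ℝ).2 ((isAlgebraic_natCast n₀).add halg).inv
  obtain ⟨m, hm, hint⟩ := hτalg.exists_integral_multiple
  have hL : 0 < q * m.natAbs := Nat.mul_pos hq (Int.natAbs_pos.2 hm)
  have hint' : IsIntegral ℤ (-(((q * m.natAbs : ℕ) : ℝ) * ((n₀ : ℝ) + α)⁻¹)) := by
    have h1 : -(((q * m.natAbs : ℕ) : ℝ) * ((n₀ : ℝ) + α)⁻¹) =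
        (-(q * m.sign) : ℤ) • (m • ((n₀ : ℝ) + α)⁻¹) := by
      have : ((m.natAbs : ℤ) : ℝ) = ((m.sign * m : ℤ) : ℝ) := by rw [Int.sign_mul_self_eq_natAbs]
      rw [Int.cast_natCast, Int.cast_mul] at this
      rw [zsmul_eq_mul, zsmul_eq_mul, Nat.cast_mul, this]
      push_cast
      ring
    rw [h1]
    exact hint.smul _
  obtain ⟨s, hs1, hs2, hs3⟩ := exists_one_add_genDirichlet_eq_zero (inv_pos.2 hy0)
    (a := fun k => f (k + (n₀ + 1)) / f n₀) (A := (∑ r ∈ Finset.range q, ‖f r‖) / ‖f n₀‖)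
    (fun k => by
      rw [norm_div]
      exact div_le_div_of_nonneg_right (hA _) (norm_nonneg _))
    hL (fun k hk => by
      obtain ⟨j, hj⟩ := (dvd_mul_right q m.natAbs).trans hk
      have : k + (n₀ + 1) = n₀ + j • q := by rw [smul_eq_mul, mul_comm j, ← hj]; ring
      simp only [this]
      rw [hperiodic.nsmul j n₀, div_self hf0]) hint' (hirr.natCast_add n₀).inv t₀
  have hmem := ht₀ (Set.mem_image_of_mem Complex.im (show s ∈ {s : ℂ | 1 < s.re ∧ _} from ⟨hs1,
    tsum_div_cpow_eq_zero_of_one_add_genDirichlet_eq_zero hα0 hlt hf0 hA hs1 hs3⟩))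
  exact absurd hs2 (not_lt.2 hmem)
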